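/- Fix θ > 0 and an integer m ≥ 1. Let y_1, …, y_m be real numbers with y_1 > y_2 > ⋯ > y_m > 0 and y_1 − y_2 > y_3, y_2 − y_3 > y_4, …, y_{m−2} − y_{m−1} > y_m. Let {a(N) ∈ 𝒫_N}_{N≥1} be a regular sequence of ordered tuples with limiting measure μ such that ∑_{i=1}^N a(N)_i = 0 for every N. Then lim_{N→∞} 𝓑_{a(N)}( y_1/√N, …, y_m/√N; N; θ ) = exp( (Var[μ]/(2θ)) ∑_{i=1}^m y_i² ). -/

import Mathlib

open MeasureTheory Filter Topology
open scoped ENNReal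

noncomputable section

/-- A triangular array with `M` levels: for `k : Fin M`, level `k+1` has `k+1` real entries. -/
abbrev Tri (M : ℕ) := ∀ k : Fin M, Fin (k.1 + 1) → ℝ

/-- `Interlaces u v` means `u ≺ v`, i.e. `v 1 > u 1 > v 2 > u 2 > ⋯ > v n > u n > v (n+1)`. -/
def Interlaces {n : ℕ} (u : Fin n → ℝ) (v : Fin (n + 1) → ℝ) : Prop :=
  ∀ i : Fin n, u i < v i.castSucc ∧ v i.succ < u i

/-- Level `k+1` (for `k < N`) of the configuration consisting of the triangular array `x`
(levels `1, …, N-1`) together with the top level `a` (level `N`). -/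
def lvl {N : ℕ} (a : Fin N → ℝ) (x : Tri (N - 1)) (k : ℕ) (hk : k < N) :
    Fin (k + 1) → ℝ :=
  if h : k < N - 1 then fun i => x ⟨k, h⟩ i
  else fun i => a ⟨i.1, by have := i.isLt; omega⟩

/-- The (unnormalized) density of the orbital beta process with top level `a`. -/
def obpWt (θ : ℝ) {N : ℕ} (a : Fin N → ℝ) (x : Tri (N - 1)) : ℝ :=
  ∏ k : Fin (N - 1),
    ((∏ i : Fin (k.1 + 1), ∏ j : Fin (k.1 + 1),
        if i < j then |x k i - x k j| ^ (2 - 2 * θ) else 1) *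
      ∏ s : Fin (k.1 + 2), ∏ r : Fin (k.1 + 1),
        |lvl a x (k.1 + 1) (by have := k.isLt; omega) s - x k r| ^ (θ - 1))

/-- The interlacing scheme `𝒫(a)`: arrays `(a⁽¹⁾ ≺ a⁽²⁾ ≺ ⋯ ≺ a⁽ᴺ⁻¹⁾ ≺ a)`. -/
def obpDomain {N : ℕ} (a : Fin N → ℝ) : Set (Tri (N - 1)) :=
  {x | ∀ k : Fin (N - 1),
      Interlaces (x k) (lvl a x (k.1 + 1) (by have := k.isLt; omega))}

/-- The orbital beta process `𝕄^{a,θ}` with top level `a`. -/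
def obp (θ : ℝ) {N : ℕ} (a : Fin N → ℝ) : Measure (Tri (N - 1)) :=
  (ENNReal.ofReal (∫ x in obpDomain a, obpWt θ a x))⁻¹ •
    volume.withDensity fun x =>
      ENNReal.ofReal ((obpDomain a).indicator (obpWt θ a) x)

/-- The Weyl chamber `𝒲_m = {x : x 0 ≥ x 1 ≥ ⋯}`. -/
def weylChamber (m : ℕ) : Set (Fin m → ℝ) :=
  {x | ∀ i j : Fin m, i ≤ j → x j ≤ x i}

/-- The (unnormalized) density of the Gaussian beta ensemble. -/
def gbeWt (θ : ℝ) (m : ℕ) (x : Fin m → ℝ) : ℝ :=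
  (∏ i : Fin m, ∏ j : Fin m, if i < j then |x i - x j| ^ (2 * θ) else 1) *
    Real.exp (-(θ / 2) * ∑ i, x i ^ 2)

/-- The Gaussian beta ensemble `𝕄^{(θ)}_m` of rank `m`. -/
def gbe (θ : ℝ) (m : ℕ) : Measure (Fin m → ℝ) :=
  (ENNReal.ofReal (∫ x in weylChamber m, gbeWt θ m x))⁻¹ •
    volume.withDensity fun x =>
      ENNReal.ofReal ((weylChamber m).indicator (gbeWt θ m) x)

/-- The empirical measure `μ_N = (1/N) ∑ δ_{a_i/N}`. -/
def empMeasure {N : ℕ} (a : Fin N → ℝ) : Measure ℝ :=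
  ((N : ℝ≥0∞))⁻¹ • ∑ i : Fin N, Measure.dirac (a i / N)

/-- The mean `𝔼[ν]` of a measure on `ℝ`. -/
def meanM (ν : Measure ℝ) : ℝ := ∫ t, t ∂ν

/-- The variance `Var[ν]` of a measure on `ℝ`. -/
def varM (ν : Measure ℝ) : ℝ := (∫ t, t ^ 2 ∂ν) - meanM ν ^ 2

/-- A regular sequence of ordered tuples with limiting measure `μ`. -/
def RegularSeq (a : (N : ℕ) → Fin N → ℝ) (μ : Measure ℝ) : Prop :=
  (∀ N : ℕ, 1 ≤ N → StrictAnti (a N)) ∧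
  (∃ C : ℝ, ∀ N : ℕ, ∀ hN : 1 ≤ N,
      |a N ⟨0, by omega⟩| ≤ C * N ∧ |a N ⟨N - 1, by omega⟩| ≤ C * N) ∧
  IsProbabilityMeasure μ ∧
  (∃ R : ℝ, μ {t : ℝ | |t| ≤ R}ᶜ = 0) ∧
  ∀ f : BoundedContinuousFunction ℝ ℝ,
    Tendsto (fun N : ℕ => ∫ t, f t ∂empMeasure (a N)) atTop (𝓝 (∫ t, f t ∂μ))

/-- Projection of a triangular array (with top level of size `N`) to its `m`-th level. -/
def levelProj {N : ℕ} (m : ℕ) (h1 : 1 ≤ m) (h2 : m < N) (x : Tri (N - 1)) :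
    Fin m → ℝ :=
  fun i => x ⟨m - 1, by omega⟩ ⟨i.1, (by have := i.isLt; omega : i.1 < m - 1 + 1)⟩

/-- Projection of a triangular array to its bottom `m` levels. -/
def triProj {N : ℕ} (m : ℕ) (h : m < N) (x : Tri (N - 1)) : Tri m :=
  fun k i => x ⟨k.1, by have := k.isLt; omega⟩ ⟨i.1, i.isLt⟩

/-- The top level of a triangular array with `m` levels. -/
def topLvl {m : ℕ} (hm : 1 ≤ m) (x : Tri m) : Fin m → ℝ :=
  fun i => x ⟨m - 1, by omega⟩ ⟨i.1, (by have := i.isLt; omega : i.1 < m - 1 + 1)⟩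

/-- The Gelfand–Tsetlin polytope `𝒲_{m,corners}` (weak interlacing). -/
def gtPoly (m : ℕ) : Set (Tri m) :=
  {x | ∀ k : Fin m, ∀ hk : k.1 + 1 < m, ∀ i : Fin (k.1 + 1),
      x k i ≤ x ⟨k.1 + 1, hk⟩ i.castSucc ∧ x ⟨k.1 + 1, hk⟩ i.succ ≤ x k i}

/-- Unnormalized density of the Gaussian beta corners process with `m` levels. -/
def gbcWt (θ : ℝ) {m : ℕ} (hm : 1 ≤ m) (x : Tri m) : ℝ :=
  (∏ i : Fin m, ∏ j : Fin m,
      if i < j then topLvl hm x i - topLvl hm x j else 1) *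
    Real.exp (-(θ / 2) * ∑ i, topLvl hm x i ^ 2) *
    ∏ k : Fin (m - 1),
      ((∏ i : Fin (k.1 + 1), ∏ j : Fin (k.1 + 1),
          if i < j then
            |x ⟨k.1, by have := k.isLt; omega⟩ i -
              x ⟨k.1, by have := k.isLt; omega⟩ j| ^ (2 - 2 * θ)
          else 1) *
        ∏ i : Fin (k.1 + 1), ∏ j : Fin (k.1 + 2),
          |x ⟨k.1, by have := k.isLt; omega⟩ i -
            x ⟨k.1 + 1, by have := k.isLt; omega⟩ j| ^ (θ - 1))

/-- The Gaussian beta corners process `𝕄^{(θ)}_{m,corners}`. -/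
def gbc (θ : ℝ) {m : ℕ} (hm : 1 ≤ m) : Measure (Tri m) :=
  (ENNReal.ofReal (∫ x in gtPoly m, gbcWt θ hm x))⁻¹ •
    volume.withDensity fun x =>
      ENNReal.ofReal ((gtPoly m).indicator (gbcWt θ hm) x)

/-- Strict interlacing domain `x⁽¹⁾ ≺ x⁽²⁾ ≺ ⋯ ≺ x⁽ᵐ⁾` inside `Tri m`. -/
def triDomain (m : ℕ) : Set (Tri m) :=
  {x | ∀ k : Fin m, ∀ hk : k.1 + 1 < m, Interlaces (x k) (x ⟨k.1 + 1, hk⟩)}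

/-- The θ-Gibbs conditional density of the bottom `n` levels given level `n+1`. -/
def gibbsWt (θ : ℝ) (n : ℕ) (x : Tri (n + 1)) : ℝ :=
  ((∏ k : Fin (n + 1), Real.Gamma ((k.1 + 1) * θ)) /
      Real.Gamma θ ^ ((n + 1) * (n + 2) / 2)) *
    (∏ i : Fin (n + 1), ∏ j : Fin (n + 1),
      if i < j then
        (x ⟨n, Nat.lt_succ_self n⟩ i - x ⟨n, Nat.lt_succ_self n⟩ j) ^ (1 - 2 * θ)
      else 1) *
    ∏ k : Fin n,
      ((∏ i : Fin (k.1 + 1), ∏ j : Fin (k.1 + 1),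
          if i < j then
            (x ⟨k.1, by have := k.isLt; omega⟩ i -
              x ⟨k.1, by have := k.isLt; omega⟩ j) ^ (2 - 2 * θ)
          else 1) *
        ∏ i : Fin (k.1 + 1), ∏ j : Fin (k.1 + 2),
          |x ⟨k.1, by have := k.isLt; omega⟩ i -
            x ⟨k.1 + 1, by have := k.isLt; omega⟩ j| ^ (θ - 1))

/-- `|a⁽ᵏ⁾|`, the sum of the entries of level `k` (with `a⁽⁰⁾ := 0` and `a⁽ᴺ⁾ := a`). -/
def sumLvl {N : ℕ} (a : Fin N → ℝ) (x : Tri (N - 1)) (k : ℕ) : ℝ :=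
  if k = 0 then 0
  else if h : k - 1 < N - 1 then ∑ i, x ⟨k - 1, h⟩ i
  else ∑ i, a i

/-- The multivariate Bessel function `𝓑_a(y; θ)`, defined through its combinatorial
integral representation over the interlacing scheme with top level `a`. -/
def MBF (θ : ℝ) {N : ℕ} (a : Fin N → ℝ) (y : Fin N → ℂ) : ℂ :=
  ((((∏ k : Fin N, Real.Gamma ((k.1 + 1) * θ)) /
        Real.Gamma θ ^ (N * (N + 1) / 2)) : ℝ) : ℂ) *
    (((∏ i : Fin N, ∏ j : Fin N,
        if i < j then |a i - a j| ^ (1 - 2 * θ) else 1) : ℝ) : ℂ) *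
    ∫ x in obpDomain a,
      Complex.exp (∑ k : Fin N,
        y k * ((sumLvl a x (k.1 + 1) - sumLvl a x k.1 : ℝ) : ℂ)) *
      ((obpWt θ a x : ℝ) : ℂ)

/-- Padding of an `m`-tuple with `N - m` zeros: `(y_1, …, y_m, 0^{N-m})`. -/
def padC {m N : ℕ} (_h : m ≤ N) (y : Fin m → ℂ) : Fin N → ℂ :=
  fun k => if h' : k.1 < m then y ⟨k.1, h'⟩ else 0

/-- Integrand `exp(yz) ∏ (z - a_i)^{-θ}` of the left-directed contour integral,
with `w^{-θ} := exp(-θ Log w)` for the principal branch `Log`. -/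
def contourFnL (θ : ℝ) {N : ℕ} (a : Fin N → ℝ) (y z : ℂ) : ℂ :=
  Complex.exp (y * z) *
    ∏ i : Fin N, Complex.exp (-(θ : ℂ) * Complex.log (z - (a i : ℂ)))

/-- Integrand `exp(-yz) ∏ (a_i - z)^{-θ}` of the right-directed contour integral. -/
def contourFnR (θ : ℝ) {N : ℕ} (a : Fin N → ℝ) (y z : ℂ) : ℂ :=
  Complex.exp (-y * z) *
    ∏ i : Fin N, Complex.exp (-(θ : ℂ) * Complex.log ((a i : ℂ) - z))

/-- `(y_1, …, y_m, y_{m+1})` with `y_{m+1} := y - (z_1 + ⋯ + z_m)`. -/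
def Yext {m : ℕ} (ys : Fin m → ℝ) (y : ℝ) (z : Fin m → ℝ) : Fin (m + 1) → ℝ :=
  fun j => if h : j.1 < m then ys ⟨j.1, h⟩ else y - ∑ i, z i

/-- `(z_1, …, z_m, z_{m+1})` with `z_{m+1} := 0`. -/
def Zext {m : ℕ} (z : Fin m → ℝ) : Fin (m + 1) → ℝ :=
  fun j => if h : j.1 < m then z ⟨j.1, h⟩ else 0

/-- The function `G_{θ, y_1, …, y_m, y}(z_1, …, z_m)`. -/
def Gfn (θ : ℝ) {m : ℕ} (ys : Fin m → ℝ) (y : ℝ) (z : Fin m → ℝ) : ℝ :=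
  (∏ i : Fin m, ∏ j : Fin m,
      if i < j then (ys i - ys j + z i) ^ (θ - 1) else 1) *
    ∏ i : Fin (m + 1), ∏ j : Fin (m + 1),
      if i < j then
        (Yext ys y z i - Yext ys y z j + Zext z i - Zext z j) *
          (Yext ys y z i - Yext ys y z j - Zext z j) ^ (θ - 1)
      else 1

/-- The function `F_{y_1, …, y_m, y}(z_1, …, z_m)`. -/
def Ffn {m : ℕ} (ys : Fin m → ℝ) (y : ℝ) (z : Fin m → ℝ) : ℝ :=
  (1 - (∑ i, z i) / y) * ∏ i, (1 + z i / ys i)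


section MultivariateBessel

/-- The absolute value of the Vandermonde product of a tuple. -/
def vand {n : ℕ} (v : Fin n → ℝ) : ℝ :=
  ∏ i : Fin n, ∏ j : Fin n, if i < j then |v i - v j| else 1

/-- The product of all distances between entries of two tuples. -/
def cross {m n : ℕ} (u : Fin m → ℝ) (v : Fin n → ℝ) : ℝ :=
  ∏ s : Fin m, ∏ r : Fin n, |u s - v r|

theorem vand_nonneg {n : ℕ} (v : Fin n → ℝ) : 0 ≤ vand v :=
  Finset.prod_nonneg fun _ _ => Finset.prod_nonneg fun _ _ => by split_ifs <;> positivity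

theorem vand_pos {n : ℕ} {v : Fin n → ℝ} (hv : Function.Injective v) : 0 < vand v := by
  refine Finset.prod_pos fun i _ => Finset.prod_pos fun j _ => ?_
  split_ifs with h
  · exact abs_pos.2 (sub_ne_zero.2 fun e => h.ne (hv e))
  · exact one_pos

theorem cross_nonneg {m n : ℕ} (u : Fin m → ℝ) (v : Fin n → ℝ) : 0 ≤ cross u v :=
  Finset.prod_nonneg fun _ _ => Finset.prod_nonneg fun _ _ => abs_nonneg _

theorem vand_eq_abs_det {n : ℕ} (v : Fin n → ℝ) : vand v = |(Matrix.vandermonde v).det| := by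
  rw [Matrix.det_vandermonde, Finset.abs_prod, vand]
  refine Finset.prod_congr rfl fun i _ => ?_
  rw [Finset.abs_prod, ← Finset.prod_filter]
  refine Finset.prod_congr (by ext; simp) fun j _ => abs_sub_comm _ _

theorem vand_sq {n : ℕ} (v : Fin n → ℝ) :
    vand v ^ 2 = ∏ i : Fin n, ∏ j ∈ Finset.univ.erase i, |v i - v j| := by
  have h1 : vand v = ∏ i : Fin n, ∏ j : Fin n, if j < i then |v i - v j| else 1 := by
    rw [vand, Finset.prod_comm]
    refine Finset.prod_congr rfl fun i _ => Finset.prod_congr rfl fun j _ => ?_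
    rw [abs_sub_comm]
  rw [sq]
  nth_rewrite 1 [h1]
  rw [vand, ← Finset.prod_mul_distrib]
  refine Finset.prod_congr rfl fun i _ => ?_
  rw [← Finset.prod_mul_distrib, ← Finset.prod_erase (a := i) _ (by simp)]
  refine Finset.prod_congr rfl fun j hj => ?_
  rcases lt_or_gt_of_ne (Finset.ne_of_mem_erase hj) with h | h
  · simp [h, h.not_gt]
  · simp [h, h.not_gt]

theorem abs_det_prod_erase_sub {n : ℕ} (x : Fin n → ℝ) {b : Fin n → ℝ}
    (hb : Function.Injective b) :
    |(Matrix.of fun i l : Fin n => ∏ j ∈ Finset.univ.erase l, (x i - b j)).det| =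
      vand x * vand b := by
  have key : ∀ x : Fin n → ℝ,
      (Matrix.of fun i l : Fin n => ∏ j ∈ Finset.univ.erase l, (x i - b j)) =
        Matrix.vandermonde x * Matrix.of (fun i l : Fin n =>
          (∏ j ∈ Finset.univ.erase l, (Polynomial.X - Polynomial.C (b j))).coeff i) := by
    intro x
    ext i l
    have hdeg : (∏ j ∈ Finset.univ.erase l,
        (Polynomial.X - Polynomial.C (b j))).natDegree < n := by
      rw [Polynomial.natDegree_prod_of_monic _ _ fun j _ => Polynomial.monic_X_sub_C _]
      have := l.pos
      simp; omega
    have := Polynomial.eval_eq_sum_range' hdeg (x i)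
    rw [Polynomial.eval_prod] at this
    simp only [Polynomial.eval_sub, Polynomial.eval_X, Polynomial.eval_C] at this
    rw [Matrix.of_apply, this, Finset.sum_range, Matrix.mul_apply]
    refine Finset.sum_congr rfl fun k _ => ?_
    simp [Matrix.vandermonde_apply, mul_comm]
  have hdiag : (Matrix.of fun i l : Fin n => ∏ j ∈ Finset.univ.erase l, (b i - b j)) =
      Matrix.diagonal fun i => ∏ j ∈ Finset.univ.erase i, (b i - b j) := by
    ext i l
    rw [Matrix.diagonal_apply, Matrix.of_apply]
    split_ifs with h
    · rw [h]
    · exact Finset.prod_eq_zero (Finset.mem_erase.2 ⟨h, Finset.mem_univ i⟩) (sub_self _)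
  have h2 := congrArg (fun M => |M.det|) (key b)
  simp only [hdiag, Matrix.det_mul, Matrix.det_diagonal, abs_mul, ← vand_eq_abs_det] at h2
  rw [Finset.abs_prod] at h2
  simp only [Finset.abs_prod] at h2
  rw [← vand_sq, sq] at h2
  have h3 := mul_left_cancel₀ (vand_pos hb).ne' h2
  rw [key x, Matrix.det_mul, abs_mul, ← vand_eq_abs_det, ← h3]

/-- The set of tuples `b` with `b 0 > z 0 > b 1 > z 1 > ⋯`. -/
def aboveSet {n : ℕ} (z : Fin n → ℝ) : Set (Fin n → ℝ) :=
  {b | (∀ i, z i < b i) ∧ ∀ i j, i < j → b j < z i}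

/-- The residue coordinates of `b` relative to `z`. -/
def gam {n : ℕ} (z b : Fin n → ℝ) (i : Fin n) : ℝ :=
  -(∏ j, (z i - b j)) / ∏ j ∈ Finset.univ.erase i, (z i - z j)

variable {n : ℕ}

theorem strictAnti_of_mem_aboveSet {z b : Fin n → ℝ} (hb : b ∈ aboveSet z) : StrictAnti b :=
  fun i j hij => (hb.2 i j hij).trans (hb.1 i)

theorem prod_erase_sub_ne_zero {z : Fin n → ℝ} (hz : Function.Injective z) (i : Fin n) :
    ∏ j ∈ Finset.univ.erase i, (z i - z j) ≠ 0 :=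
  Finset.prod_ne_zero_iff.2 fun _ hj =>
    sub_ne_zero.2 fun e => Finset.ne_of_mem_erase hj (hz e).symm

theorem gam_eq (z b : Fin n → ℝ) (i : Fin n) :
    gam z b i = (b i - z i) * ∏ j ∈ Finset.univ.erase i, ((z i - b j) / (z i - z j)) := by
  rw [gam, Finset.prod_div_distrib, ← Finset.mul_prod_erase _ _ (Finset.mem_univ i)]
  ring

theorem gam_pos {z b : Fin n → ℝ} (hz : StrictAnti z) (hb : b ∈ aboveSet z) (i : Fin n) :
    0 < gam z b i := by
  rw [gam_eq]
  refine mul_pos (sub_pos.2 (hb.1 i)) (Finset.prod_pos fun j hj => ?_)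
  rcases lt_or_gt_of_ne (Finset.ne_of_mem_erase hj) with h | h
  · exact div_pos_of_neg_of_neg (sub_neg.2 ((hz h).trans (hb.1 j))) (sub_neg.2 (hz h))
  · exact div_pos (sub_pos.2 (hb.2 i j h)) (sub_pos.2 (hz h))

theorem prod_gam {z b : Fin n → ℝ} (hz : StrictAnti z) (hb : b ∈ aboveSet z) :
    ∏ i, gam z b i = cross z b / vand z ^ 2 := by
  have : ∏ i, gam z b i = ∏ i, |gam z b i| :=
    Finset.prod_congr rfl fun i _ => (abs_of_pos (gam_pos hz hb i)).symm
  rw [this, vand_sq, cross, ← Finset.prod_div_distrib]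
  refine Finset.prod_congr rfl fun i _ => ?_
  rw [gam, abs_div, abs_neg, Finset.abs_prod, Finset.abs_prod]

theorem eq_of_monic_of_eval_eq {p q : Polynomial ℝ} (hp : p.Monic) (hq : q.Monic)
    (hpn : p.natDegree = n) (hqn : q.natDegree = n) {z : Fin n → ℝ}
    (hz : Function.Injective z) (h : ∀ i, p.eval (z i) = q.eval (z i)) : p = q := by
  rcases Nat.eq_zero_or_pos n with rfl | hn
  · rw [Polynomial.eq_one_of_monic_natDegree_zero hp hpn,
      Polynomial.eq_one_of_monic_natDegree_zero hq hqn]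
  refine Polynomial.eq_of_degree_sub_lt_of_eval_index_eq (s := Finset.univ) (v := z)
    hz.injOn ?_ fun i _ => h i
  have := Polynomial.degree_sub_lt_left (p := p) (q := q)
    (by rw [Polynomial.degree_eq_natDegree hp.ne_zero, Polynomial.degree_eq_natDegree hq.ne_zero,
      hpn, hqn]) hp.ne_zero (by rw [hp.leadingCoeff, hq.leadingCoeff])
  rwa [Polynomial.degree_eq_natDegree hp.ne_zero, hpn, ← Fintype.card_fin n,
    ← Finset.card_univ] at this

theorem prod_X_sub_C_monic (b : Fin n → ℝ) :
    (∏ j, (Polynomial.X - Polynomial.C (b j))).Monic :=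
  Polynomial.monic_prod_of_monic _ _ fun _ _ => Polynomial.monic_X_sub_C _

theorem natDegree_prod_X_sub_C (b : Fin n → ℝ) :
    (∏ j, (Polynomial.X - Polynomial.C (b j))).natDegree = n := by
  rw [Polynomial.natDegree_prod_of_monic _ _ fun _ _ => Polynomial.monic_X_sub_C _]
  simp

/-- The monic polynomial with residue coordinates `g` relative to `z`. -/
def resPoly (z g : Fin n → ℝ) : Polynomial ℝ :=
  ∏ j, (Polynomial.X - Polynomial.C (z j)) -
    ∑ i, Polynomial.C (g i) * ∏ j ∈ Finset.univ.erase i, (Polynomial.X - Polynomial.C (z j))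

theorem degree_sum_prod_erase_lt (hn : 0 < n) (z g : Fin n → ℝ) :
    (∑ i, Polynomial.C (g i) *
      ∏ j ∈ Finset.univ.erase i, (Polynomial.X - Polynomial.C (z j))).degree < n := by
  refine (Polynomial.degree_sum_le _ _).trans_lt ((Finset.sup_lt_iff (by simp)).2 fun i _ => ?_)
  refine (Polynomial.degree_mul_le _ _).trans_lt ((add_le_add_left Polynomial.degree_C_le _).trans_lt ?_)
  rw [zero_add, Polynomial.degree_prod]
  simp only [Polynomial.degree_X_sub_C, Finset.sum_const, Finset.card_erase_of_mem
    (Finset.mem_univ i), Finset.card_univ, Fintype.card_fin, nsmul_eq_mul, mul_one]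
  exact_mod_cast Nat.sub_lt hn one_pos

theorem resPoly_monic (z g : Fin n → ℝ) : (resPoly z g).Monic := by
  rcases Nat.eq_zero_or_pos n with rfl | hn
  · simp [resPoly]
  refine (prod_X_sub_C_monic z).sub_of_left ?_
  rw [Polynomial.degree_eq_natDegree (prod_X_sub_C_monic z).ne_zero, natDegree_prod_X_sub_C]
  exact degree_sum_prod_erase_lt hn z g

theorem natDegree_resPoly (z g : Fin n → ℝ) : (resPoly z g).natDegree = n := by
  rcases Nat.eq_zero_or_pos n with rfl | hn
  · simp [resPoly]
  rw [resPoly, Polynomial.natDegree_eq_of_degree_eq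
    (Polynomial.degree_sub_eq_left_of_degree_lt _), natDegree_prod_X_sub_C]
  rw [Polynomial.degree_eq_natDegree (prod_X_sub_C_monic z).ne_zero, natDegree_prod_X_sub_C]
  exact degree_sum_prod_erase_lt hn z g

theorem eval_resPoly (z g : Fin n → ℝ) (x : ℝ) : (resPoly z g).eval x =
    ∏ j, (x - z j) - ∑ i, g i * ∏ j ∈ Finset.univ.erase i, (x - z j) := by
  simp [resPoly, Polynomial.eval_prod, Polynomial.eval_finsetSum]

theorem eval_resPoly_node (z g : Fin n → ℝ) (i : Fin n) : (resPoly z g).eval (z i) =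
    -(g i * ∏ j ∈ Finset.univ.erase i, (z i - z j)) := by
  rw [eval_resPoly, Finset.prod_eq_zero (Finset.mem_univ i) (sub_self _), zero_sub, neg_inj]
  refine Finset.sum_eq_single i (fun k _ hk => ?_) (by simp)
  rw [Finset.prod_eq_zero (Finset.mem_erase.2 ⟨hk.symm, Finset.mem_univ i⟩) (sub_self _), mul_zero]

theorem prod_X_sub_C_eq_resPoly {z : Fin n → ℝ} (hz : Function.Injective z) (b : Fin n → ℝ) :
    ∏ j, (Polynomial.X - Polynomial.C (b j)) = resPoly z (gam z b) := by
  refine eq_of_monic_of_eval_eq (prod_X_sub_C_monic b) (resPoly_monic z _)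
    (natDegree_prod_X_sub_C b) (natDegree_resPoly z _) hz fun i => ?_
  rw [eval_resPoly_node, Polynomial.eval_prod, gam, div_mul_cancel₀ _ (prod_erase_sub_ne_zero hz i)]
  simp

theorem prod_sub_eq_gam {z : Fin n → ℝ} (hz : Function.Injective z) (b : Fin n → ℝ) (x : ℝ) :
    ∏ j, (x - b j) = ∏ j, (x - z j) -
      ∑ i, gam z b i * ∏ j ∈ Finset.univ.erase i, (x - z j) := by
  rw [← eval_resPoly, ← prod_X_sub_C_eq_resPoly hz b, Polynomial.eval_prod]
  simp

theorem gam_injOn {z : Fin n → ℝ} (hz : Function.Injective z) :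
    Set.InjOn (gam z) (aboveSet z) := by
  intro b hb b' hb' h
  have hp := (prod_X_sub_C_eq_resPoly hz b).trans
    ((congrArg (resPoly z) h).trans (prod_X_sub_C_eq_resPoly hz b').symm)
  funext j
  have h0 := congrArg (Polynomial.eval (b j)) hp
  simp only [Polynomial.eval_prod, Polynomial.eval_sub, Polynomial.eval_X,
    Polynomial.eval_C] at h0
  rw [Finset.prod_eq_zero (Finset.mem_univ j) (sub_self _), eq_comm, Finset.prod_eq_zero_iff] at h0
  obtain ⟨l, -, hl⟩ := h0
  have hl : b j = b' l := sub_eq_zero.1 hl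
  rcases lt_trichotomy j l with h | h | h
  · exact absurd hl ((hb'.2 j l h).trans (hb.1 j)).ne'
  · rw [hl, h]
  · exact absurd hl ((hb.2 l j h).trans (hb'.1 l)).ne

theorem exists_gam_eq {z : Fin n → ℝ} (hz : StrictAnti z) {g : Fin n → ℝ} (hg : ∀ i, 0 < g i) :
    ∃ b ∈ aboveSet z, gam z b = g := by
  have hroot : ∀ i : Fin n, ∃ t, z i < t ∧ (∀ j < i, t < z j) ∧ (resPoly z g).eval t = 0 := by
    intro i
    have hcont : Continuous fun t => (resPoly z g).eval t := (resPoly z g).continuous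
    by_cases hi : i.1 = 0
    · have h1 : (resPoly z g).eval (z i) < 0 := by
        rw [eval_resPoly_node, neg_neg_iff_pos]
        refine mul_pos (hg i) (Finset.prod_pos fun j hj => sub_pos.2 (hz ?_))
        have := Finset.ne_of_mem_erase hj
        rw [Fin.lt_def]; rw [Ne, Fin.ext_iff] at this; omega
      have htop : Tendsto (fun t => (resPoly z g).eval t) atTop atTop := by
        refine Polynomial.tendsto_atTop_of_leadingCoeff_nonneg _ ?_ ?_
        · rw [Polynomial.degree_eq_natDegree (resPoly_monic z g).ne_zero, natDegree_resPoly]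
          exact_mod_cast i.pos
        · rw [(resPoly_monic z g).leadingCoeff]; exact zero_le_one
      obtain ⟨T, hT1, hT2⟩ := ((htop.eventually_gt_atTop 0).and (eventually_gt_atTop (z i))).exists
      obtain ⟨t, ht, ht0⟩ := intermediate_value_Ioo hT2.le hcont.continuousOn ⟨h1, hT1⟩
      exact ⟨t, ht.1, fun j hj => absurd (Fin.lt_def.1 hj) (by omega), ht0⟩
    · set k : Fin n := ⟨i.1 - 1, by omega⟩ with hk
      have hki : k < i := by rw [Fin.lt_def]; simp [hk]; omega
      have hprod : (resPoly z g).eval (z i) * (resPoly z g).eval (z k) < 0 := by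
        rw [eval_resPoly_node, eval_resPoly_node,
          ← Finset.mul_prod_erase (Finset.univ.erase i) _
            (Finset.mem_erase.2 ⟨hki.ne, Finset.mem_univ k⟩),
          ← Finset.mul_prod_erase (Finset.univ.erase k) _
            (Finset.mem_erase.2 ⟨hki.ne', Finset.mem_univ i⟩), Finset.erase_right_comm]
        have hp : 0 < (∏ j ∈ (Finset.univ.erase k).erase i, (z i - z j)) *
            ∏ j ∈ (Finset.univ.erase k).erase i, (z k - z j) := by
          rw [← Finset.prod_mul_distrib]
          refine Finset.prod_pos fun j hj => ?_
          have hji := Finset.ne_of_mem_erase hj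
          have hjk := Finset.ne_of_mem_erase (Finset.mem_of_mem_erase hj)
          rcases lt_or_gt_of_ne hji with h | h
          · have : j < k := by
              rw [Ne, Fin.ext_iff] at hjk; rw [Fin.lt_def] at h ⊢; simp [hk] at hjk ⊢; omega
            exact mul_pos_of_neg_of_neg (sub_neg.2 (hz h)) (sub_neg.2 (hz this))
          · exact mul_pos (sub_pos.2 (hz h)) (sub_pos.2 (hz (hki.trans h)))
        have hd : 0 < z k - z i := sub_pos.2 (hz hki)
        have := mul_pos (mul_pos (mul_pos (hg i) (hg k)) (mul_pos hd hd)) hp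
        nlinarith [this]
      have hlt := hz hki
      obtain ⟨t, ht, ht0⟩ : ∃ t ∈ Set.Ioo (z i) (z k), (resPoly z g).eval t = 0 := by
        rcases mul_neg_iff.1 hprod with h | h
        · exact intermediate_value_Ioo' hlt.le hcont.continuousOn ⟨h.2, h.1⟩
        · exact intermediate_value_Ioo hlt.le hcont.continuousOn ⟨h.1, h.2⟩
      refine ⟨t, ht.1, fun j hj => ht.2.trans_le (hz.antitone ?_), ht0⟩
      rw [Fin.lt_def] at hj; rw [Fin.le_def]; simp [hk]; omega
  choose b hb1 hb2 hb3 using hroot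
  have hb : b ∈ aboveSet z := ⟨hb1, fun i j hij => hb2 j i hij⟩
  refine ⟨b, hb, ?_⟩
  have heq : ∏ j, (Polynomial.X - Polynomial.C (b j)) = resPoly z g := by
    refine eq_of_monic_of_eval_eq (prod_X_sub_C_monic b) (resPoly_monic z _)
      (natDegree_prod_X_sub_C b) (natDegree_resPoly z _)
      (strictAnti_of_mem_aboveSet hb).injective fun i => ?_
    rw [hb3, Polynomial.eval_prod]
    exact Finset.prod_eq_zero (Finset.mem_univ i) (by simp)
  funext i
  have := congrArg (Polynomial.eval (z i)) heq
  rw [eval_resPoly_node, Polynomial.eval_prod] at this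
  simp only [Polynomial.eval_sub, Polynomial.eval_X, Polynomial.eval_C] at this
  rw [gam, this, neg_neg, mul_div_cancel_right₀ _ (prod_erase_sub_ne_zero hz.injective i)]

theorem gam_image {z : Fin n → ℝ} (hz : StrictAnti z) :
    gam z '' aboveSet z = {g | ∀ i, 0 < g i} := by
  ext g
  constructor
  · rintro ⟨b, hb, rfl⟩
    exact gam_pos hz hb
  · exact fun hg => exists_gam_eq hz hg

theorem isOpen_aboveSet (z : Fin n → ℝ) : IsOpen (aboveSet z) := by
  have : aboveSet z = (⋂ i, {b | z i < b i}) ∩ ⋂ i, ⋂ j, ⋂ (_ : i < j), {b | b j < z i} := by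
    ext b; simp [aboveSet]
  rw [this]
  refine (isOpen_iInter_of_finite fun i => isOpen_lt continuous_const (continuous_apply i)).inter
    (isOpen_iInter_of_finite fun i => isOpen_iInter_of_finite fun j =>
      isOpen_iInter_of_finite fun _ => isOpen_lt (continuous_apply j) continuous_const)

/-- The Jacobian matrix of `gam z`. -/
def gamJac (z b : Fin n → ℝ) : Matrix (Fin n) (Fin n) ℝ :=
  Matrix.of fun i l => (∏ j ∈ Finset.univ.erase i, (z i - z j))⁻¹ *
    ∏ j ∈ Finset.univ.erase l, (z i - b j)

theorem hasFDerivAt_gam (z b : Fin n → ℝ) :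
    HasFDerivAt (gam z) (LinearMap.toContinuousLinearMap (Matrix.toLin' (gamJac z b))) b := by
  rw [hasFDerivAt_pi']
  intro i
  have h1 : ∀ j ∈ (Finset.univ : Finset (Fin n)), HasFDerivAt (fun b : Fin n → ℝ => z i - b j)
      (-(ContinuousLinearMap.proj j : (Fin n → ℝ) →L[ℝ] ℝ)) b := fun j _ =>
    (hasFDerivAt_apply j b).const_sub (z i)
  have h2 := ((HasFDerivAt.finsetProd h1).neg).mul_const
    (∏ j ∈ Finset.univ.erase i, (z i - z j))⁻¹
  refine HasFDerivAt.congr_fderiv h2 ?_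
  ext v
  simp [gamJac, Matrix.mulVec, dotProduct, Finset.mul_sum]
  refine Finset.sum_congr rfl fun j _ => by ring

theorem abs_det_gamJac {z b : Fin n → ℝ} (hz : StrictAnti z) (hb : Function.Injective b) :
    |(gamJac z b).det| = vand b / vand z := by
  have : gamJac z b = Matrix.diagonal (fun i => (∏ j ∈ Finset.univ.erase i, (z i - z j))⁻¹) *
      Matrix.of fun i l : Fin n => ∏ j ∈ Finset.univ.erase l, (z i - b j) := by
    ext i l; simp [gamJac, Matrix.diagonal_mul]
  rw [this, Matrix.det_mul, abs_mul, abs_det_prod_erase_sub z hb, Matrix.det_diagonal,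
    Finset.prod_inv_distrib, abs_inv, Finset.abs_prod]
  simp only [Finset.abs_prod]
  rw [← vand_sq]
  have := (vand_pos hz.injective).ne'
  field_simp

theorem lintegral_pos_orthant_eq {z : Fin n → ℝ} (hz : StrictAnti z) (F : (Fin n → ℝ) → ℝ≥0∞) :
    ∫⁻ g in {g : Fin n → ℝ | ∀ i, 0 < g i}, F g =
      ∫⁻ b in aboveSet z, ENNReal.ofReal (vand b / vand z) * F (gam z b) := by
  rw [← gam_image hz, lintegral_image_eq_lintegral_abs_det_fderiv_mul volume
    (isOpen_aboveSet z).measurableSet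
    (fun b _ => (hasFDerivAt_gam z b).hasFDerivWithinAt) (gam_injOn hz.injective)]
  refine setLIntegral_congr_fun (isOpen_aboveSet z).measurableSet fun b hb => ?_
  simp only [LinearMap.det_toContinuousLinearMap, LinearMap.det_toLin']
  rw [abs_det_gamJac hz (strictAnti_of_mem_aboveSet hb).injective]

theorem lintegral_pi_cons {F : (Fin (n + 1) → ℝ) → ℝ≥0∞} (hF : Measurable F) :
    ∫⁻ g, F g = ∫⁻ x : ℝ, ∫⁻ h : Fin n → ℝ, F (Fin.cons x h) := by
  rw [← (volume_preserving_piFinSuccAbove (fun _ : Fin (n + 1) => ℝ) 0).symm.lintegral_comp hF]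
  rw [Measure.volume_eq_prod, lintegral_prod _ (by fun_prop)]
  simp [MeasurableEquiv.piFinSuccAbove, Fin.consEquiv]

theorem lintegral_pi_scale {l : Fin n → ℝ} (hl : ∀ i, 0 < l i) {F : (Fin n → ℝ) → ℝ≥0∞}
    (hF : Measurable F) :
    ∫⁻ h, F h = ENNReal.ofReal (∏ i, l i) * ∫⁻ h : Fin n → ℝ, F (fun i => l i * h i) := by
  have hdet : (Matrix.diagonal l).det = ∏ i, l i := Matrix.det_diagonal
  have hpos : 0 < ∏ i, l i := Finset.prod_pos fun i _ => hl i
  have := Real.smul_map_diagonal_volume_pi (D := l) (by rw [hdet]; exact hpos.ne')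
  conv_lhs => rw [← this]
  rw [lintegral_smul_measure, lintegral_map hF (LinearMap.continuous_of_finiteDimensional _).measurable,
    hdet, abs_of_pos hpos, smul_eq_mul]
  congr 1
  refine lintegral_congr fun h => congrArg F ?_
  ext i
  simp [Matrix.mulVec_diagonal]

/-- The Dixon–Anderson weights of `b` relative to `c`. -/
def dw (c : Fin (n + 1) → ℝ) (b : Fin n → ℝ) (i : Fin (n + 1)) : ℝ :=
  (∏ j, (c i - b j)) / ∏ l ∈ Finset.univ.erase i, (c i - c l)

theorem prod_erase_zero (f : Fin (n + 1) → ℝ) :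
    ∏ l ∈ Finset.univ.erase 0, f l = ∏ l : Fin n, f l.succ := by
  have h : (Finset.univ.erase (0 : Fin (n + 1))) = Finset.univ.map (Fin.succEmb n) := by
    ext i; cases i using Fin.cases <;> simp
  simp [h]

theorem prod_erase_succ (f : Fin (n + 1) → ℝ) (i : Fin n) :
    ∏ l ∈ Finset.univ.erase i.succ, f l = f 0 * ∏ l ∈ Finset.univ.erase i, f l.succ := by
  rw [← Finset.mul_prod_erase _ _ (Finset.mem_erase.2 ⟨(Fin.succ_ne_zero i).symm, Finset.mem_univ _⟩)]
  congr 1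
  have h : ((Finset.univ.erase i.succ).erase (0 : Fin (n + 1))) =
      (Finset.univ.erase i).map (Fin.succEmb n) := by
    ext j; cases j using Fin.cases <;> simp
  rw [h, Finset.prod_map]
  simp

theorem dw_succ (c : Fin (n + 1) → ℝ) (b : Fin n → ℝ) (i : Fin n) :
    dw c b i.succ = gam (fun i => c i.succ) b i / (c 0 - c i.succ) := by
  rw [dw, gam, prod_erase_succ, div_div, mul_comm, ← neg_sub (c 0), mul_neg, div_neg, neg_div]

theorem dw_zero {c : Fin (n + 1) → ℝ} (hc : StrictAnti c) (b : Fin n → ℝ) :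
    dw c b 0 = 1 - ∑ i : Fin n, dw c b i.succ := by
  have hz : StrictAnti (fun i : Fin n => c i.succ) := hc.comp_strictMono Fin.strictMono_succ
  have hne : ∀ i : Fin n, c 0 - c i.succ ≠ 0 := fun i => (sub_pos.2 (hc (Fin.succ_pos i))).ne'
  have hP : ∏ j : Fin n, (c 0 - c j.succ) ≠ 0 := Finset.prod_ne_zero_iff.2 fun i _ => hne i
  rw [dw, prod_erase_zero, prod_sub_eq_gam hz.injective, sub_div, div_self hP, Finset.sum_div]
  congr 1
  refine Finset.sum_congr rfl fun i _ => ?_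
  rw [dw_succ, ← Finset.mul_prod_erase _ _ (Finset.mem_univ i), mul_div_mul_right]
  exact Finset.prod_ne_zero_iff.2 fun i _ => hne i

theorem sum_dw {c : Fin (n + 1) → ℝ} (hc : StrictAnti c) (b : Fin n → ℝ) :
    ∑ i, dw c b i = 1 := by
  rw [Fin.sum_univ_succ, dw_zero hc]; ring

theorem interlaces_iff_aboveSet {c : Fin (n + 1) → ℝ} (hc : StrictAnti c) (b : Fin n → ℝ) :
    Interlaces b c ↔ b ∈ aboveSet (fun i => c i.succ) ∧ 0 < dw c b 0 := by
  have hpos : 0 < ∏ l : Fin n, (c 0 - c l.succ) :=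
    Finset.prod_pos fun i _ => sub_pos.2 (hc (Fin.succ_pos i))
  rw [dw, prod_erase_zero, div_pos_iff_of_pos_right hpos]
  constructor
  · intro h
    refine ⟨⟨fun i => (h i).2, fun i j hij => (h j).1.trans_le (hc.antitone ?_)⟩,
      Finset.prod_pos fun j _ => sub_pos.2 ((h j).1.trans_le (hc.antitone (Fin.zero_le _)))⟩
    rw [Fin.le_def]; rw [Fin.lt_def] at hij; simp; omega
  · rintro ⟨h1, h2⟩ i
    refine ⟨?_, h1.1 i⟩
    obtain _ | n := n
    · exact i.elim0
    cases i using Fin.cases with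
    | zero =>
      rw [Fin.prod_univ_succ] at h2
      refine sub_pos.1 (pos_of_mul_pos_left h2 (Finset.prod_nonneg fun j _ => ?_))
      exact (sub_pos.2 ((h1.2 0 j.succ (Fin.succ_pos j)).trans (hc (Fin.succ_pos _)))).le
    | succ i =>
      have := h1.2 i.castSucc i.succ (Fin.castSucc_lt_succ)
      simpa using this

theorem dw_pos {c : Fin (n + 1) → ℝ} (hc : StrictAnti c) {b : Fin n → ℝ} (hb : Interlaces b c)
    (i : Fin (n + 1)) : 0 < dw c b i := by
  rw [interlaces_iff_aboveSet hc] at hb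
  cases i using Fin.cases with
  | zero => exact hb.2
  | succ i =>
    rw [dw_succ]
    exact div_pos (gam_pos (hc.comp_strictMono Fin.strictMono_succ) hb.1 i)
      (sub_pos.2 (hc (Fin.succ_pos i)))

theorem vand_succ (c : Fin (n + 1) → ℝ) :
    vand c = (∏ l : Fin n, |c 0 - c l.succ|) * vand (fun i => c i.succ) := by
  rw [vand, Fin.prod_univ_succ, Fin.prod_univ_succ, vand]
  simp only [lt_self_iff_false, if_false, one_mul, Fin.succ_pos, if_true]
  congr 1
  refine Finset.prod_congr rfl fun i _ => ?_
  rw [Fin.prod_univ_succ]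
  simp

theorem prod_dw {c : Fin (n + 1) → ℝ} (hc : StrictAnti c) {b : Fin n → ℝ} (hb : Interlaces b c) :
    ∏ i, dw c b i = cross c b / vand c ^ 2 := by
  have : ∏ i, dw c b i = ∏ i, |dw c b i| :=
    Finset.prod_congr rfl fun i _ => (abs_of_pos (dw_pos hc hb i)).symm
  rw [this, vand_sq, cross, ← Finset.prod_div_distrib]
  refine Finset.prod_congr rfl fun i _ => ?_
  rw [dw, abs_div, Finset.abs_prod, Finset.abs_prod]

theorem continuous_dw (c : Fin (n + 1) → ℝ) : Continuous (dw c) := by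
  unfold dw; fun_prop

theorem continuous_vand : Continuous (vand (n := n)) := by
  unfold vand
  refine continuous_finsetProd _ fun i _ => continuous_finsetProd _ fun j _ => ?_
  split_ifs <;> fun_prop

theorem isOpen_interlaces (c : Fin (n + 1) → ℝ) : IsOpen {b | Interlaces b c} := by
  have : {b | Interlaces b c} = ⋂ i, {b : Fin n → ℝ | b i < c i.castSucc} ∩ {b | c i.succ < b i} := by
    ext b; simp [Interlaces]
  rw [this]
  exact isOpen_iInter_of_finite fun i => (isOpen_lt (continuous_apply i) continuous_const).inter
    (isOpen_lt continuous_const (continuous_apply i))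

theorem measurableSet_pos_orthant : MeasurableSet {g : Fin n → ℝ | ∀ i, 0 < g i} := by
  simp only [Set.ofPred_forall]
  exact MeasurableSet.iInter fun i => measurableSet_lt measurable_const (measurable_pi_apply i)

theorem lintegral_pos_orthant_eq_simplex {c : Fin (n + 1) → ℝ} (hc : StrictAnti c)
    {F : (Fin (n + 1) → ℝ) → ℝ≥0∞} (hF : Measurable F) :
    ∫⁻ g in {g : Fin (n + 1) → ℝ | ∀ i, 0 < g i}, F g =
      ∫⁻ τ in Set.Ioi (0 : ℝ), ENNReal.ofReal (τ ^ n) *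
        ∫⁻ b in {b | Interlaces b c}, ENNReal.ofReal (vand b / vand c) * F (fun i => τ * dw c b i) := by
  set G := {g : Fin (n + 1) → ℝ | ∀ i, 0 < g i}.indicator F with hG
  have hGm : Measurable G := hF.indicator measurableSet_pos_orthant
  have hz : StrictAnti (fun i : Fin n => c i.succ) := hc.comp_strictMono Fin.strictMono_succ
  rw [← lintegral_indicator measurableSet_pos_orthant, ← hG, lintegral_pi_cons hGm,
    lintegral_lintegral_swap (by fun_prop)]
  have hshift : ∀ h : Fin n → ℝ, ∫⁻ x : ℝ, G (Fin.cons x h) =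
      ∫⁻ τ : ℝ, G (Fin.cons (τ - ∑ i, h i) h) := fun h =>
    (lintegral_sub_right_eq_self (fun x => G (Fin.cons x h)) _).symm
  simp_rw [hshift]
  rw [lintegral_lintegral_swap (by fun_prop), ← lintegral_indicator measurableSet_Ioi]
  refine lintegral_congr fun τ => ?_
  by_cases hτ : 0 < τ
  swap
  · rw [Set.indicator_of_notMem (by simpa using hτ)]
    refine lintegral_eq_zero_of_ae_eq_zero (Eventually.of_forall fun h => ?_)
    refine Set.indicator_of_notMem (fun hm => hτ ?_) _
    have h0 := hm 0
    have h1 : 0 ≤ ∑ i, h i := Finset.sum_nonneg fun i _ => by simpa using (hm i.succ).le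
    simp at h0
    linarith
  rw [Set.indicator_of_mem (by simpa using hτ)]
  have hd : ∀ i : Fin n, 0 < c 0 - c i.succ := fun i => sub_pos.2 (hc (Fin.succ_pos i))
  have hl : ∀ i : Fin n, 0 < τ / (c 0 - c i.succ) := fun i => div_pos hτ (hd i)
  rw [lintegral_pi_scale hl (by fun_prop)]
  have hrestr : ∫⁻ h : Fin n → ℝ, G (Fin.cons (τ - ∑ i, τ / (c 0 - c i.succ) * h i)
        fun i => τ / (c 0 - c i.succ) * h i) =
      ∫⁻ h in {h : Fin n → ℝ | ∀ i, 0 < h i}, G (Fin.cons (τ - ∑ i, τ / (c 0 - c i.succ) * h i)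
        fun i => τ / (c 0 - c i.succ) * h i) := by
    refine (setLIntegral_eq_of_support_subset ?_).symm
    intro h hh i
    have hm := Set.mem_of_indicator_ne_zero hh i.succ
    simp at hm
    exact pos_of_mul_pos_right hm (hl i).le
  rw [hrestr, lintegral_pos_orthant_eq hz]
  have hsub : ∀ b : Fin n → ℝ, (Fin.cons (τ - ∑ i, τ / (c 0 - c i.succ) *
      gam (fun i => c i.succ) b i) (fun i => τ / (c 0 - c i.succ) *
        gam (fun i => c i.succ) b i) : Fin (n + 1) → ℝ) = fun i => τ * dw c b i := by
    intro b
    have h1 : ∀ i : Fin n, τ / (c 0 - c i.succ) * gam (fun i => c i.succ) b i =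
      τ * dw c b i.succ := fun i => by rw [dw_succ]; ring
    simp_rw [h1]
    funext i
    cases i using Fin.cases with
    | zero => rw [Fin.cons_zero, dw_zero hc, ← Finset.mul_sum]; ring
    | succ i => simp
  simp_rw [hsub]
  have hA : MeasurableSet {b | Interlaces b c} := (isOpen_interlaces c).measurableSet
  rw [← lintegral_const_mul' _ _ ENNReal.ofReal_ne_top,
    ← lintegral_const_mul' _ _ ENNReal.ofReal_ne_top,
    ← lintegral_indicator (isOpen_aboveSet _).measurableSet, ← lintegral_indicator hA]
  refine lintegral_congr fun b => ?_
  by_cases hb : Interlaces b c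
  · have hb' := (interlaces_iff_aboveSet hc b).1 hb
    rw [Set.indicator_of_mem hb'.1, Set.indicator_of_mem (s := {b | Interlaces b c}) hb, hG,
      Set.indicator_of_mem (show (fun i => τ * dw c b i) ∈ {g : Fin (n + 1) → ℝ | ∀ i, 0 < g i} from
        fun i => mul_pos hτ (dw_pos hc hb i)), ← mul_assoc, ← mul_assoc,
      ← ENNReal.ofReal_mul (Finset.prod_nonneg fun i _ => (hl i).le),
      ← ENNReal.ofReal_mul (pow_nonneg hτ.le _)]
    congr 2
    rw [Finset.prod_div_distrib, Finset.prod_const, Finset.card_univ, Fintype.card_fin, vand_succ,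
      Finset.prod_congr rfl fun i _ => abs_of_pos (hd i)]
    have := (vand_pos hz.injective).ne'
    have : ∏ i : Fin n, (c 0 - c i.succ) ≠ 0 := Finset.prod_ne_zero_iff.2 fun i _ => (hd i).ne'
    field_simp
  · rw [Set.indicator_of_notMem (s := {b | Interlaces b c}) hb]
    by_cases hb' : b ∈ aboveSet (fun i => c i.succ)
    · rw [Set.indicator_of_mem hb', hG, Set.indicator_of_notMem, mul_zero, mul_zero]
      intro hm
      exact hb ((interlaces_iff_aboveSet hc b).2 ⟨hb', pos_of_mul_pos_right (hm 0) hτ.le⟩)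
    · rw [Set.indicator_of_notMem hb']

/-- The unnormalized Dixon–Anderson density. -/
def dixonWt (θ : ℝ) (c : Fin (n + 1) → ℝ) (b : Fin n → ℝ) : ℝ :=
  vand c ^ (1 - 2 * θ) * vand b * cross c b ^ (θ - 1)

theorem dixonWt_nonneg (θ : ℝ) (c : Fin (n + 1) → ℝ) (b : Fin n → ℝ) : 0 ≤ dixonWt θ c b :=
  mul_nonneg (mul_nonneg (Real.rpow_nonneg (vand_nonneg c) _) (vand_nonneg b))
    (Real.rpow_nonneg (cross_nonneg _ _) _)

theorem continuous_cross_right (c : Fin (n + 1) → ℝ) : Continuous fun b : Fin n → ℝ => cross c b := by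
  unfold cross; fun_prop

theorem measurable_dixonWt (θ : ℝ) (c : Fin (n + 1) → ℝ) : Measurable (dixonWt θ c) := by
  unfold dixonWt
  exact (continuous_vand.measurable.const_mul _).mul
    ((continuous_cross_right c).measurable.pow_const _)

/-- Gamma lift of the Dixon–Anderson density. -/
theorem lintegral_gamma_lift (θ : ℝ) {c : Fin (n + 1) → ℝ} (hc : StrictAnti c)
    {F : (Fin (n + 1) → ℝ) → ℝ≥0∞} (hF : Measurable F) :
    ∫⁻ g in {g : Fin (n + 1) → ℝ | ∀ i, 0 < g i}, ENNReal.ofReal (∏ i, g i ^ (θ - 1)) * F g =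
      ∫⁻ τ in Set.Ioi (0 : ℝ), ENNReal.ofReal (τ ^ ((n + 1) * θ - 1)) *
        ∫⁻ b in {b | Interlaces b c}, ENNReal.ofReal (dixonWt θ c b) *
          F (fun i => τ * dw c b i) := by
  rw [lintegral_pos_orthant_eq_simplex hc (by fun_prop)]
  refine setLIntegral_congr_fun measurableSet_Ioi fun τ (hτ : 0 < τ) => ?_
  simp only
  rw [← lintegral_const_mul' _ _ ENNReal.ofReal_ne_top,
    ← lintegral_const_mul' _ _ ENNReal.ofReal_ne_top]
  refine setLIntegral_congr_fun (isOpen_interlaces c).measurableSet fun b hb => ?_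
  rw [← mul_assoc, ← mul_assoc, ← mul_assoc, ← ENNReal.ofReal_mul (by positivity),
    ← ENNReal.ofReal_mul, ← ENNReal.ofReal_mul (by positivity)]
  swap
  · exact mul_nonneg (pow_nonneg hτ.le _) (div_nonneg (vand_nonneg _) (vand_nonneg _))
  congr 2
  have hv := vand_pos hc.injective
  have h1 : ∏ i, (τ * dw c b i) ^ (θ - 1) =
      τ ^ ((n + 1) * (θ - 1)) * (cross c b ^ (θ - 1) * vand c ^ (-(2 * (θ - 1)))) := by
    rw [Finset.prod_congr rfl fun i _ => Real.mul_rpow hτ.le (dw_pos hc hb i).le,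
      Finset.prod_mul_distrib, Finset.prod_const, Finset.card_univ, Fintype.card_fin,
      Real.finsetProd_rpow _ _ fun i _ => (dw_pos hc hb i).le, prod_dw hc hb,
      Real.div_rpow (cross_nonneg _ _) (by positivity), ← Real.rpow_natCast, ← Real.rpow_mul hτ.le,
      Real.rpow_neg hv.le, Real.rpow_mul hv.le]
    push_cast
    rw [mul_comm (θ - 1), Real.rpow_two, div_eq_mul_inv]
  have h2 : τ ^ ((n + 1) * θ - 1) = τ ^ n * τ ^ ((n + 1) * (θ - 1)) := by
    rw [← Real.rpow_natCast, ← Real.rpow_add hτ]; congr 1; ring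
  have h3 : vand c ^ (1 - 2 * θ) = vand c ^ (-(2 * (θ - 1))) * (vand c)⁻¹ := by
    rw [← Real.rpow_neg_one, ← Real.rpow_add hv]; congr 1; ring
  rw [h1, h2, dixonWt, h3]
  ring

theorem prod_sub_eq_dw {c : Fin (n + 1) → ℝ} (hc : Function.Injective c) (b : Fin n → ℝ) :
    ∏ j, (Polynomial.X - Polynomial.C (b j)) = ∑ i, Polynomial.C (dw c b i) *
      ∏ l ∈ Finset.univ.erase i, (Polynomial.X - Polynomial.C (c l)) := by
  refine Polynomial.eq_of_degrees_lt_of_eval_index_eq (s := Finset.univ) (v := c) hc.injOn ?_ ?_ ?_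
  · rw [Polynomial.degree_eq_natDegree (prod_X_sub_C_monic b).ne_zero, natDegree_prod_X_sub_C]
    simp only [Finset.card_univ, Fintype.card_fin]
    exact_mod_cast Nat.lt_succ_self n
  · simpa using degree_sum_prod_erase_lt (Nat.succ_pos n) c (dw c b)
  · intro i _
    rw [Polynomial.eval_finsetSum, Finset.sum_eq_single i]
    · simp only [Polynomial.eval_prod, Polynomial.eval_mul, Polynomial.eval_sub, Polynomial.eval_X,
        Polynomial.eval_C]
      rw [dw, div_mul_cancel₀ _ (prod_erase_sub_ne_zero hc i)]
    · intro k _ hk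
      rw [Polynomial.eval_mul, Polynomial.eval_prod, Finset.prod_eq_zero
        (Finset.mem_erase.2 ⟨hk.symm, Finset.mem_univ i⟩) (by simp), mul_zero]
    · simp

theorem prod_add_eq_dw {c : Fin (n + 1) → ℝ} (hc : Function.Injective c) (b : Fin n → ℝ) :
    ∏ j, (Polynomial.X + Polynomial.C (b j)) = ∑ i, Polynomial.C (dw c b i) *
      ∏ l ∈ Finset.univ.erase i, (Polynomial.X + Polynomial.C (c l)) := by
  refine Polynomial.funext fun x => ?_
  have h := congrArg (fun p => (-1) ^ n * Polynomial.eval (-x) p) (prod_sub_eq_dw hc b)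
  simp only [Polynomial.eval_finsetSum, Polynomial.eval_prod, Polynomial.eval_mul,
    Polynomial.eval_sub, Polynomial.eval_add, Polynomial.eval_X, Polynomial.eval_C,
    Finset.mul_sum] at h ⊢
  have hneg : ∀ (s : Finset (Fin (n + 1))), s.card = n → (-1 : ℝ) ^ n * ∏ l ∈ s, (-x - c l) =
      ∏ l ∈ s, (x + c l) := by
    intro s hs
    nth_rewrite 1 [← hs]
    rw [← Finset.prod_const, ← Finset.prod_mul_distrib]
    exact Finset.prod_congr rfl fun l _ => by ring
  have hneg' : (-1 : ℝ) ^ n * ∏ l : Fin n, (-x - b l) = ∏ l, (x + b l) := by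
    have : (-1 : ℝ) ^ n = ∏ _l : Fin n, (-1 : ℝ) := by simp
    rw [this, ← Finset.prod_mul_distrib]
    exact Finset.prod_congr rfl fun l _ => by ring
  rw [← hneg', h]
  refine Finset.sum_congr rfl fun i _ => ?_
  rw [← hneg _ (by simp)]
  ring

theorem sum_dw_mul {c : Fin (n + 1) → ℝ} (hc : StrictAnti c) (b : Fin n → ℝ) :
    ∑ i, dw c b i * c i = ∑ i, c i - ∑ j, b j := by
  rcases Nat.eq_zero_or_pos n with rfl | hn
  · simp [dw]
  have h := congrArg (fun p => Polynomial.coeff p (n - 1)) (prod_sub_eq_dw hc.injective b)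
  have h1 := Polynomial.prod_X_sub_C_coeff_card_pred (Finset.univ : Finset (Fin n)) b (by simpa)
  rw [Finset.card_univ, Fintype.card_fin] at h1
  simp only [h1, Polynomial.finsetSum_coeff, Polynomial.coeff_C_mul] at h
  have h2 : ∀ i, (∏ l ∈ Finset.univ.erase i, (Polynomial.X - Polynomial.C (c l))).coeff (n - 1) =
      -(∑ l, c l - c i) := by
    intro i
    have := Polynomial.prod_X_sub_C_coeff_card_pred (Finset.univ.erase i) c (by simpa)
    rw [Finset.card_erase_of_mem (Finset.mem_univ i), Finset.card_univ, Fintype.card_fin,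
      Nat.add_sub_cancel] at this
    rw [this, ← Finset.add_sum_erase _ _ (Finset.mem_univ i)]; ring
  simp only [h2] at h
  have h3 : ∑ i, dw c b i * -(∑ l, c l - c i) = -((∑ i, dw c b i) * ∑ l, c l) +
      ∑ i, dw c b i * c i := by
    rw [Finset.sum_mul, ← Finset.sum_neg_distrib, ← Finset.sum_add_distrib]
    exact Finset.sum_congr rfl fun i _ => by ring
  rw [h3, sum_dw hc] at h
  linarith

theorem lintegral_pi_prod {f : Fin n → ℝ → ℝ≥0∞} (hf : ∀ i, Measurable (f i)) :
    ∫⁻ g : Fin n → ℝ, ∏ i, f i (g i) = ∏ i, ∫⁻ x, f i x := by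
  induction n with
  | zero => simp [volume_pi]
  | succ n ih =>
    rw [lintegral_pi_cons (by fun_prop), Fin.prod_univ_succ, ← ih (fun i => hf i.succ)]
    simp only [Fin.prod_univ_succ, Fin.cons_zero, Fin.cons_succ]
    rw [← lintegral_mul_const _ (hf 0)]
    refine lintegral_congr fun x => ?_
    rw [lintegral_const_mul _ (by fun_prop)]

theorem setLIntegral_pos_orthant_prod {f : Fin n → ℝ → ℝ≥0∞} (hf : ∀ i, Measurable (f i)) :
    ∫⁻ g in {g : Fin n → ℝ | ∀ i, 0 < g i}, ∏ i, f i (g i) = ∏ i, ∫⁻ x in Set.Ioi 0, f i x := by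
  simp_rw [← lintegral_indicator measurableSet_Ioi]
  rw [← lintegral_pi_prod fun i => (hf i).indicator measurableSet_Ioi,
    ← lintegral_indicator measurableSet_pos_orthant]
  refine lintegral_congr fun g => ?_
  by_cases hg : ∀ i, 0 < g i
  · rw [Set.indicator_of_mem (s := {g : Fin n → ℝ | ∀ i, 0 < g i}) hg]
    exact Finset.prod_congr rfl fun i _ => (Set.indicator_of_mem (Set.mem_Ioi.2 (hg i)) _).symm
  · rw [Set.indicator_of_notMem (s := {g : Fin n → ℝ | ∀ i, 0 < g i}) hg]
    push Not at hg
    obtain ⟨i, hi⟩ := hg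
    exact (Finset.prod_eq_zero (Finset.mem_univ i)
      (Set.indicator_of_notMem (Set.notMem_Ioi.2 hi) _)).symm

theorem lintegral_rpow_mul_exp {a r : ℝ} (ha : 0 < a) (hr : 0 < r) :
    ∫⁻ t in Set.Ioi (0 : ℝ), ENNReal.ofReal (t ^ (a - 1)) * ENNReal.ofReal (Real.exp (-(r * t))) =
      ENNReal.ofReal (r ^ (-a) * Real.Gamma a) := by
  have h := Real.integral_rpow_mul_exp_neg_mul_Ioi ha hr
  have hpos : 0 < (1 / r) ^ a * Real.Gamma a :=
    mul_pos (Real.rpow_pos_of_pos (by positivity) _) (Real.Gamma_pos_of_pos ha)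
  have hInt : Integrable (fun t : ℝ => t ^ (a - 1) * Real.exp (-(r * t)))
      (volume.restrict (Set.Ioi 0)) := by
    by_contra hc
    rw [integral_undef hc] at h
    exact hpos.ne h
  rw [Real.rpow_neg hr.le, ← Real.inv_rpow hr.le, ← one_div, ← h,
    ofReal_integral_eq_lintegral_ofReal hInt]
  · refine setLIntegral_congr_fun measurableSet_Ioi fun t (ht : 0 < t) => ?_
    exact (ENNReal.ofReal_mul (Real.rpow_nonneg ht.le _)).symm
  · filter_upwards [ae_restrict_mem measurableSet_Ioi] with t ht
    have : (0 : ℝ) < t := ht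
    positivity

/-- The normalizing constant of the Dixon–Anderson density. -/
def dixonConst (θ : ℝ) (n : ℕ) : ℝ := Real.Gamma ((n + 1) * θ) / Real.Gamma θ ^ (n + 1)

/-- The Dixon–Anderson conditional law of a tuple interlacing with `c`. -/
def dixon (θ : ℝ) (c : Fin (n + 1) → ℝ) : Measure (Fin n → ℝ) :=
  (volume.restrict {b | Interlaces b c}).withDensity
    fun b => ENNReal.ofReal (dixonConst θ n * dixonWt θ c b)

theorem dixonConst_pos {θ : ℝ} (hθ : 0 < θ) (n : ℕ) : 0 < dixonConst θ n :=
  div_pos (Real.Gamma_pos_of_pos (by positivity)) (pow_pos (Real.Gamma_pos_of_pos hθ) _)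

theorem lintegral_dixon {θ : ℝ} (hθ : 0 < θ) (c : Fin (n + 1) → ℝ) (f : (Fin n → ℝ) → ℝ≥0∞) :
    ∫⁻ b, f b ∂(dixon θ c) = ENNReal.ofReal (dixonConst θ n) *
      ∫⁻ b in {b | Interlaces b c}, ENNReal.ofReal (dixonWt θ c b) * f b := by
  rw [dixon, lintegral_withDensity_eq_lintegral_mul_non_measurable _
    ((measurable_dixonWt θ c).const_mul _).ennreal_ofReal
    (Eventually.of_forall fun _ => ENNReal.ofReal_lt_top),
    ← lintegral_const_mul' _ _ ENNReal.ofReal_ne_top]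
  refine lintegral_congr fun b => ?_
  simp only [Pi.mul_apply]
  rw [ENNReal.ofReal_mul (dixonConst_pos hθ n).le, mul_assoc]

theorem ae_dixon_interlaces (θ : ℝ) (c : Fin (n + 1) → ℝ) :
    ∀ᵐ b ∂(dixon θ c), Interlaces b c :=
  (withDensity_absolutelyContinuous _ _).ae_le
    (ae_restrict_mem (isOpen_interlaces c).measurableSet)

theorem lintegral_dixon_lift {θ : ℝ} (hθ : 0 < θ) {c : Fin (n + 1) → ℝ} (hc : StrictAnti c)
    {α : Fin (n + 1) → ℕ} {r : Fin (n + 1) → ℝ} (hr : ∀ i, 0 < r i) :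
    ∫⁻ b, ENNReal.ofReal ((∏ i, dw c b i ^ α i) *
        (∑ i, r i * dw c b i) ^ (-((n + 1) * θ + (∑ i, α i : ℕ)))) ∂(dixon θ c) =
      ENNReal.ofReal (dixonConst θ n * (∏ i, (r i ^ (-(θ + α i)) * Real.Gamma (θ + α i))) /
        Real.Gamma ((n + 1) * θ + (∑ i, α i : ℕ))) := by
  set A : ℝ := (n + 1) * θ + (∑ i, α i : ℕ) with hA
  have hApos : 0 < A := by positivity
  have hG := Real.Gamma_pos_of_pos hApos
  have key := lintegral_gamma_lift θ hc (F := fun g => ∏ i, (ENNReal.ofReal (g i ^ α i) *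
    ENNReal.ofReal (Real.exp (-(r i * g i))))) (by fun_prop)
  have hL : ∫⁻ g in {g : Fin (n + 1) → ℝ | ∀ i, 0 < g i}, ENNReal.ofReal (∏ i, g i ^ (θ - 1)) *
      ∏ i, (ENNReal.ofReal (g i ^ α i) * ENNReal.ofReal (Real.exp (-(r i * g i)))) =
      ENNReal.ofReal (∏ i, (r i ^ (-(θ + α i)) * Real.Gamma (θ + α i))) := by
    have : ∀ g ∈ {g : Fin (n + 1) → ℝ | ∀ i, 0 < g i}, ENNReal.ofReal (∏ i, g i ^ (θ - 1)) *
      ∏ i, (ENNReal.ofReal (g i ^ α i) * ENNReal.ofReal (Real.exp (-(r i * g i)))) =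
        ∏ i, (ENNReal.ofReal (g i ^ (θ + α i - 1)) *
          ENNReal.ofReal (Real.exp (-(r i * g i)))) := by
      intro g hg
      have hg' : ∀ i, 0 < g i := hg
      rw [ENNReal.ofReal_prod_of_nonneg fun i _ => Real.rpow_nonneg (hg' i).le _,
        ← Finset.prod_mul_distrib]
      refine Finset.prod_congr rfl fun i _ => ?_
      rw [← mul_assoc, ← ENNReal.ofReal_mul (Real.rpow_nonneg (hg' i).le _), ← Real.rpow_natCast,
        ← Real.rpow_add (hg' i)]
      congr 3; ring
    rw [setLIntegral_congr_fun measurableSet_pos_orthant this,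
      setLIntegral_pos_orthant_prod (f := fun i x => ENNReal.ofReal (x ^ (θ + α i - 1)) *
          ENNReal.ofReal (Real.exp (-(r i * x)))) (fun i => by fun_prop),
      ENNReal.ofReal_prod_of_nonneg fun i _ => mul_nonneg (Real.rpow_nonneg (hr i).le _)
        (Real.Gamma_pos_of_pos (by positivity)).le]
    exact Finset.prod_congr rfl fun i _ => lintegral_rpow_mul_exp (by positivity) (hr i)
  have hm1 : Measurable fun b : Fin n → ℝ => dixonWt θ c b := measurable_dixonWt θ c
  have hm2 : ∀ i, Measurable fun b : Fin n → ℝ => dw c b i := fun i =>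
    (measurable_pi_apply i).comp (continuous_dw c).measurable
  have hR : ∫⁻ τ in Set.Ioi (0 : ℝ), ENNReal.ofReal (τ ^ ((n + 1) * θ - 1)) *
        ∫⁻ b in {b | Interlaces b c}, ENNReal.ofReal (dixonWt θ c b) *
          ∏ i, (ENNReal.ofReal ((τ * dw c b i) ^ α i) *
            ENNReal.ofReal (Real.exp (-(r i * (τ * dw c b i))))) =
      ENNReal.ofReal (Real.Gamma A) * ∫⁻ b in {b | Interlaces b c}, ENNReal.ofReal (dixonWt θ c b) *
        ENNReal.ofReal ((∏ i, dw c b i ^ α i) * (∑ i, r i * dw c b i) ^ (-A)) := by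
    rw [← lintegral_const_mul' _ _ ENNReal.ofReal_ne_top]
    simp_rw [← lintegral_const_mul' (ENNReal.ofReal (_ ^ ((n + 1) * θ - 1))) _ ENNReal.ofReal_ne_top]
    rw [lintegral_lintegral_swap (by fun_prop)]
    refine setLIntegral_congr_fun (isOpen_interlaces c).measurableSet fun b hb => ?_
    have hw := dw_pos hc hb
    have hs : 0 < ∑ i, r i * dw c b i :=
      Finset.sum_pos (fun i _ => mul_pos (hr i) (hw i)) Finset.univ_nonempty
    have hP : 0 ≤ ∏ i, dw c b i ^ α i := Finset.prod_nonneg fun i _ => pow_nonneg (hw i).le _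
    have : ∀ τ ∈ Set.Ioi (0 : ℝ), ENNReal.ofReal (τ ^ ((n + 1) * θ - 1)) *
        (ENNReal.ofReal (dixonWt θ c b) * ∏ i, (ENNReal.ofReal ((τ * dw c b i) ^ α i) *
            ENNReal.ofReal (Real.exp (-(r i * (τ * dw c b i)))))) =
        (ENNReal.ofReal (dixonWt θ c b) * ENNReal.ofReal (∏ i, dw c b i ^ α i)) *
        (ENNReal.ofReal (τ ^ (A - 1)) *
          ENNReal.ofReal (Real.exp (-((∑ i, r i * dw c b i) * τ)))) := by
      intro τ hτ
      have hτ : 0 < τ := hτ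
      have e1 : τ ^ (A - 1) = τ ^ ((n + 1) * θ - 1) * τ ^ (∑ i, α i) := by
        rw [← Real.rpow_natCast, ← Real.rpow_add hτ]; congr 1; rw [hA]; ring
      have e2 : Real.exp (-((∑ i, r i * dw c b i) * τ)) =
          ∏ i, Real.exp (-(r i * (τ * dw c b i))) := by
        rw [← Real.exp_sum, Finset.sum_mul, ← Finset.sum_neg_distrib]
        congr 1; exact Finset.sum_congr rfl fun i _ => by ring
      have e3 : ∏ i, (τ * dw c b i) ^ α i = τ ^ (∑ i, α i) * ∏ i, dw c b i ^ α i := by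
        simp_rw [mul_pow]
        rw [Finset.prod_mul_distrib, Finset.prod_pow_eq_pow_sum]
      rw [Finset.prod_mul_distrib, ← ENNReal.ofReal_prod_of_nonneg
        (fun i _ => pow_nonneg (mul_nonneg hτ.le (hw i).le) _), ← ENNReal.ofReal_prod_of_nonneg
        (fun i _ => (Real.exp_pos _).le), e3, ← e2, e1, ENNReal.ofReal_mul (by positivity),
        ENNReal.ofReal_mul (Real.rpow_nonneg hτ.le _)]
      ring
    rw [setLIntegral_congr_fun measurableSet_Ioi this, lintegral_const_mul _ (by fun_prop),
      lintegral_rpow_mul_exp hApos hs, ENNReal.ofReal_mul hP,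
      ENNReal.ofReal_mul (Real.rpow_nonneg hs.le _)]
    ring
  rw [hL, hR] at key
  rw [lintegral_dixon hθ, mul_div_assoc, ENNReal.ofReal_mul (dixonConst_pos hθ n).le,
    ENNReal.ofReal_div_of_pos hG, key, ENNReal.mul_div_right_comm, ENNReal.div_self, one_mul]
  · simpa using hG
  · exact ENNReal.ofReal_ne_top

theorem isProbabilityMeasure_dixon {θ : ℝ} (hθ : 0 < θ) {c : Fin (n + 1) → ℝ} (hc : StrictAnti c) :
    IsProbabilityMeasure (dixon θ c) := by
  have h := lintegral_dixon_lift hθ hc (α := fun _ => 0) (r := fun _ => 1) (fun _ => one_pos)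
  simp only [pow_zero, one_mul, sum_dw hc, Real.one_rpow, Finset.prod_const_one,
    ENNReal.ofReal_one, lintegral_one, Nat.cast_zero, add_zero, Finset.sum_const_zero,
    Finset.prod_const, Finset.card_univ, Fintype.card_fin] at h
  refine ⟨h.trans ?_⟩
  have h1 := Real.Gamma_pos_of_pos hθ
  have h2 := Real.Gamma_pos_of_pos (show 0 < (n + 1) * θ by positivity)
  rw [dixonConst, ← ENNReal.ofReal_one]
  congr 1
  field_simp

theorem Gamma_add_natCast {x : ℝ} (hx : 0 < x) (k : ℕ) :
    Real.Gamma (x + k) = (ascPochhammer ℝ k).eval x * Real.Gamma x := by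
  induction k with
  | zero => simp
  | succ k ih =>
    rw [ascPochhammer_succ_eval, Nat.cast_succ, ← add_assoc, Real.Gamma_add_one (by positivity), ih]
    ring

/-- Dirichlet moments of the Dixon–Anderson weights. -/
def dirMoment (θ : ℝ) (α : Fin (n + 1) → ℕ) : ℝ :=
  (∏ i, (ascPochhammer ℝ (α i)).eval θ) / (ascPochhammer ℝ (∑ i, α i)).eval ((n + 1) * θ)

theorem dirMoment_nonneg {θ : ℝ} (hθ : 0 < θ) (α : Fin (n + 1) → ℕ) : 0 ≤ dirMoment θ α :=
  div_nonneg (Finset.prod_nonneg fun i _ => (ascPochhammer_pos _ _ hθ).le)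
    (ascPochhammer_pos _ _ (by positivity)).le

theorem lintegral_dixon_dw {θ : ℝ} (hθ : 0 < θ) {c : Fin (n + 1) → ℝ} (hc : StrictAnti c)
    (α : Fin (n + 1) → ℕ) :
    ∫⁻ b, ENNReal.ofReal (∏ i, dw c b i ^ α i) ∂(dixon θ c) = ENNReal.ofReal (dirMoment θ α) := by
  have h := lintegral_dixon_lift hθ hc (α := α) (r := fun _ => 1) (fun _ => one_pos)
  simp only [one_mul, sum_dw hc, Real.one_rpow, mul_one] at h
  rw [h, dirMoment, dixonConst]
  have h1 := Real.Gamma_pos_of_pos hθ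
  have hp : 0 < (n + 1) * θ := by positivity
  have h2 := Real.Gamma_pos_of_pos hp
  have h3 := ascPochhammer_pos (∑ i, α i) _ hp
  congr 1
  rw [Gamma_add_natCast hp, Finset.prod_congr rfl fun i _ => Gamma_add_natCast hθ (α i),
    Finset.prod_mul_distrib, Finset.prod_const, Finset.card_univ, Fintype.card_fin]
  field_simp

theorem integrable_dixon_dw {θ : ℝ} (hθ : 0 < θ) {c : Fin (n + 1) → ℝ} (hc : StrictAnti c)
    (α : Fin (n + 1) → ℕ) : Integrable (fun b => ∏ i, dw c b i ^ α i) (dixon θ c) := by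
  have hm : Measurable fun b : Fin n → ℝ => ∏ i, dw c b i ^ α i :=
    Finset.measurable_fun_prod _ fun i _ =>
      ((measurable_pi_apply i).comp (continuous_dw c).measurable).pow_const _
  have hnn : 0 ≤ᵐ[dixon θ c] fun b => ∏ i, dw c b i ^ α i := by
    filter_upwards [ae_dixon_interlaces θ c] with b hb
    exact Finset.prod_nonneg fun i _ => pow_nonneg (dw_pos hc hb i).le _
  refine ⟨hm.aestronglyMeasurable, ?_⟩
  rw [hasFiniteIntegral_iff_ofReal hnn, lintegral_dixon_dw hθ hc]
  exact ENNReal.ofReal_lt_top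

theorem integral_dixon_dw {θ : ℝ} (hθ : 0 < θ) {c : Fin (n + 1) → ℝ} (hc : StrictAnti c)
    (α : Fin (n + 1) → ℕ) : ∫ b, ∏ i, dw c b i ^ α i ∂(dixon θ c) = dirMoment θ α := by
  have hnn : 0 ≤ᵐ[dixon θ c] fun b => ∏ i, dw c b i ^ α i := by
    filter_upwards [ae_dixon_interlaces θ c] with b hb
    exact Finset.prod_nonneg fun i _ => pow_nonneg (dw_pos hc hb i).le _
  rw [integral_eq_lintegral_of_nonneg_ae hnn (integrable_dixon_dw hθ hc α).1,
    lintegral_dixon_dw hθ hc, ENNReal.toReal_ofReal (dirMoment_nonneg hθ α)]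

/-- Markov–Krein type identity for the Dixon–Anderson law. -/
theorem lintegral_dixon_markov_krein {θ : ℝ} (hθ : 0 < θ) {c : Fin (n + 1) → ℝ} (hc : StrictAnti c)
    {s : ℝ} (hs : ∀ i, 0 < 1 - s * c i) :
    ∫⁻ b, ENNReal.ofReal ((1 - s * (∑ i, c i - ∑ j, b j)) ^ (-((n + 1) * θ))) ∂(dixon θ c) =
      ENNReal.ofReal (∏ i, (1 - s * c i) ^ (-θ)) := by
  have h := lintegral_dixon_lift hθ hc (α := fun _ => 0) hs
  have e : ∀ b : Fin n → ℝ, ∑ i, (1 - s * c i) * dw c b i = 1 - s * (∑ i, c i - ∑ j, b j) := by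
    intro b
    nth_rewrite 2 [← sum_dw hc b]
    rw [← sum_dw_mul hc b, Finset.mul_sum, ← Finset.sum_sub_distrib]
    exact Finset.sum_congr rfl fun i _ => by ring
  simp only [pow_zero, one_mul, Finset.prod_const_one, e, Nat.cast_zero, add_zero,
    Finset.sum_const_zero, Finset.prod_mul_distrib, Finset.prod_const, Finset.card_univ,
    Fintype.card_fin] at h
  rw [h, dixonConst]
  have h1 := Real.Gamma_pos_of_pos hθ
  have h2 := Real.Gamma_pos_of_pos (show 0 < (n + 1) * θ by positivity)
  congr 1
  field_simp

/-- Orthogonal matrix diagonalizing the rank one perturbation `diag z + √g √gᵀ`. -/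
def rotMat (z b g : Fin n → ℝ) : Matrix (Fin n) (Fin n) ℝ :=
  Matrix.of fun j i => (√(∑ l, g l / (b j - z l) ^ 2))⁻¹ * (√(g i) / (b j - z i))

theorem rotMat_mul_transpose {z b g : Fin n → ℝ} (hg : ∀ i, 0 < g i) (hb : Function.Injective b)
    (hbz : ∀ j i, b j ≠ z i) (hsum : ∀ j, ∑ i, g i / (b j - z i) = 1) :
    rotMat z b g * (rotMat z b g).transpose = 1 := by
  have hd : ∀ j i, b j - z i ≠ 0 := fun j i => sub_ne_zero.2 (hbz j i)
  ext j l
  rw [Matrix.mul_apply, Matrix.one_apply]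
  have e : ∀ i, rotMat z b g j i * (rotMat z b g).transpose i l =
      (√(∑ l, g l / (b j - z l) ^ 2))⁻¹ * (√(∑ i, g i / (b l - z i) ^ 2))⁻¹ *
        (g i / ((b j - z i) * (b l - z i))) := by
    intro i
    rw [Matrix.transpose_apply, rotMat, Matrix.of_apply, Matrix.of_apply]
    have h1 := hd j i
    have h2 := hd l i
    have hs : g i = √(g i) * √(g i) := (Real.mul_self_sqrt (hg i).le).symm
    generalize (√(∑ l, g l / (b j - z l) ^ 2))⁻¹ = r
    generalize (√(∑ i, g i / (b l - z i) ^ 2))⁻¹ = r'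
    generalize √(g i) = t at hs
    rw [hs]
    field_simp
  rw [Finset.sum_congr rfl fun i _ => e i, ← Finset.mul_sum]
  split_ifs with h
  · subst h
    have hpos : 0 < ∑ l, g l / (b j - z l) ^ 2 :=
      Finset.sum_pos (fun i _ => div_pos (hg i) (sq_pos_of_ne_zero (hd j i))) ⟨j, Finset.mem_univ j⟩
    rw [← mul_inv, Real.mul_self_sqrt hpos.le]
    simp_rw [← sq]
    exact inv_mul_cancel₀ hpos.ne'
  · have hne : b l - b j ≠ 0 := sub_ne_zero.2 fun e => h (hb e).symm
    have : ∑ i, g i / ((b j - z i) * (b l - z i)) =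
        (∑ i, g i / (b j - z i) - ∑ i, g i / (b l - z i)) / (b l - b j) := by
      rw [← Finset.sum_sub_distrib, Finset.sum_div]
      refine Finset.sum_congr rfl fun i _ => ?_
      have h1 := hd j i
      have h2 := hd l i
      field_simp
      ring
    rw [this, hsum, hsum, sub_self, zero_div, mul_zero]

/-- Quadratic form obtained from the weights `g i / (z i - b j)` after the rotation `rotMat`. -/
theorem sum_rotMat_gram {z b g : Fin n → ℝ} (hg : ∀ i, 0 < g i) (hz : Function.Injective z)
    (hb : Function.Injective b)
    (hbz : ∀ j i, b j ≠ z i) (hsum : ∀ j, ∑ i, g i / (b j - z i) = 1)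
    {G : Fin n → Fin n → ℝ} (hG : ∀ i j, G i j = G j i) (i : Fin n) :
    ∑ m, ∑ m', (∑ j, g i / (z i - b j) * (rotMat z b g j m * rotMat z b g j m')) * G m m' =
      -G i i + ∑ m ∈ Finset.univ.erase i,
        (g m * G i i + g i * G m m - 2 * (√(g i) * √(g m)) * G i m) / (z i - z m) := by
  set O := rotMat z b g with hO
  have hd : ∀ j i, b j - z i ≠ 0 := fun j i => sub_ne_zero.2 (hbz j i)
  have hH : ∀ m m', ∑ j, O j m * O j m' = if m = m' then 1 else 0 := by
    intro m m'
    have hO' : O.transpose * O = 1 := mul_eq_one_comm.1 (rotMat_mul_transpose hg hb hbz hsum)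
    have := congrArg (fun M => M m m') hO'
    beta_reduce at this
    rwa [Matrix.mul_apply, Matrix.one_apply] at this
  have hpf : ∀ p q j, p ≠ q → g p / (b j - z p) * O j q =
      (√(g p) * √(g q) * O j p - g p * O j q) / (z p - z q) := by
    intro p q j hpq
    have hpq' : z p - z q ≠ 0 := sub_ne_zero.2 fun e => hpq (hz e)
    have h1 := hd j p
    have h2 := hd j q
    have hs : g p = √(g p) * √(g p) := (Real.mul_self_sqrt (hg p).le).symm
    rw [hO, rotMat, Matrix.of_apply, Matrix.of_apply]
    generalize (√(∑ l, g l / (b j - z l) ^ 2))⁻¹ = r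
    generalize √(g p) = t at hs
    rw [hs]
    field_simp
    ring
  have hneg : ∀ j, g i / (z i - b j) = -(g i / (b j - z i)) := fun j => by
    rw [← neg_sub, div_neg]
  set Y : Fin n → Fin n → ℝ := fun m m' => ∑ j, g i / (z i - b j) * (O j m * O j m') with hY
  have hYsymm : ∀ m m', Y m m' = Y m' m := fun m m' =>
    Finset.sum_congr rfl fun j _ => by ring
  have hYoff : ∀ m m', m ≠ i → Y m m' =
      (g i * (if m = m' then 1 else 0) - √(g i) * √(g m) * (if i = m' then 1 else 0)) /
        (z i - z m) := by
    intro m m' hm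
    rw [← hH m m', ← hH i m', Finset.mul_sum, Finset.mul_sum, ← Finset.sum_sub_distrib,
      Finset.sum_div]
    refine Finset.sum_congr rfl fun j _ => ?_
    rw [hneg, neg_mul, ← mul_assoc, hpf i m j hm.symm]
    ring
  have hYdiag : Y i i = -1 + ∑ m ∈ Finset.univ.erase i, g m / (z i - z m) := by
    have h1 : (1 : ℝ) = ∑ m, ∑ j, g m / (b j - z m) * (O j i * O j i) := by
      rw [Finset.sum_comm, ← if_pos (c := i = i) (t := (1 : ℝ)) (e := 0) rfl, ← hH i i]
      refine Finset.sum_congr rfl fun j _ => ?_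
      rw [← Finset.sum_mul, hsum, one_mul]
    rw [← Finset.add_sum_erase _ _ (Finset.mem_univ i)] at h1
    have h2 : ∑ j, g i / (b j - z i) * (O j i * O j i) = -Y i i := by
      rw [hY, ← Finset.sum_neg_distrib]
      exact Finset.sum_congr rfl fun j _ => by rw [hneg]; ring
    have h3 : ∀ m ∈ Finset.univ.erase i, ∑ j, g m / (b j - z m) * (O j i * O j i) =
        g m / (z i - z m) := by
      intro m hm
      have hmi := Finset.ne_of_mem_erase hm
      have e : ∀ j, g m / (b j - z m) * (O j i * O j i) =
          (√(g m) * √(g i) * (O j m * O j i) - g m * (O j i * O j i)) / (z m - z i) := by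
        intro j
        rw [← mul_assoc, hpf m i j hmi]; ring
      rw [Finset.sum_congr rfl fun j _ => e j, ← Finset.sum_div, Finset.sum_sub_distrib,
        ← Finset.mul_sum, ← Finset.mul_sum, hH, hH, if_neg hmi, if_pos rfl, ← neg_sub (z i), div_neg]
      ring
    rw [h2, Finset.sum_congr rfl h3] at h1
    linarith
  rw [← Finset.add_sum_erase _ _ (Finset.mem_univ i),
    ← Finset.add_sum_erase _ (fun m' => Y i m' * G i m') (Finset.mem_univ i), hYdiag]
  have h4 : ∀ m ∈ Finset.univ.erase i, Y i m * G i m =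
      (-(√(g i) * √(g m)) * G i m) / (z i - z m) := by
    intro m hm
    have hmi := Finset.ne_of_mem_erase hm
    rw [hYsymm, hYoff m i hmi, if_neg hmi, if_pos rfl]; ring
  have h5 : ∀ m ∈ Finset.univ.erase i, ∑ m', Y m m' * G m m' =
      (g i * G m m - √(g i) * √(g m) * G i m) / (z i - z m) := by
    intro m hm
    have hmi := Finset.ne_of_mem_erase hm
    have e : ∀ m', Y m m' * G m m' = (g i * (if m = m' then G m m' else 0) -
        √(g i) * √(g m) * (if i = m' then G m m' else 0)) / (z i - z m) := by
      intro m'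
      rw [hYoff m m' hmi]
      split_ifs <;> ring
    rw [Finset.sum_congr rfl fun m' _ => e m', ← Finset.sum_div, Finset.sum_sub_distrib,
      ← Finset.mul_sum, ← Finset.mul_sum, Finset.sum_ite_eq, Finset.sum_ite_eq, if_pos
      (Finset.mem_univ _), if_pos (Finset.mem_univ _), hG m i]
  rw [Finset.sum_congr rfl h4, Finset.sum_congr rfl h5, add_mul, Finset.sum_mul, add_assoc,
    add_assoc, ← Finset.sum_add_distrib, ← Finset.sum_add_distrib, neg_one_mul]
  congr 1
  exact Finset.sum_congr rfl fun m _ => by ring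

theorem sum_gam_div {z b : Fin n → ℝ} (hz : StrictAnti z) (hbz : ∀ j i, b j ≠ z i) (j : Fin n) :
    ∑ i, gam z b i / (b j - z i) = 1 := by
  have h := prod_sub_eq_gam hz.injective b (b j)
  rw [Finset.prod_eq_zero (Finset.mem_univ j) (sub_self _)] at h
  have hne : ∀ i, b j - z i ≠ 0 := fun i => sub_ne_zero.2 (hbz j i)
  have hP : ∏ i, (b j - z i) ≠ 0 := Finset.prod_ne_zero_iff.2 fun i _ => hne i
  have h2 : ∑ i, gam z b i * ∏ l ∈ Finset.univ.erase i, (b j - z l) =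
      (∑ i, gam z b i / (b j - z i)) * ∏ i, (b j - z i) := by
    rw [Finset.sum_mul]
    refine Finset.sum_congr rfl fun i _ => ?_
    rw [← Finset.mul_prod_erase _ _ (Finset.mem_univ i)]
    have := hne i
    field_simp
  rw [h2] at h
  exact mul_right_cancel₀ hP (by linarith)

theorem ne_of_mem_aboveSet {z b : Fin n → ℝ} (hz : StrictAnti z) (hb : b ∈ aboveSet z)
    (j i : Fin n) : b j ≠ z i := by
  rcases lt_or_ge i j with h | h
  · exact (hb.2 i j h).ne
  · exact ((hz.antitone h).trans_lt (hb.1 j)).ne'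

theorem sum_gam {z : Fin n → ℝ} (hz : Function.Injective z) (b : Fin n → ℝ) :
    ∑ i, gam z b i = ∑ j, b j - ∑ i, z i := by
  rcases Nat.eq_zero_or_pos n with rfl | hn
  · simp
  have h := congrArg (fun p => Polynomial.coeff p (n - 1)) (prod_X_sub_C_eq_resPoly hz b)
  have h1 : ∀ v : Fin n → ℝ, (∏ j, (Polynomial.X - Polynomial.C (v j))).coeff (n - 1) =
      -∑ j, v j := by
    intro v
    have h1 := Polynomial.prod_X_sub_C_coeff_card_pred (Finset.univ : Finset (Fin n)) v (by simpa)
    rwa [Finset.card_univ, Fintype.card_fin] at h1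
  have h2 : ∀ i, (∏ j ∈ Finset.univ.erase i,
      (Polynomial.X - Polynomial.C (z j))).coeff (n - 1) = 1 := by
    intro i
    have hm : (∏ j ∈ Finset.univ.erase i, (Polynomial.X - Polynomial.C (z j))).Monic :=
      Polynomial.monic_prod_of_monic _ _ fun _ _ => Polynomial.monic_X_sub_C _
    have hdeg : (∏ j ∈ Finset.univ.erase i, (Polynomial.X - Polynomial.C (z j))).natDegree =
        n - 1 := by
      rw [Polynomial.natDegree_prod_of_monic _ _ fun _ _ => Polynomial.monic_X_sub_C _]
      simp
    rw [← hdeg]; exact hm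
  simp only [resPoly, Polynomial.coeff_sub, Polynomial.finsetSum_coeff, Polynomial.coeff_C_mul, h1,
    h2, mul_one] at h
  linarith

/-- Law of the squared radius under Lebesgue measure on `ℝ^D`, up to a factor. -/
def radMeasure (D : ℕ) : Measure ℝ :=
  (volume.restrict (Set.Ioi 0)).withDensity fun s => ENNReal.ofReal (s ^ ((D : ℝ) / 2 - 1) / 2)

instance sigmaFinite_radMeasure (D : ℕ) : SigmaFinite (radMeasure D) := by
  rw [radMeasure]
  exact SigmaFinite.withDensity_of_ne_top (Eventually.of_forall fun _ => ENNReal.ofReal_ne_top)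

theorem lintegral_radMeasure (D : ℕ) {f : ℝ → ℝ≥0∞} (hf : Measurable f) :
    ∫⁻ s, f s ∂radMeasure D =
      ∫⁻ s in Set.Ioi 0, ENNReal.ofReal (s ^ ((D : ℝ) / 2 - 1) / 2) * f s := by
  rw [radMeasure, lintegral_withDensity_eq_lintegral_mul _ (by fun_prop) hf]
  rfl

theorem lintegral_radMeasure_sq {D : ℕ} (hD : 0 < D) {f : ℝ → ℝ≥0∞} (hf : Measurable f) :
    ∫⁻ s, f (√s) ∂radMeasure D =
      ∫⁻ r in Set.Ioi 0, ENNReal.ofReal (r ^ (D - 1)) * f r := by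
  have himg : (fun r : ℝ => r ^ 2) '' Set.Ioi 0 = Set.Ioi 0 := by
    ext s
    constructor
    · rintro ⟨r, hr, rfl⟩
      exact pow_pos (Set.mem_Ioi.1 hr) 2
    · intro hs
      exact ⟨√s, Real.sqrt_pos.2 hs, Real.sq_sqrt (le_of_lt hs)⟩
  have hinj : Set.InjOn (fun r : ℝ => r ^ 2) (Set.Ioi 0) := fun x hx y hy h =>
    (pow_left_inj₀ (le_of_lt hx) (le_of_lt hy) two_ne_zero).1 h
  rw [lintegral_radMeasure D (by fun_prop), ← himg,
    lintegral_image_eq_lintegral_abs_deriv_mul measurableSet_Ioi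
      (fun x _ => (hasDerivAt_pow 2 x).hasDerivWithinAt) hinj, himg]
  refine setLIntegral_congr_fun measurableSet_Ioi fun r (hr : 0 < r) => ?_
  rw [Real.sqrt_sq hr.le, ← mul_assoc, ← ENNReal.ofReal_mul (abs_nonneg _)]
  congr 2
  rw [← Real.rpow_natCast_mul hr.le, ← Real.rpow_natCast r (D - 1), Nat.cast_sub hD,
    abs_of_pos (by positivity)]
  have : r ^ ((D : ℝ) - (Nat.succ 0 : ℕ)) = r * r ^ ((2 : ℕ) * ((D : ℝ) / 2 - 1)) := by
    nth_rewrite 2 [← Real.rpow_one r]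
    rw [← Real.rpow_add hr]
    congr 1
    push_cast
    ring
  rw [this]
  push_cast
  ring

/-- Polar coordinates with the squared radius as radial variable. -/
theorem measurePreserving_sqrt_smul {D : ℕ} (hD : 0 < D) :
    MeasurePreserving (fun p : Metric.sphere (0 : EuclideanSpace ℝ (Fin D)) 1 × ℝ =>
        √p.2 • (p.1 : EuclideanSpace ℝ (Fin D)))
      ((volume : Measure (EuclideanSpace ℝ (Fin D))).toSphere.prod (radMeasure D)) volume := by
  have : Nontrivial (EuclideanSpace ℝ (Fin D)) := by
    have : Nonempty (Fin D) := ⟨⟨0, hD⟩⟩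
    infer_instance
  have hm : Measurable (fun p : Metric.sphere (0 : EuclideanSpace ℝ (Fin D)) 1 × ℝ =>
        √p.2 • (p.1 : EuclideanSpace ℝ (Fin D))) := by fun_prop
  refine ⟨hm, Measure.ext_of_lintegral _ fun F hF => ?_⟩
  rw [lintegral_map hF hm, lintegral_prod _ (by fun_prop)]
  have hpol := (volume : Measure (EuclideanSpace ℝ (Fin D))).measurePreserving_homeomorphUnitSphereProd
  have h1 : ∫⁻ x, F x = ∫⁻ x : ({0}ᶜ : Set (EuclideanSpace ℝ (Fin D))),
      F x.1 ∂(Measure.comap Subtype.val volume) := by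
    rw [lintegral_subtype_comap (measurableSet_singleton _).compl, restrict_compl_singleton]
  have h2 := hpol.lintegral_comp
    (f := fun p => F ((p.2 : ℝ) • (p.1 : EuclideanSpace ℝ (Fin D)))) (by fun_prop)
  have h3 : ∀ x : ({0}ᶜ : Set (EuclideanSpace ℝ (Fin D))),
      ((homeomorphUnitSphereProd (EuclideanSpace ℝ (Fin D)) x).2 : ℝ) •
        ((homeomorphUnitSphereProd (EuclideanSpace ℝ (Fin D)) x).1 : EuclideanSpace ℝ (Fin D)) =
      x := by
    intro x
    rw [homeomorphUnitSphereProd_apply_snd_coe, homeomorphUnitSphereProd_apply_fst_coe, smul_smul,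
      mul_inv_cancel₀ (norm_ne_zero_iff.2 x.2), one_smul]
  rw [h1]
  simp_rw [h3] at h2
  rw [h2, lintegral_prod _ (by fun_prop)]
  refine lintegral_congr fun η => ?_
  rw [lintegral_radMeasure_sq hD (f := fun r => F (r • (η : EuclideanSpace ℝ (Fin D))))
    (by fun_prop), Measure.volumeIoiPow, lintegral_withDensity_eq_lintegral_mul _ (by fun_prop)
    (by fun_prop), finrank_euclideanSpace_fin]
  exact (lintegral_subtype_comap measurableSet_Ioi
    (fun r : ℝ => ENNReal.ofReal (r ^ (D - 1)) * F (r • (η : EuclideanSpace ℝ (Fin D))))).symm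

theorem lintegral_pi_radMeasure (D : ℕ) {F : (Fin n → ℝ) → ℝ≥0∞} (hF : Measurable F) :
    ∫⁻ g, F g ∂(Measure.pi fun _ => radMeasure D) =
      ∫⁻ g in {g : Fin n → ℝ | ∀ i, 0 < g i},
        (∏ i, ENNReal.ofReal (g i ^ ((D : ℝ) / 2 - 1) / 2)) * F g := by
  have hm : Measurable fun g : Fin n → ℝ => ∏ i, ENNReal.ofReal (g i ^ ((D : ℝ) / 2 - 1) / 2) := by
    fun_prop
  have : (Measure.pi fun _ : Fin n => radMeasure D) =
      (volume.restrict {g : Fin n → ℝ | ∀ i, 0 < g i}).withDensity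
        fun g => ∏ i, ENNReal.ofReal (g i ^ ((D : ℝ) / 2 - 1) / 2) := by
    refine Measure.pi_eq fun s hs => ?_
    rw [withDensity_apply _ (MeasurableSet.univ_pi hs),
      ← lintegral_indicator (MeasurableSet.univ_pi hs)]
    have h1 : ∀ i, radMeasure D (s i) = ∫⁻ x in Set.Ioi 0,
        (s i).indicator (fun x => ENNReal.ofReal (x ^ ((D : ℝ) / 2 - 1) / 2)) x := by
      intro i
      rw [radMeasure, withDensity_apply _ (hs i), lintegral_indicator (hs i)]
    rw [Finset.prod_congr rfl fun i _ => h1 i, ← setLIntegral_pos_orthant_prod fun i =>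
      Measurable.indicator (by fun_prop) (hs i)]
    refine lintegral_congr fun g => ?_
    by_cases hg : ∀ i, g i ∈ s i
    · rw [Set.indicator_of_mem (s := Set.univ.pi s) (fun i _ => hg i)]
      exact Finset.prod_congr rfl fun i _ => by rw [Set.indicator_of_mem (hg i)]
    · rw [Set.indicator_of_notMem (s := Set.univ.pi s) fun h => hg fun i => h i (Set.mem_univ i)]
      push Not at hg
      obtain ⟨i, hi⟩ := hg
      exact (Finset.prod_eq_zero (Finset.mem_univ i) (Set.indicator_of_notMem hi _)).symm
  rw [this, lintegral_withDensity_eq_lintegral_mul _ hm hF]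
  rfl

theorem lintegral_pi_polar {D : ℕ} (hD : 0 < D)
    {F : (Fin n → EuclideanSpace ℝ (Fin D)) → ℝ≥0∞} (hF : Measurable F) :
    ∫⁻ x, F x = ∫⁻ η : Fin n → Metric.sphere (0 : EuclideanSpace ℝ (Fin D)) 1,
      ∫⁻ s : Fin n → ℝ, F (fun j => √(s j) • (η j : EuclideanSpace ℝ (Fin D)))
        ∂(Measure.pi fun _ => radMeasure D) ∂(Measure.pi fun _ => volume.toSphere) := by
  have h1 := measurePreserving_pi (ι := Fin n) (fun _ => _) (fun _ => _)
    fun _ => measurePreserving_sqrt_smul hD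
  have h2 := measurePreserving_arrowProdEquivProdArrow
    (Metric.sphere (0 : EuclideanSpace ℝ (Fin D)) 1) ℝ (Fin n)
    (fun _ => volume.toSphere) (fun _ => radMeasure D)
  rw [volume_pi, ← h1.lintegral_comp hF]
  rw [← lintegral_prod (fun p : (Fin n → Metric.sphere (0 : EuclideanSpace ℝ (Fin D)) 1) ×
    (Fin n → ℝ) => F (fun j => √(p.2 j) • (p.1 j : EuclideanSpace ℝ (Fin D)))) (by fun_prop)]
  rw [← h2.lintegral_comp (by fun_prop)]
  rfl

/-- The action of a matrix on tuples of vectors. -/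
def rotMap {E : Type*} [AddCommGroup E] [Module ℝ E] (O : Matrix (Fin n) (Fin n) ℝ) :
    (Fin n → E) →ₗ[ℝ] (Fin n → E) where
  toFun x j := ∑ i, O j i • x i
  map_add' x y := by ext1 j; simp [Finset.sum_add_distrib]
  map_smul' c x := by ext1 j; simp [Finset.smul_sum, smul_comm c]

theorem rotMap_apply {E : Type*} [AddCommGroup E] [Module ℝ E] (O : Matrix (Fin n) (Fin n) ℝ)
    (x : Fin n → E) (j : Fin n) : rotMap O x j = ∑ i, O j i • x i := rfl

theorem rotMap_mul {E : Type*} [AddCommGroup E] [Module ℝ E] (O P : Matrix (Fin n) (Fin n) ℝ) :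
    rotMap (E := E) (O * P) = rotMap O ∘ₗ rotMap P := by
  refine LinearMap.ext fun x => funext fun j => ?_
  simp only [rotMap_apply, LinearMap.comp_apply, Matrix.mul_apply, Finset.sum_smul,
    Finset.smul_sum, smul_smul]
  exact Finset.sum_comm

theorem rotMap_one {E : Type*} [AddCommGroup E] [Module ℝ E] :
    rotMap (E := E) (1 : Matrix (Fin n) (Fin n) ℝ) = LinearMap.id := by
  refine LinearMap.ext fun x => funext fun j => ?_
  simp [rotMap_apply, Matrix.one_apply]

theorem norm_sq_rotMap {E : Type*} [NormedAddCommGroup E] [InnerProductSpace ℝ E]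
    (O : Matrix (Fin n) (Fin n) ℝ) (x : Fin n → E) (j : Fin n) :
    ‖rotMap O x j‖ ^ 2 = ∑ m, ∑ m', O j m * O j m' * inner ℝ (x m) (x m') := by
  rw [← real_inner_self_eq_norm_sq, rotMap_apply, sum_inner]
  refine Finset.sum_congr rfl fun m _ => ?_
  rw [inner_sum]
  refine Finset.sum_congr rfl fun m' _ => ?_
  rw [real_inner_smul_left, real_inner_smul_right]
  ring

theorem sum_norm_sq_rotMap {E : Type*} [NormedAddCommGroup E] [InnerProductSpace ℝ E]
    {O : Matrix (Fin n) (Fin n) ℝ} (hO : O * O.transpose = 1) (x : Fin n → E) :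
    ∑ j, ‖rotMap O x j‖ ^ 2 = ∑ j, ‖x j‖ ^ 2 := by
  have hO' : O.transpose * O = 1 := mul_eq_one_comm.1 hO
  have hH : ∀ m m', ∑ j, O j m * O j m' = if m = m' then 1 else 0 := by
    intro m m'
    have := congrArg (fun M => M m m') hO'
    beta_reduce at this
    rwa [Matrix.mul_apply, Matrix.one_apply] at this
  simp_rw [norm_sq_rotMap]
  rw [Finset.sum_comm]
  refine Finset.sum_congr rfl fun m _ => ?_
  rw [Finset.sum_comm]
  simp_rw [← Finset.sum_mul, hH, ite_mul, one_mul, zero_mul]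
  rw [Finset.sum_ite_eq, if_pos (Finset.mem_univ _), real_inner_self_eq_norm_sq]

theorem measurePreserving_rotMap {D : ℕ} {O : Matrix (Fin n) (Fin n) ℝ}
    (hO : O * O.transpose = 1) :
    MeasurePreserving (rotMap (E := EuclideanSpace ℝ (Fin D)) O) volume volume := by
  set L := rotMap (E := EuclideanSpace ℝ (Fin D)) O with hL
  have hcont : Continuous L := LinearMap.continuous_of_finiteDimensional L
  refine ⟨hcont.measurable, ?_⟩
  have hdet : LinearMap.det L ≠ 0 := by
    have h : LinearMap.det L * LinearMap.det (rotMap (E := EuclideanSpace ℝ (Fin D)) O.transpose) = 1 := by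
      rw [← LinearMap.det_comp, hL, ← rotMap_mul, hO, rotMap_one, LinearMap.det_id]
    exact left_ne_zero_of_mul_eq_one h
  have hmap := Measure.map_linearMap_addHaar_eq_smul_addHaar
    (volume : Measure (Fin n → EuclideanSpace ℝ (Fin D))) hdet
  set S : Set (Fin n → EuclideanSpace ℝ (Fin D)) := {x | ∑ j, ‖x j‖ ^ 2 < 1} with hS
  have hopen : IsOpen S := isOpen_lt (by fun_prop) continuous_const
  have hpre : L ⁻¹' S = S := by
    ext x
    simp only [hS, Set.mem_preimage, Set.mem_ofPred_eq, hL, sum_norm_sq_rotMap hO]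
  have hpos : volume S ≠ 0 := (hopen.measure_pos volume ⟨0, by simp [hS]⟩).ne'
  have hfin : volume S ≠ ∞ := by
    have hsub : S ⊆ Metric.closedBall 0 1 := by
      intro x (hx : ∑ j, ‖x j‖ ^ 2 < 1)
      rw [mem_closedBall_zero_iff, pi_norm_le_iff_of_nonneg zero_le_one]
      intro j
      have : ‖x j‖ ^ 2 ≤ ∑ j, ‖x j‖ ^ 2 :=
        Finset.single_le_sum (f := fun j => ‖x j‖ ^ 2) (fun j _ => sq_nonneg _) (Finset.mem_univ j)
      nlinarith [norm_nonneg (x j)]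
    exact ((isCompact_closedBall 0 1).measure_lt_top.trans_le' (measure_mono hsub)).ne
  have h := congrArg (fun ν => ν S) hmap
  simp only [Measure.smul_apply, smul_eq_mul] at h
  rw [Measure.map_apply hcont.measurable hopen.measurableSet, hpre] at h
  have hc : ENNReal.ofReal |(LinearMap.det L)⁻¹| = 1 := by
    have h' : 1 * volume S = ENNReal.ofReal |(LinearMap.det L)⁻¹| * volume S := by rwa [one_mul]
    exact ((ENNReal.mul_left_inj hpos hfin).1 h').symm
  rw [hmap, hc, one_smul]

theorem prod_sub_eq_neg_gam_mul {z : Fin n → ℝ} (hz : Function.Injective z) (b : Fin n → ℝ)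
    (i : Fin n) :
    ∏ l, (z i - b l) = -(gam z b i * ∏ l ∈ Finset.univ.erase i, (z i - z l)) := by
  rw [prod_sub_eq_gam hz b (z i), Finset.prod_eq_zero (Finset.mem_univ i) (sub_self _), zero_sub,
    Finset.sum_eq_single i (fun l _ hl => ?_) (fun h => absurd (Finset.mem_univ i) h)]
  rw [Finset.prod_eq_zero (Finset.mem_erase.2 ⟨hl.symm, Finset.mem_univ i⟩) (sub_self _), mul_zero]

/-- Values at `z i` of the polynomial obtained from two successive interlacing steps above `z` with
residues `g`, `s`; it is symmetric under exchanging the two steps. -/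
def exchVec (z g s : Fin n → ℝ) (G : Fin n → Fin n → ℝ) (i : Fin n) : ℝ :=
  -(∏ l ∈ Finset.univ.erase i, (z i - z l)) * (g i + s i - ∑ m ∈ Finset.univ.erase i,
    (g m * s i + g i * s m - 2 * (√(g i) * √(g m)) * (√(s i) * √(s m) * G i m)) / (z i - z m))

theorem exchVec_comm (z g s : Fin n → ℝ) (G : Fin n → Fin n → ℝ) :
    exchVec z g s G = exchVec z s g G := by
  funext i
  rw [exchVec, exchVec, add_comm (g i)]
  congr 2
  exact Finset.sum_congr rfl fun m _ => by ring

theorem prod_sub_rotMap {D : ℕ} {z b : Fin n → ℝ} (hz : StrictAnti z) (hb : b ∈ aboveSet z)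
    {s : Fin n → ℝ} (hs : ∀ i, 0 ≤ s i)
    (η : Fin n → Metric.sphere (0 : EuclideanSpace ℝ (Fin D)) 1) (i : Fin n) :
    ∏ l, (z i - b l) - ∑ j, ‖rotMap (rotMat z b (gam z b))
        (fun j => √(s j) • (η j : EuclideanSpace ℝ (Fin D))) j‖ ^ 2 *
          ∏ l ∈ Finset.univ.erase j, (z i - b l) =
      exchVec z (gam z b) s (fun i m => inner ℝ (η i : EuclideanSpace ℝ (Fin D)) (η m)) i := by
  set G : Fin n → Fin n → ℝ := fun m m' => inner ℝ (√(s m) • (η m : EuclideanSpace ℝ (Fin D)))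
    (√(s m') • (η m' : EuclideanSpace ℝ (Fin D))) with hG
  have hbz := ne_of_mem_aboveSet hz hb
  have hGd : ∀ m, G m m = s m := by
    intro m
    rw [hG]
    simp only
    rw [real_inner_self_eq_norm_sq, norm_smul, norm_eq_of_mem_sphere, mul_one, Real.norm_eq_abs,
      sq_abs, Real.sq_sqrt (hs m)]
  have hGo : ∀ m m', G m m' = √(s m) * √(s m') *
      inner ℝ (η m : EuclideanSpace ℝ (Fin D)) (η m') := by
    intro m m'
    rw [hG]
    simp only
    rw [real_inner_smul_left, real_inner_smul_right, mul_assoc]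
  have key := sum_rotMat_gram (gam_pos hz hb) hz.injective
    (strictAnti_of_mem_aboveSet hb).injective hbz (sum_gam_div hz hbz)
    (G := G) (fun m m' => real_inner_comm _ _) i
  set O := rotMat z b (gam z b) with hO
  have h1 : ∀ j, ‖rotMap O (fun j => √(s j) • (η j : EuclideanSpace ℝ (Fin D))) j‖ ^ 2 *
      ∏ l ∈ Finset.univ.erase j, (z i - b l) =
      -(∏ l ∈ Finset.univ.erase i, (z i - z l)) *
        ∑ m, ∑ m', gam z b i / (z i - b j) * (O j m * O j m') * G m m' := by
    intro j
    have hne : z i - b j ≠ 0 := sub_ne_zero.2 (hbz j i).symm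
    have h2 : ∏ l ∈ Finset.univ.erase j, (z i - b l) =
        -(∏ l ∈ Finset.univ.erase i, (z i - z l)) * (gam z b i / (z i - b j)) := by
      have := prod_sub_eq_neg_gam_mul hz.injective b i
      rw [← Finset.mul_prod_erase _ _ (Finset.mem_univ j)] at this
      field_simp
      linarith
    rw [norm_sq_rotMap, h2, mul_comm, mul_assoc, Finset.mul_sum]
    congr 1
    refine Finset.sum_congr rfl fun m _ => ?_
    rw [Finset.mul_sum]
    exact Finset.sum_congr rfl fun m' _ => by ring
  rw [Finset.sum_congr rfl fun j _ => h1 j, ← Finset.mul_sum, Finset.sum_comm]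
  have h3 : ∀ m, ∑ j, ∑ m', gam z b i / (z i - b j) * (O j m * O j m') * G m m' =
      ∑ m', (∑ j, gam z b i / (z i - b j) * (O j m * O j m')) * G m m' := by
    intro m
    rw [Finset.sum_comm]
    exact Finset.sum_congr rfl fun m' _ => by rw [Finset.sum_mul]
  rw [Finset.sum_congr rfl fun m _ => h3 m, key, prod_sub_eq_neg_gam_mul hz.injective, exchVec,
    hGd i]
  have h4 : ∀ m ∈ Finset.univ.erase i,
      (gam z b m * s i + gam z b i * G m m - 2 * (√(gam z b i) * √(gam z b m)) * G i m) /
        (z i - z m) = (gam z b m * s i + gam z b i * s m - 2 * (√(gam z b i) * √(gam z b m)) *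
          (√(s i) * √(s m) * inner ℝ (η i : EuclideanSpace ℝ (Fin D)) (η m))) / (z i - z m) := by
    intro m _
    rw [hGd, hGo]
  rw [Finset.sum_congr rfl h4]
  ring

theorem ae_radMeasure_pos (D : ℕ) :
    ∀ᵐ s : Fin n → ℝ ∂(Measure.pi fun _ => radMeasure D), ∀ i, 0 < s i := by
  rw [ae_all_iff]
  intro i
  refine (Measure.tendsto_eval_ae_ae (μ := fun _ : Fin n => radMeasure D) (i := i)).eventually
    (p := fun s => 0 < s) ?_
  exact (withDensity_absolutelyContinuous _ _).ae_le (ae_restrict_mem measurableSet_Ioi)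

theorem lintegral_rotate {D : ℕ} (hD : 0 < D) {z b : Fin n → ℝ} (hz : StrictAnti z)
    (hb : b ∈ aboveSet z) {f : ℝ × (Fin n → ℝ) → ℝ≥0∞} (hf : Measurable f) :
    (Measure.pi fun _ : Fin n =>
        (volume : Measure (EuclideanSpace ℝ (Fin D))).toSphere) Set.univ *
      ∫⁻ s : Fin n → ℝ, f (∑ j, s j, fun i => ∏ l, (z i - b l) -
        ∑ j, s j * ∏ l ∈ Finset.univ.erase j, (z i - b l)) ∂(Measure.pi fun _ => radMeasure D) =
    ∫⁻ η : Fin n → Metric.sphere (0 : EuclideanSpace ℝ (Fin D)) 1,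
      ∫⁻ s : Fin n → ℝ, f (∑ j, s j, exchVec z (gam z b) s
        (fun i m => inner ℝ (η i : EuclideanSpace ℝ (Fin D)) (η m)))
        ∂(Measure.pi fun _ => radMeasure D) ∂(Measure.pi fun _ => volume.toSphere) := by
  have hbz := ne_of_mem_aboveSet hz hb
  set F : (Fin n → EuclideanSpace ℝ (Fin D)) → ℝ≥0∞ := fun x =>
    f (∑ j, ‖x j‖ ^ 2, fun i => ∏ l, (z i - b l) -
        ∑ j, ‖x j‖ ^ 2 * ∏ l ∈ Finset.univ.erase j, (z i - b l)) with hF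
  have hFm : Measurable F := by
    refine hf.comp (Measurable.prodMk (by fun_prop) (measurable_pi_lambda _ fun i => by fun_prop))
  have hrot := rotMat_mul_transpose (gam_pos hz hb) (strictAnti_of_mem_aboveSet hb).injective hbz
    (sum_gam_div hz hbz)
  have hmp := measurePreserving_rotMap (D := D) hrot
  have hn : ∀ (s : Fin n → ℝ) (η : Fin n → Metric.sphere (0 : EuclideanSpace ℝ (Fin D)) 1) (j),
      (∀ i, 0 < s i) → ‖√(s j) • (η j : EuclideanSpace ℝ (Fin D))‖ ^ 2 = s j := by
    intro s η j hs
    rw [norm_smul, norm_eq_of_mem_sphere, mul_one, Real.norm_eq_abs, sq_abs, Real.sq_sqrt (hs j).le]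
  have h1 := lintegral_pi_polar hD hFm
  have h2 := lintegral_pi_polar hD (hFm.comp hmp.measurable)
  rw [← hmp.lintegral_comp hFm] at h1
  rw [mul_comm, ← lintegral_const]
  refine Eq.trans ?_ (h1.symm.trans (h2.trans ?_))
  · refine lintegral_congr fun η => lintegral_congr_ae ?_
    filter_upwards [ae_radMeasure_pos D] with s hs
    simp only [hF, hn s η _ hs]
  · refine lintegral_congr fun η => lintegral_congr_ae ?_
    filter_upwards [ae_radMeasure_pos D] with s hs
    simp only [hF, Function.comp_apply]
    rw [sum_norm_sq_rotMap hrot]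
    simp only [hn s η _ hs]
    congr 2
    funext i
    exact prod_sub_rotMap hz hb (fun i => (hs i).le) η i

/-- Density of the `n`-point level `b` above `z` coming from squared radii in `ℝ^D`. -/
def stepWt (D : ℕ) (z b : Fin n → ℝ) : ℝ≥0∞ :=
  ENNReal.ofReal (vand b / vand z) * ∏ i, ENNReal.ofReal (gam z b i ^ ((D : ℝ) / 2 - 1) / 2)

theorem lintegral_stepWt (D : ℕ) {z : Fin n → ℝ} (hz : StrictAnti z)
    {F : (Fin n → ℝ) → ℝ≥0∞} (hF : Measurable F) :
    ∫⁻ b in aboveSet z, stepWt D z b * F (gam z b) =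
      ∫⁻ g, F g ∂(Measure.pi fun _ => radMeasure D) := by
  rw [lintegral_pi_radMeasure D hF, lintegral_pos_orthant_eq hz]
  simp only [stepWt, mul_assoc]

theorem measurable_exchVec (z : Fin n → ℝ) {α : Type*} [MeasurableSpace α] {g s : α → Fin n → ℝ}
    {G : α → Fin n → Fin n → ℝ} (hg : Measurable g) (hs : Measurable s) (hG : Measurable G) :
    Measurable fun a => exchVec z (g a) (s a) (G a) := by
  refine measurable_pi_lambda _ fun i => ?_
  unfold exchVec
  fun_prop

theorem lintegral_exchange_aux {D : ℕ} (hD : 0 < D) {z : Fin n → ℝ} (hz : StrictAnti z)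
    {f : ℝ × ℝ × (Fin n → ℝ) → ℝ≥0∞} (hf : Measurable f) :
    (Measure.pi fun _ : Fin n =>
        (volume : Measure (EuclideanSpace ℝ (Fin D))).toSphere) Set.univ *
      ∫⁻ b in aboveSet z, stepWt D z b * ∫⁻ w in aboveSet b, stepWt D b w *
        f (∑ i, b i - ∑ i, z i, ∑ i, w i - ∑ i, b i, fun i => ∏ j, (z i - w j)) =
    ∫⁻ η : Fin n → Metric.sphere (0 : EuclideanSpace ℝ (Fin D)) 1,
      ∫⁻ g : Fin n → ℝ, ∫⁻ s : Fin n → ℝ, f (∑ j, g j, ∑ j, s j, exchVec z g s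
        (fun i m => inner ℝ (η i : EuclideanSpace ℝ (Fin D)) (η m)))
        ∂(Measure.pi fun _ => radMeasure D) ∂(Measure.pi fun _ => radMeasure D)
        ∂(Measure.pi fun _ => volume.toSphere) := by
  set σ := (Measure.pi fun _ : Fin n =>
        (volume : Measure (EuclideanSpace ℝ (Fin D))).toSphere) with hσ
  have hmeas : Measurable fun p : ((Fin n → Metric.sphere (0 : EuclideanSpace ℝ (Fin D)) 1) ×
      (Fin n → ℝ)) × (Fin n → ℝ) => f (∑ j, p.1.2 j, ∑ j, p.2 j, exchVec z p.1.2 p.2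
        (fun i m => inner ℝ (p.1.1 i : EuclideanSpace ℝ (Fin D)) (p.1.1 m))) := by
    refine hf.comp (Measurable.prodMk (by fun_prop) (Measurable.prodMk (by fun_prop)
      (measurable_exchVec z (by fun_prop) (by fun_prop) ?_)))
    exact measurable_pi_lambda _ fun i => measurable_pi_lambda _ fun m => by fun_prop
  have hm1 := hmeas.lintegral_prod_right' (ν := (Measure.pi fun _ : Fin n => radMeasure D))
  have hm2 := (hm1.comp measurable_swap).lintegral_prod_right' (ν := σ)
  simp only [Function.comp_def, Prod.swap_prod_mk] at hm2
  rw [lintegral_lintegral_swap hm1.aemeasurable, ← lintegral_stepWt D hz hm2,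
    ← lintegral_const_mul']
  swap
  · rw [hσ]; exact measure_ne_top _ _
  refine setLIntegral_congr_fun (isOpen_aboveSet z).measurableSet fun b hb => ?_
  have hbz := strictAnti_of_mem_aboveSet hb
  have h := lintegral_rotate hD hz hb (f := fun p => f (∑ j, gam z b j, p.1, p.2)) (by fun_prop)
  rw [← h, mul_left_comm]
  congr 2
  rw [← lintegral_stepWt D hbz]
  · refine setLIntegral_congr_fun (isOpen_aboveSet b).measurableSet fun w hw => ?_
    simp only
    rw [sum_gam hz.injective, sum_gam hbz.injective]
    congr 4
    funext i
    exact prod_sub_eq_gam hbz.injective w (z i)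
  · refine hf.comp (Measurable.prodMk (by fun_prop) (Measurable.prodMk (by fun_prop)
      (measurable_pi_lambda _ fun i => by fun_prop)))

/-- Two successive interlacing steps above `z` may be exchanged. -/
theorem lintegral_exchange {D : ℕ} (hD : 0 < D) {z : Fin n → ℝ} (hz : StrictAnti z)
    {f : ℝ × ℝ × (Fin n → ℝ) → ℝ≥0∞} (hf : Measurable f) :
    ∫⁻ b in aboveSet z, stepWt D z b * ∫⁻ w in aboveSet b, stepWt D b w *
        f (∑ i, b i - ∑ i, z i, ∑ i, w i - ∑ i, b i, fun i => ∏ j, (z i - w j)) =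
    ∫⁻ b in aboveSet z, stepWt D z b * ∫⁻ w in aboveSet b, stepWt D b w *
        f (∑ i, w i - ∑ i, b i, ∑ i, b i - ∑ i, z i, fun i => ∏ j, (z i - w j)) := by
  have : Nontrivial (EuclideanSpace ℝ (Fin D)) := by
    have : Nonempty (Fin D) := ⟨⟨0, hD⟩⟩
    infer_instance
  have h1 := lintegral_exchange_aux hD hz hf
  have h2 := lintegral_exchange_aux hD hz (f := fun p => f (p.2.1, p.1, p.2.2)) (by fun_prop)
  simp only at h2
  refine (ENNReal.mul_right_inj ?_ (measure_ne_top _ _)).1 (h1.trans (Eq.trans ?_ h2.symm))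
  · rw [Measure.pi_univ, Finset.prod_ne_zero_iff]
    intro i _
    rw [Measure.measure_univ_ne_zero]
    exact Measure.toSphere_ne_zero _
  · refine lintegral_congr fun η => ?_
    rw [lintegral_lintegral_swap]
    · simp only [exchVec_comm z]
    · refine Measurable.aemeasurable (hf.comp (Measurable.prodMk (by fun_prop)
        (Measurable.prodMk (by fun_prop)
        (measurable_exchVec z (by fun_prop) (by fun_prop) measurable_const))))

theorem strictAnti_eq_of_prod_sub_eq {z w w' : Fin n → ℝ} (hz : Function.Injective z)
    (hw : StrictAnti w) (hw' : StrictAnti w') (h : ∀ i, ∏ j, (z i - w j) = ∏ j, (z i - w' j)) :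
    w = w' := by
  have hp : ∏ j, (Polynomial.X - Polynomial.C (w j)) = ∏ j, (Polynomial.X - Polynomial.C (w' j)) :=
    eq_of_monic_of_eval_eq (prod_X_sub_C_monic w) (prod_X_sub_C_monic w')
      (natDegree_prod_X_sub_C w) (natDegree_prod_X_sub_C w') hz fun i => by
        simpa [Polynomial.eval_prod] using h i
  have hroot : ∀ (u : Fin n → ℝ) (x : ℝ),
      Polynomial.eval x (∏ j, (Polynomial.X - Polynomial.C (u j))) = 0 ↔ x ∈ Set.range u := by
    intro u x
    simp only [Polynomial.eval_prod, Polynomial.eval_sub, Polynomial.eval_X, Polynomial.eval_C,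
      Finset.prod_eq_zero_iff, Finset.mem_univ, true_and, sub_eq_zero, Set.mem_range]
    exact exists_congr fun _ => eq_comm
  have hr : Set.range w = Set.range w' := by
    ext x
    rw [← hroot, ← hroot, hp]
  have := (StrictMono.range_inj (f := OrderDual.toDual ∘ w) (g := OrderDual.toDual ∘ w')
    hw.dual_right hw'.dual_right).1 (by rw [Set.range_comp, Set.range_comp, hr])
  exact this

theorem isOpen_strictAnti : IsOpen {w : Fin n → ℝ | StrictAnti w} := by
  have : {w : Fin n → ℝ | StrictAnti w} = ⋂ i, ⋂ j, ⋂ (_ : i < j), {w | w j < w i} := by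
    ext w
    simp only [Set.mem_iInter]
    exact ⟨fun h i j hij => h hij, fun h i j hij => h i j hij⟩
  rw [this]
  exact isOpen_iInter_of_finite fun i => isOpen_iInter_of_finite fun j =>
    isOpen_iInter_of_finite fun _ => isOpen_lt (by fun_prop) (by fun_prop)

theorem exists_measurable_leftInverse_prod_sub {z : Fin n → ℝ} (hz : Function.Injective z) :
    ∃ r : (Fin n → ℝ) → (Fin n → ℝ), Measurable r ∧
      ∀ w, StrictAnti w → r (fun i => ∏ j, (z i - w j)) = w := by
  have hS : MeasurableSet {w : Fin n → ℝ | StrictAnti w} := isOpen_strictAnti.measurableSet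
  have hemb := ContinuousOn.measurableEmbedding (f := fun w : Fin n → ℝ => fun i => ∏ j, (z i - w j))
    hS (by fun_prop) fun w hw w' hw' h =>
      strictAnti_eq_of_prod_sub_eq hz hw hw' fun i => congrFun h i
  obtain ⟨r, hr, hr'⟩ := hemb.exists_measurable_extend
    (g := fun w : {w : Fin n → ℝ | StrictAnti w} => (w : Fin n → ℝ)) measurable_subtype_coe
    fun _ => ⟨0⟩
  exact ⟨r, hr, fun w hw => congrFun hr' ⟨w, hw⟩⟩

theorem lintegral_exchange_top {D : ℕ} (hD : 0 < D) {z : Fin n → ℝ} (hz : StrictAnti z)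
    {f : (Fin n → ℝ) × ℝ × ℝ → ℝ≥0∞} (hf : Measurable f) :
    ∫⁻ b in aboveSet z, stepWt D z b * ∫⁻ w in aboveSet b, stepWt D b w *
        f (w, ∑ i, b i - ∑ i, z i, ∑ i, w i - ∑ i, b i) =
    ∫⁻ b in aboveSet z, stepWt D z b * ∫⁻ w in aboveSet b, stepWt D b w *
        f (w, ∑ i, w i - ∑ i, b i, ∑ i, b i - ∑ i, z i) := by
  obtain ⟨r, hr, hr'⟩ := exists_measurable_leftInverse_prod_sub hz.injective
  have h := lintegral_exchange hD hz (f := fun p => f (r p.2.2, p.1, p.2.1)) (by fun_prop)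
  simp only at h
  refine Eq.trans ?_ (h.trans ?_)
  · refine setLIntegral_congr_fun (isOpen_aboveSet z).measurableSet fun b hb => ?_
    congr 1
    refine setLIntegral_congr_fun (isOpen_aboveSet b).measurableSet fun w hw => ?_
    rw [hr' w (strictAnti_of_mem_aboveSet hw)]
  · refine setLIntegral_congr_fun (isOpen_aboveSet z).measurableSet fun b hb => ?_
    congr 1
    refine setLIntegral_congr_fun (isOpen_aboveSet b).measurableSet fun w hw => ?_
    rw [hr' w (strictAnti_of_mem_aboveSet hw)]

theorem cross_comm {k : ℕ} (u : Fin k → ℝ) (v : Fin n → ℝ) : cross u v = cross v u := by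
  rw [cross, cross, Finset.prod_comm]
  exact Finset.prod_congr rfl fun _ _ => Finset.prod_congr rfl fun _ _ => abs_sub_comm _ _

theorem cross_snoc {k : ℕ} (u : Fin k → ℝ) (x : ℝ) (v : Fin n → ℝ) :
    cross (Fin.snoc u x : Fin (k + 1) → ℝ) v = cross u v * ∏ r, |x - v r| := by
  rw [cross, Fin.prod_univ_castSucc, cross]
  simp

theorem stepWt_eq (D : ℕ) {z b : Fin n → ℝ} (hz : StrictAnti z) (hb : b ∈ aboveSet z) :
    stepWt D z b = ENNReal.ofReal
      (vand z ^ (1 - 2 * ((D : ℝ) / 2)) * vand b * cross z b ^ ((D : ℝ) / 2 - 1) / 2 ^ n) := by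
  have hv := vand_pos hz.injective
  rw [stepWt, ← ENNReal.ofReal_prod_of_nonneg fun i _ =>
    div_nonneg (Real.rpow_nonneg (gam_pos hz hb i).le _) zero_le_two,
    ← ENNReal.ofReal_mul (div_nonneg (vand_nonneg b) (vand_nonneg z)), Finset.prod_div_distrib,
    Real.finsetProd_rpow _ _ (fun i _ => (gam_pos hz hb i).le), prod_gam hz hb,
    Real.div_rpow (cross_nonneg _ _) (sq_nonneg _), ← Real.rpow_natCast_mul hv.le]
  congr 1
  have : vand z ^ (1 - 2 * ((D : ℝ) / 2)) * vand z * vand z ^ ((2 : ℕ) * ((D : ℝ) / 2 - 1)) = 1 := by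
    nth_rewrite 2 [← Real.rpow_one (vand z)]
    rw [← Real.rpow_add hv, ← Real.rpow_add hv]
    have e : 1 - 2 * ((D : ℝ) / 2) + 1 + (2 : ℕ) * ((D : ℝ) / 2 - 1) = 0 := by push_cast; ring
    rw [e, Real.rpow_zero]
  have hp := Real.rpow_pos_of_pos hv ((2 : ℕ) * ((D : ℝ) / 2 - 1))
  rw [Finset.prod_const, Finset.card_univ, Fintype.card_fin]
  generalize vand z ^ (1 - 2 * ((D : ℝ) / 2)) = p at *
  generalize vand z ^ ((2 : ℕ) * ((D : ℝ) / 2 - 1)) = q at *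
  generalize cross z b ^ ((D : ℝ) / 2 - 1) = r at *
  field_simp
  linear_combination (-vand b * r) * this

theorem lintegral_pi_snoc {F : (Fin (n + 1) → ℝ) → ℝ≥0∞} (hF : Measurable F) :
    ∫⁻ g, F g = ∫⁻ x : ℝ, ∫⁻ h : Fin n → ℝ, F (Fin.snoc h x) := by
  rw [← (volume_preserving_piFinSuccAbove (fun _ : Fin (n + 1) => ℝ)
    (Fin.last n)).symm.lintegral_comp hF, Measure.volume_eq_prod, lintegral_prod _ (by fun_prop)]
  simp [MeasurableEquiv.piFinSuccAbove, Fin.insertNthEquiv, Fin.insertNth_last']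

theorem isOpen_interlaces_prod :
    IsOpen {p : (Fin n → ℝ) × (Fin (n + 1) → ℝ) | Interlaces p.1 p.2} := by
  have : {p : (Fin n → ℝ) × (Fin (n + 1) → ℝ) | Interlaces p.1 p.2} =
      ⋂ i, {p : (Fin n → ℝ) × (Fin (n + 1) → ℝ) | p.1 i < p.2 i.castSucc} ∩
        {p | p.2 i.succ < p.1 i} := by
    ext p
    simp [Interlaces]
  rw [this]
  exact isOpen_iInter_of_finite fun i => (isOpen_lt (by fun_prop) (by fun_prop)).inter
    (isOpen_lt (by fun_prop) (by fun_prop))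

theorem measurable_dixonWt_uncurry (θ : ℝ) :
    Measurable fun p : (Fin (n + 1) → ℝ) × (Fin n → ℝ) => dixonWt θ p.1 p.2 := by
  have h1 : Measurable fun p : (Fin (n + 1) → ℝ) × (Fin n → ℝ) => vand p.1 :=
    (continuous_vand.comp continuous_fst).measurable
  have h2 : Measurable fun p : (Fin (n + 1) → ℝ) × (Fin n → ℝ) => vand p.2 :=
    (continuous_vand.comp continuous_snd).measurable
  have h3 : Measurable fun p : (Fin (n + 1) → ℝ) × (Fin n → ℝ) => cross p.1 p.2 := by
    unfold cross
    fun_prop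
  unfold dixonWt
  fun_prop

/-- The interlacing Dixon–Anderson weight on two consecutive levels, below a level `c`. -/
def pairWt (θ : ℝ) (c : Fin (n + 2) → ℝ) (b : Fin (n + 1) → ℝ) (a : Fin n → ℝ) : ℝ≥0∞ :=
  {b | Interlaces b c}.indicator (fun b => ENNReal.ofReal (dixonWt θ c b)) b *
    {a | Interlaces a b}.indicator (fun a => ENNReal.ofReal (dixonWt θ b a)) a

theorem measurable_pairWt (θ : ℝ) : Measurable
    fun p : (Fin (n + 2) → ℝ) × (Fin (n + 1) → ℝ) × (Fin n → ℝ) => pairWt θ p.1 p.2.1 p.2.2 := by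
  have key : ∀ k : ℕ, Measurable fun p : (Fin (k + 1) → ℝ) × (Fin k → ℝ) =>
      {b | Interlaces b p.1}.indicator (fun b => ENNReal.ofReal (dixonWt θ p.1 b)) p.2 := by
    intro k
    have := (measurable_dixonWt_uncurry (n := k) θ).ennreal_ofReal.indicator
      (isOpen_interlaces_prod.measurableSet.preimage measurable_swap)
    exact this
  exact ((key (n + 1)).comp (measurable_fst.prodMk measurable_snd.fst)).mul
    ((key n).comp (measurable_snd.fst.prodMk measurable_snd.snd))

theorem strictAnti_of_aboveSet_nonempty {z b : Fin n → ℝ} (hb : b ∈ aboveSet z) : StrictAnti z :=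
  fun i j hij => (hb.1 j).trans (hb.2 i j hij)

theorem Interlaces.strictAnti_left {a : Fin n → ℝ} {b : Fin (n + 1) → ℝ} (h : Interlaces a b) :
    StrictAnti b :=
  Fin.strictAnti_iff_succ_lt.2 fun i => (h i).2.trans (h i).1

theorem interlaces_snoc_iff {a : Fin n → ℝ} {b w : Fin (n + 1) → ℝ} {x : ℝ} :
    Interlaces b (Fin.snoc w x : Fin (n + 2) → ℝ) ∧ Interlaces a b ↔
      b ∈ aboveSet (Fin.snoc a x : Fin (n + 1) → ℝ) ∧ w ∈ aboveSet b := by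
  constructor
  · rintro ⟨hc, ha⟩
    have hb := ha.strictAnti_left
    have hw := hc.strictAnti_left
    refine ⟨⟨fun i => ?_, fun i k hik => ?_⟩, fun i => ?_, fun i k hik => ?_⟩
    · induction i using Fin.lastCases with
      | last => simpa using (hc (Fin.last n)).2
      | cast i => simpa using (ha i).1
    · induction i using Fin.lastCases with
      | last => exact absurd hik (Fin.le_last k).not_gt
      | cast i =>
        simpa using (hb.antitone (by simpa [Fin.le_def, Fin.lt_def] using hik)).trans_lt (ha i).2
    · simpa using (hc i).1
    · have h1 := (hc i).2
      have h2 : (Fin.snoc w x : Fin (n + 2) → ℝ) k.castSucc ≤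
        (Fin.snoc w x : Fin (n + 2) → ℝ) i.succ := hw.antitone (by simpa [Fin.le_def] using hik)
      rw [Fin.snoc_castSucc] at h2
      exact h2.trans_lt h1
  · rintro ⟨hz, hw⟩
    refine ⟨fun i => ⟨by simpa using hw.1 i, ?_⟩, fun i => ⟨?_, ?_⟩⟩
    · induction i using Fin.lastCases with
      | last => simpa using hz.1 (Fin.last n)
      | cast i =>
        rw [← Fin.castSucc_succ, Fin.snoc_castSucc]
        exact hw.2 _ _ (Fin.castSucc_lt_succ)
    · simpa using hz.1 i.castSucc
    · simpa using hz.2 i.castSucc i.succ Fin.castSucc_lt_succ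

theorem pairWt_snoc (D : ℕ) (a : Fin n → ℝ) (b w : Fin (n + 1) → ℝ) (x : ℝ) :
    pairWt ((D : ℝ) / 2) (Fin.snoc w x : Fin (n + 2) → ℝ) b a =
      (aboveSet (Fin.snoc a x : Fin (n + 1) → ℝ)).indicator
        (fun b => stepWt D (Fin.snoc a x : Fin (n + 1) → ℝ) b *
          (aboveSet b).indicator (fun w => stepWt D b w * ENNReal.ofReal
            (4 ^ (n + 1) * vand (Fin.snoc w x : Fin (n + 2) → ℝ) ^ (1 - 2 * ((D : ℝ) / 2)) *
              vand a / (vand w *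
                vand (Fin.snoc a x : Fin (n + 1) → ℝ) ^ (1 - 2 * ((D : ℝ) / 2))))) w) b := by
  by_cases h : b ∈ aboveSet (Fin.snoc a x : Fin (n + 1) → ℝ) ∧ w ∈ aboveSet b
  · have h' := interlaces_snoc_iff.2 h
    have hz := strictAnti_of_aboveSet_nonempty h.1
    have hb := strictAnti_of_mem_aboveSet h.1
    have hw := strictAnti_of_mem_aboveSet h.2
    rw [pairWt, Set.indicator_of_mem (s := {b | Interlaces b (Fin.snoc w x : Fin (n + 2) → ℝ)}) h'.1,
      Set.indicator_of_mem (s := {a | Interlaces a b}) h'.2, Set.indicator_of_mem h.1,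
      Set.indicator_of_mem h.2, stepWt_eq D hz h.1, stepWt_eq D hb h.2,
      ← ENNReal.ofReal_mul (dixonWt_nonneg _ _ _), ← ENNReal.ofReal_mul, ← ENNReal.ofReal_mul]
    · congr 1
      have hvz := Real.rpow_pos_of_pos (vand_pos hz.injective) (1 - 2 * ((D : ℝ) / 2))
      have hvw := vand_pos hw.injective
      have e : cross (Fin.snoc w x : Fin (n + 2) → ℝ) b ^ ((D : ℝ) / 2 - 1) *
          cross b a ^ ((D : ℝ) / 2 - 1) =
          cross (Fin.snoc a x : Fin (n + 1) → ℝ) b ^ ((D : ℝ) / 2 - 1) *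
          cross b w ^ ((D : ℝ) / 2 - 1) := by
        rw [← Real.mul_rpow (cross_nonneg _ _) (cross_nonneg _ _),
          ← Real.mul_rpow (cross_nonneg _ _) (cross_nonneg _ _), cross_snoc, cross_snoc,
          cross_comm b a, cross_comm b w]
        congr 1
        ring
      rw [dixonWt, dixonWt]
      generalize vand (Fin.snoc a x : Fin (n + 1) → ℝ) ^ (1 - 2 * ((D : ℝ) / 2)) = p at *
      generalize cross (Fin.snoc w x : Fin (n + 2) → ℝ) b ^ ((D : ℝ) / 2 - 1) = q1 at *
      generalize cross b a ^ ((D : ℝ) / 2 - 1) = q2 at *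
      generalize cross (Fin.snoc a x : Fin (n + 1) → ℝ) b ^ ((D : ℝ) / 2 - 1) = q3 at *
      generalize cross b w ^ ((D : ℝ) / 2 - 1) = q4 at *
      generalize vand (Fin.snoc w x : Fin (n + 2) → ℝ) ^ (1 - 2 * ((D : ℝ) / 2)) = r1
      generalize vand b ^ (1 - 2 * ((D : ℝ) / 2)) = r2
      have h4 : (4 : ℝ) ^ (n + 1) = 2 ^ (n + 1) * 2 ^ (n + 1) := by
        rw [← mul_pow]; norm_num
      rw [h4]
      field_simp
      linear_combination (r1 * vand b * r2 * vand a) * e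
    · have := vand_nonneg (Fin.snoc a x : Fin (n + 1) → ℝ)
      have := vand_nonneg b
      have := cross_nonneg (Fin.snoc a x : Fin (n + 1) → ℝ) b
      positivity
    · have := vand_nonneg w
      have := vand_nonneg b
      have := cross_nonneg b w
      positivity
  · have h' := mt interlaces_snoc_iff.1 h
    rw [pairWt]
    by_cases h1 : b ∈ aboveSet (Fin.snoc a x : Fin (n + 1) → ℝ)
    · rw [Set.indicator_of_mem h1, Set.indicator_of_notMem fun h2 => h ⟨h1, h2⟩, mul_zero]
      by_cases h3 : Interlaces b (Fin.snoc w x : Fin (n + 2) → ℝ)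
      · rw [Set.indicator_of_notMem (s := {a | Interlaces a b}) fun h4 => h' ⟨h3, h4⟩, mul_zero]
      · rw [Set.indicator_of_notMem (s := {b | Interlaces b (Fin.snoc w x : Fin (n + 2) → ℝ)}) h3,
          zero_mul]
    · rw [Set.indicator_of_notMem h1]
      by_cases h3 : Interlaces b (Fin.snoc w x : Fin (n + 2) → ℝ)
      · rw [Set.indicator_of_notMem (s := {a | Interlaces a b}) fun h4 => h' ⟨h3, h4⟩, mul_zero]
      · rw [Set.indicator_of_notMem (s := {b | Interlaces b (Fin.snoc w x : Fin (n + 2) → ℝ)}) h3,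
          zero_mul]

theorem lintegral_pi_reverse {α β γ : Type*} [MeasurableSpace α] [MeasurableSpace β]
    [MeasurableSpace γ] {μ : Measure α} {ν : Measure β} {ρ : Measure γ} [SFinite μ] [SFinite ν]
    [SFinite ρ] {f : α × β × γ → ℝ≥0∞} (hf : Measurable f) :
    ∫⁻ x, ∫⁻ y, ∫⁻ z, f (x, y, z) ∂ρ ∂ν ∂μ = ∫⁻ z, ∫⁻ y, ∫⁻ x, f (x, y, z) ∂μ ∂ν ∂ρ := by
  have h1 : ∀ x, ∫⁻ y, ∫⁻ z, f (x, y, z) ∂ρ ∂ν = ∫⁻ z, ∫⁻ y, f (x, y, z) ∂ν ∂ρ := fun x =>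
    lintegral_lintegral_swap (by fun_prop)
  simp_rw [h1]
  rw [lintegral_lintegral_swap]
  · refine lintegral_congr fun z => ?_
    rw [lintegral_lintegral_swap (by fun_prop)]
  · refine (Measurable.lintegral_prod_right' (f := fun p : (α × γ) × β => f (p.1.1, p.2, p.1.2))
      (by fun_prop)).aemeasurable

theorem lintegral_pairWt_swap {D : ℕ} (hD : 0 < D)
    {F : (Fin (n + 2) → ℝ) × (Fin n → ℝ) × ℝ × ℝ → ℝ≥0∞} (hF : Measurable F) :
    ∫⁻ c, ∫⁻ b, ∫⁻ a, pairWt ((D : ℝ) / 2) c b a *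
        F (c, a, ∑ i, c i - ∑ i, b i, ∑ i, b i - ∑ i, a i) =
    ∫⁻ c, ∫⁻ b, ∫⁻ a, pairWt ((D : ℝ) / 2) c b a *
        F (c, a, ∑ i, b i - ∑ i, a i, ∑ i, c i - ∑ i, b i) := by
  have hP := measurable_pairWt (n := n) ((D : ℝ) / 2)
  have hsnoc : Measurable fun p : ℝ × (Fin (n + 1) → ℝ) =>
      (Fin.snoc p.2 p.1 : Fin (n + 2) → ℝ) := by
    refine measurable_pi_lambda _ fun i => ?_
    induction i using Fin.lastCases with
    | last => simpa using measurable_fst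
    | cast i => simp only [Fin.snoc_castSucc]; fun_prop
  have reduce : ∀ G : (Fin (n + 2) → ℝ) × (Fin n → ℝ) × ℝ × ℝ → ℝ≥0∞, Measurable G →
      ∫⁻ c, ∫⁻ b, ∫⁻ a, pairWt ((D : ℝ) / 2) c b a *
        G (c, a, ∑ i, c i - ∑ i, b i, ∑ i, b i - ∑ i, a i) =
      ∫⁻ x, ∫⁻ a : Fin n → ℝ, ∫⁻ b in aboveSet (Fin.snoc a x : Fin (n + 1) → ℝ),
        stepWt D (Fin.snoc a x : Fin (n + 1) → ℝ) b * ∫⁻ w in aboveSet b, stepWt D b w *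
          (ENNReal.ofReal (4 ^ (n + 1) *
            vand (Fin.snoc w x : Fin (n + 2) → ℝ) ^ (1 - 2 * ((D : ℝ) / 2)) * vand a /
              (vand w * vand (Fin.snoc a x : Fin (n + 1) → ℝ) ^ (1 - 2 * ((D : ℝ) / 2)))) *
            G ((Fin.snoc w x : Fin (n + 2) → ℝ), a, ∑ i, w i - ∑ i, b i + x,
              ∑ i, b i - ∑ i, (Fin.snoc a x : Fin (n + 1) → ℝ) i + x)) := by
    intro G hG
    rw [lintegral_pi_snoc]
    · refine lintegral_congr fun x => ?_
      have hsx : Measurable fun w : Fin (n + 1) → ℝ => (Fin.snoc w x : Fin (n + 2) → ℝ) :=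
        hsnoc.comp (measurable_const.prodMk measurable_id)
      rw [lintegral_pi_reverse (f := fun p : (Fin (n + 1) → ℝ) × (Fin (n + 1) → ℝ) × (Fin n → ℝ) =>
        pairWt ((D : ℝ) / 2) (Fin.snoc p.1 x : Fin (n + 2) → ℝ) p.2.1 p.2.2 *
          G (Fin.snoc p.1 x, p.2.2, ∑ i, (Fin.snoc p.1 x : Fin (n + 2) → ℝ) i - ∑ i, p.2.1 i,
            ∑ i, p.2.1 i - ∑ i, p.2.2 i))]
      · refine lintegral_congr fun a => ?_
        rw [← lintegral_indicator (isOpen_aboveSet _).measurableSet]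
        refine lintegral_congr fun b => ?_
        by_cases hb : b ∈ aboveSet (Fin.snoc a x : Fin (n + 1) → ℝ)
        · rw [Set.indicator_of_mem hb, ← lintegral_indicator (isOpen_aboveSet _).measurableSet,
            ← lintegral_const_mul' _ _ (by
              rw [stepWt_eq D (strictAnti_of_aboveSet_nonempty hb) hb]
              exact ENNReal.ofReal_ne_top)]
          refine lintegral_congr fun w => ?_
          rw [pairWt_snoc, Set.indicator_of_mem hb]
          by_cases hw : w ∈ aboveSet b
          · rw [Set.indicator_of_mem hw, Set.indicator_of_mem hw, Fin.sum_snoc, Fin.sum_snoc,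
              mul_assoc, mul_assoc, sub_add_eq_sub_sub (∑ i, b i), sub_add_cancel,
              add_sub_right_comm]
          · rw [Set.indicator_of_notMem hw, Set.indicator_of_notMem hw, mul_zero, zero_mul]
        · rw [Set.indicator_of_notMem hb]
          simp only [pairWt_snoc, Set.indicator_of_notMem hb, zero_mul, lintegral_zero]
      · exact (hP.comp ((hsx.comp measurable_fst).prodMk measurable_snd)).mul
          (hG.comp (by fun_prop))
    · refine Measurable.lintegral_prod_right'
        (f := fun p : (Fin (n + 2) → ℝ) × (Fin (n + 1) → ℝ) => ∫⁻ a, pairWt ((D : ℝ) / 2) p.1 p.2 a *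
          G (p.1, a, ∑ i, p.1 i - ∑ i, p.2 i, ∑ i, p.2 i - ∑ i, a i)) ?_
      refine Measurable.lintegral_prod_right'
        (f := fun q : ((Fin (n + 2) → ℝ) × (Fin (n + 1) → ℝ)) × (Fin n → ℝ) =>
          pairWt ((D : ℝ) / 2) q.1.1 q.1.2 q.2 *
          G (q.1.1, q.2, ∑ i, q.1.1 i - ∑ i, q.1.2 i, ∑ i, q.1.2 i - ∑ i, q.2 i)) ?_
      exact (hP.comp (measurable_fst.fst.prodMk (measurable_fst.snd.prodMk measurable_snd))).mul
        (by fun_prop)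
  rw [reduce F hF, reduce (fun p => F (p.1, p.2.1, p.2.2.2, p.2.2.1)) (by fun_prop)]
  refine lintegral_congr fun x => lintegral_congr fun a => ?_
  by_cases hz : StrictAnti (Fin.snoc a x : Fin (n + 1) → ℝ)
  · have hsx : Measurable fun w : Fin (n + 1) → ℝ => (Fin.snoc w x : Fin (n + 2) → ℝ) :=
      hsnoc.comp (measurable_const.prodMk measurable_id)
    refine (lintegral_exchange_top hD hz
      (f := fun p => ENNReal.ofReal (4 ^ (n + 1) *
            vand (Fin.snoc p.1 x : Fin (n + 2) → ℝ) ^ (1 - 2 * ((D : ℝ) / 2)) * vand a /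
              (vand p.1 * vand (Fin.snoc a x : Fin (n + 1) → ℝ) ^ (1 - 2 * ((D : ℝ) / 2)))) *
            F ((Fin.snoc p.1 x : Fin (n + 2) → ℝ), a, p.2.2 + x, p.2.1 + x)) ?_)
    refine Measurable.mul ?_ (hF.comp ?_)
    · have h1 : Measurable fun p : (Fin (n + 1) → ℝ) × ℝ × ℝ =>
          vand (Fin.snoc p.1 x : Fin (n + 2) → ℝ) :=
        continuous_vand.measurable.comp (hsx.comp measurable_fst)
      have h2 : Measurable fun p : (Fin (n + 1) → ℝ) × ℝ × ℝ => vand p.1 :=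
        continuous_vand.measurable.comp measurable_fst
      fun_prop
    · exact (hsx.comp measurable_fst).prodMk (by fun_prop)
  · have he : aboveSet (Fin.snoc a x : Fin (n + 1) → ℝ) = ∅ :=
      Set.eq_empty_of_forall_notMem fun b hb => hz (strictAnti_of_aboveSet_nonempty hb)
    rw [he, setLIntegral_empty, setLIntegral_empty]

theorem lintegral_dixon_dixon {θ : ℝ} (hθ : 0 < θ) (c : Fin (n + 2) → ℝ)
    (F : (Fin (n + 1) → ℝ) → (Fin n → ℝ) → ℝ≥0∞) :
    ∫⁻ b, ∫⁻ a, F b a ∂dixon θ b ∂dixon θ c =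
      ENNReal.ofReal (dixonConst θ (n + 1)) * (ENNReal.ofReal (dixonConst θ n) *
        ∫⁻ b, ∫⁻ a, pairWt θ c b a * F b a) := by
  rw [lintegral_dixon hθ]
  congr 1
  rw [← lintegral_const_mul' _ _ ENNReal.ofReal_ne_top,
    ← lintegral_indicator (isOpen_interlaces c).measurableSet]
  refine lintegral_congr fun b => ?_
  by_cases hb : Interlaces b c
  · rw [Set.indicator_of_mem (s := {b | Interlaces b c}) hb, lintegral_dixon hθ, mul_left_comm,
      ← lintegral_indicator (isOpen_interlaces b).measurableSet,
      ← lintegral_const_mul' _ _ ENNReal.ofReal_ne_top]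
    congr 1
    refine lintegral_congr fun a => ?_
    rw [pairWt, Set.indicator_of_mem (s := {b | Interlaces b c}) hb, mul_assoc]
    congr 1
    by_cases ha : Interlaces a b
    · rw [Set.indicator_of_mem (s := {a | Interlaces a b}) ha,
        Set.indicator_of_mem (s := {a | Interlaces a b}) ha]
    · rw [Set.indicator_of_notMem (s := {a | Interlaces a b}) ha,
        Set.indicator_of_notMem (s := {a | Interlaces a b}) ha, zero_mul]
  · rw [Set.indicator_of_notMem (s := {b | Interlaces b c}) hb]
    simp only [pairWt, Set.indicator_of_notMem (s := {b | Interlaces b c}) hb, zero_mul,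
      lintegral_zero, mul_zero]

theorem ae_lintegral_dixon_swap {D : ℕ} (hD : 0 < D) {F : (Fin n → ℝ) × ℝ × ℝ → ℝ≥0∞}
    (hF : Measurable F) : ∀ᵐ c : Fin (n + 2) → ℝ,
    ∫⁻ b, ∫⁻ a, F (a, ∑ i, c i - ∑ i, b i, ∑ i, b i - ∑ i, a i)
        ∂dixon ((D : ℝ) / 2) b ∂dixon ((D : ℝ) / 2) c =
    ∫⁻ b, ∫⁻ a, F (a, ∑ i, b i - ∑ i, a i, ∑ i, c i - ∑ i, b i)
        ∂dixon ((D : ℝ) / 2) b ∂dixon ((D : ℝ) / 2) c := by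
  have hθ : (0 : ℝ) < (D : ℝ) / 2 := by positivity
  have hP := measurable_pairWt (n := n) ((D : ℝ) / 2)
  have hmeas : ∀ G : (Fin (n + 2) → ℝ) × (Fin (n + 1) → ℝ) × (Fin n → ℝ) → ℝ≥0∞, Measurable G →
      Measurable fun c => ∫⁻ b, ∫⁻ a, pairWt ((D : ℝ) / 2) c b a * G (c, b, a) := by
    intro G hG
    refine Measurable.lintegral_prod_right'
      (f := fun p : (Fin (n + 2) → ℝ) × (Fin (n + 1) → ℝ) => ∫⁻ a, pairWt ((D : ℝ) / 2) p.1 p.2 a *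
        G (p.1, p.2, a)) ?_
    refine Measurable.lintegral_prod_right'
      (f := fun q : ((Fin (n + 2) → ℝ) × (Fin (n + 1) → ℝ)) × (Fin n → ℝ) =>
        pairWt ((D : ℝ) / 2) q.1.1 q.1.2 q.2 * G (q.1.1, q.1.2, q.2)) ?_
    exact (hP.comp (measurable_fst.fst.prodMk (measurable_fst.snd.prodMk measurable_snd))).mul
      (by fun_prop)
  have key := ae_eq_of_forall_setLIntegral_eq_of_sigmaFinite (μ := volume)
    (hmeas (fun p => F (p.2.2, ∑ i, p.1 i - ∑ i, p.2.1 i, ∑ i, p.2.1 i - ∑ i, p.2.2 i))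
      (by fun_prop))
    (hmeas (fun p => F (p.2.2, ∑ i, p.2.1 i - ∑ i, p.2.2 i, ∑ i, p.1 i - ∑ i, p.2.1 i))
      (by fun_prop)) (by
      intro s hs _
      have hmul : ∀ G : (Fin (n + 2) → ℝ) × (Fin (n + 1) → ℝ) × (Fin n → ℝ) → ℝ≥0∞,
          ∫⁻ c in s, ∫⁻ b, ∫⁻ a, pairWt ((D : ℝ) / 2) c b a * G (c, b, a) =
          ∫⁻ c, ∫⁻ b, ∫⁻ a, pairWt ((D : ℝ) / 2) c b a * (s.indicator 1 c * G (c, b, a)) := by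
        intro G
        rw [← lintegral_indicator hs]
        refine lintegral_congr fun c => ?_
        by_cases hc : c ∈ s
        · simp only [Set.indicator_of_mem hc, Pi.one_apply, one_mul]
        · simp only [Set.indicator_of_notMem hc, zero_mul, mul_zero, lintegral_zero]
      refine (hmul fun p => F (p.2.2, ∑ i, p.1 i - ∑ i, p.2.1 i, ∑ i, p.2.1 i - ∑ i, p.2.2 i)).trans
        (Eq.trans ?_ (hmul fun p =>
          F (p.2.2, ∑ i, p.2.1 i - ∑ i, p.2.2 i, ∑ i, p.1 i - ∑ i, p.2.1 i)).symm)
      exact lintegral_pairWt_swap hD (F := fun p => s.indicator 1 p.1 * F (p.2.1, p.2.2.1, p.2.2.2))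
        (((measurable_one.indicator hs).comp measurable_fst).mul (by fun_prop)))
  filter_upwards [key] with c hc
  rw [lintegral_dixon_dixon hθ, lintegral_dixon_dixon hθ, hc]

section SymmetricMoments
open MvPolynomial

/-- Coefficients of `∏_{l ≠ i} (t + x_l)` as polynomials in the `x_l`. -/
def erasedCoeff (k : ℕ) (i : Fin (n + 1)) : MvPolynomial (Fin (n + 1)) ℝ :=
  (∏ l ∈ Finset.univ.erase i, (Polynomial.X + Polynomial.C (X l))).coeff k

theorem rename_erasedCoeff (σ : Equiv.Perm (Fin (n + 1))) (k : ℕ) (i : Fin (n + 1)) :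
    rename σ (erasedCoeff k i) = erasedCoeff k (σ i) := by
  have h := Polynomial.coeff_map (p := ∏ l ∈ Finset.univ.erase i, (Polynomial.X + Polynomial.C
    (X l : MvPolynomial (Fin (n + 1)) ℝ))) (rename σ : _ →ₐ[ℝ] MvPolynomial (Fin (n + 1)) ℝ).toRingHom k
  rw [erasedCoeff, erasedCoeff]
  refine h.symm.trans ?_
  rw [Polynomial.map_prod]
  congr 1
  refine Finset.prod_equiv σ (by simp) fun l _ => ?_
  simp

theorem eval_erasedCoeff (c : Fin (n + 1) → ℝ) (k : ℕ) (i : Fin (n + 1)) :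
    eval c (erasedCoeff k i) =
      (∏ l ∈ Finset.univ.erase i, (Polynomial.X + Polynomial.C (c l))).coeff k := by
  rw [erasedCoeff, ← Polynomial.coeff_map, Polynomial.map_prod]
  simp

theorem eval_esymm_eq_sum_dw {c : Fin (n + 1) → ℝ} (hc : Function.Injective c) (b : Fin n → ℝ)
    (i : Fin n) : eval b (esymm (Fin n) ℝ (i + 1)) =
      ∑ l, dw c b l * eval c (erasedCoeff (n - (i + 1)) l) := by
  have h := congrArg (fun p => Polynomial.coeff p (n - (i + 1))) (prod_add_eq_dw hc b)
  simp only [Polynomial.finsetSum_coeff, Polynomial.coeff_C_mul, ← eval_erasedCoeff] at h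
  rw [← h, Finset.prod_X_add_C_coeff _ _ (by simp), esymm, map_sum]
  have : (Finset.univ : Finset (Fin n)).card - (n - (i + 1)) = i + 1 := by
    have := i.isLt
    simp only [Finset.card_univ, Fintype.card_fin]
    omega
  rw [this]
  simp

/-- The polynomial expressing `(|c| - |b|) ^ q * ψ(e(b))` in the Dixon weights `dw c b`, with
coefficients polynomial in `c`. -/
def momentPoly (q : ℕ) (ψ : MvPolynomial (Fin n) ℝ) :
    MvPolynomial (Fin (n + 1)) (MvPolynomial (Fin (n + 1)) ℝ) :=
  (∑ l, C (X l) * X l) ^ q * aeval (fun i : Fin n => ∑ l, C (erasedCoeff (n - (i + 1)) l) * X l) ψ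

theorem eval₂_momentPoly {c : Fin (n + 1) → ℝ} (hc : StrictAnti c) (b : Fin n → ℝ) (q : ℕ)
    (ψ : MvPolynomial (Fin n) ℝ) :
    eval₂ (eval c) (dw c b) (momentPoly q ψ) = (∑ i, c i - ∑ i, b i) ^ q *
      eval b (aeval (fun i : Fin n => esymm (Fin n) ℝ (i + 1)) ψ) := by
  rw [momentPoly, eval₂_mul, eval₂_pow, ← sum_dw_mul hc b]
  refine congrArg₂ (· * ·) (congrArg (· ^ q) ?_) ?_
  · rw [eval₂_sum]
    refine Finset.sum_congr rfl fun l _ => ?_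
    rw [eval₂_mul, eval₂_C, eval₂_X, eval_X, mul_comm]
  · have h1 := map_aeval (fun i : Fin n => ∑ l, C (erasedCoeff (n - (i + 1)) l) * X l)
      (eval₂Hom (eval c) (dw c b)) ψ
    have h2 := map_aeval (fun i : Fin n => esymm (Fin n) ℝ (i + 1)) (eval b) ψ
    rw [h2]
    refine h1.trans ?_
    congr 1
    refine congrArg₂ eval₂Hom ?_ ?_
    · ext r
      simp
    · funext i
      rw [eval_esymm_eq_sum_dw hc.injective, map_sum]
      refine Finset.sum_congr rfl fun l _ => ?_
      rw [map_mul, coe_eval₂Hom, eval₂_C, eval₂_X, mul_comm]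

theorem rename_map_momentPoly (σ : Equiv.Perm (Fin (n + 1))) (q : ℕ)
    (ψ : MvPolynomial (Fin n) ℝ) :
    rename σ (map (rename σ : _ →ₐ[ℝ] MvPolynomial (Fin (n + 1)) ℝ).toRingHom (momentPoly q ψ)) =
      momentPoly q ψ := by
  have hgen : ∀ g : Fin (n + 1) → MvPolynomial (Fin (n + 1)) ℝ,
      (∀ l, rename σ (g l) = g (σ l)) →
      rename σ (map (rename σ : _ →ₐ[ℝ] MvPolynomial (Fin (n + 1)) ℝ).toRingHom
        (∑ l, C (g l) * X l)) = ∑ l, C (g l) * X l := by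
    intro g hg
    rw [map_sum, map_sum, ← Equiv.sum_comp σ (fun l => C (g l) * X l)]
    refine Finset.sum_congr rfl fun l _ => ?_
    rw [map_mul, map_mul, map_C, map_X, rename_C, rename_X, ← hg]
    rfl
  rw [momentPoly, map_mul, map_mul, map_pow, map_pow, hgen X fun l => rename_X _ _]
  congr 1
  have h1 := map_aeval (fun i : Fin n => ∑ l, C (erasedCoeff (n - (i + 1)) l) * X l)
    ((rename σ : _ →ₐ[MvPolynomial (Fin (n + 1)) ℝ] MvPolynomial (Fin (n + 1)) _).toRingHom.comp
      (map (rename σ : _ →ₐ[ℝ] MvPolynomial (Fin (n + 1)) ℝ).toRingHom)) ψ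
  refine h1.trans ?_
  rw [aeval_def, ← coe_eval₂Hom]
  congr 1
  refine congrArg₂ eval₂Hom ?_ ?_
  · refine RingHom.ext fun r => ?_
    have hr : algebraMap ℝ (MvPolynomial (Fin (n + 1)) (MvPolynomial (Fin (n + 1)) ℝ)) r =
        C (C r) := rfl
    rw [RingHom.comp_apply, hr, RingHom.comp_apply, map_C]
    refine (rename_C _ _).trans (congrArg C (rename_C _ _))
  · funext i
    exact hgen _ fun l => rename_erasedCoeff σ _ l

theorem rename_coeff_momentPoly (σ : Equiv.Perm (Fin (n + 1))) (q : ℕ)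
    (ψ : MvPolynomial (Fin n) ℝ) (α : Fin (n + 1) →₀ ℕ) :
    rename σ (coeff α (momentPoly q ψ)) = coeff (α.mapDomain σ) (momentPoly q ψ) := by
  conv_rhs => rw [← rename_map_momentPoly σ, coeff_rename_mapDomain _ σ.injective, coeff_map]
  rfl

/-- The average of a polynomial over all permutations of its variables. -/
def symmAverage (p : MvPolynomial (Fin n) ℝ) : MvPolynomial (Fin n) ℝ :=
  C ((Fintype.card (Equiv.Perm (Fin n)) : ℝ)⁻¹) * ∑ σ : Equiv.Perm (Fin n), rename σ p

theorem symmAverage_isSymmetric (p : MvPolynomial (Fin n) ℝ) : (symmAverage p).IsSymmetric := by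
  intro τ
  rw [symmAverage, map_mul, rename_C, map_sum,
    ← Equiv.sum_comp (Equiv.mulLeft τ) fun σ : Equiv.Perm (Fin n) => rename σ p]
  congr 1
  refine Finset.sum_congr rfl fun σ _ => ?_
  rw [rename_rename]
  rfl

theorem dirMoment_mapDomain (θ : ℝ) (σ : Equiv.Perm (Fin (n + 1))) (α : Fin (n + 1) →₀ ℕ) :
    dirMoment θ (α.mapDomain σ) = dirMoment θ α := by
  have h : ∀ i, α.mapDomain σ i = α (σ.symm i) := fun i => by
    rw [Finsupp.mapDomain_equiv_apply]
  simp only [dirMoment, h]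
  rw [Equiv.prod_comp σ.symm fun i => (ascPochhammer ℝ (α i)).eval θ,
    Equiv.sum_comp σ.symm fun i => α i]

theorem sum_dirMoment_symmAverage (θ : ℝ) (q : ℕ) (ψ : MvPolynomial (Fin n) ℝ)
    (c : Fin (n + 1) → ℝ) :
    ∑ α ∈ (momentPoly q ψ).support, dirMoment θ α *
        eval c (symmAverage (coeff α (momentPoly q ψ))) =
      ∑ α ∈ (momentPoly q ψ).support, dirMoment θ α * eval c (coeff α (momentPoly q ψ)) := by
  have hσ : ∀ σ : Equiv.Perm (Fin (n + 1)),
      ∑ α ∈ (momentPoly q ψ).support, dirMoment θ α * eval c (rename σ (coeff α (momentPoly q ψ))) =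
      ∑ α ∈ (momentPoly q ψ).support, dirMoment θ α * eval c (coeff α (momentPoly q ψ)) := by
    intro σ
    refine Finset.sum_bij (fun α _ => α.mapDomain σ) ?_ ?_ ?_ ?_
    · intro α hα
      rw [mem_support_iff, ← rename_coeff_momentPoly]
      rw [mem_support_iff] at hα
      exact fun h => hα (rename_injective σ σ.injective (by rw [h, map_zero]))
    · intro α _ β _ h
      exact Finsupp.mapDomain_injective σ.injective h
    · intro β hβ
      have hinv : (β.mapDomain σ.symm).mapDomain σ = β := by
        rw [← Finsupp.mapDomain_comp]
        simp
      refine ⟨β.mapDomain σ.symm, ?_, hinv⟩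
      rw [mem_support_iff, ← rename_coeff_momentPoly]
      rw [mem_support_iff] at hβ
      exact fun h => hβ (rename_injective _ σ.symm.injective (by rw [h, map_zero]))
    · intro α _
      rw [dirMoment_mapDomain, rename_coeff_momentPoly]
  have hcard : (Fintype.card (Equiv.Perm (Fin (n + 1))) : ℝ) ≠ 0 :=
    Nat.cast_ne_zero.2 Fintype.card_ne_zero
  have : ∀ α : Fin (n + 1) →₀ ℕ, dirMoment θ α * eval c (symmAverage (coeff α (momentPoly q ψ))) =
      (Fintype.card (Equiv.Perm (Fin (n + 1))) : ℝ)⁻¹ * ∑ σ : Equiv.Perm (Fin (n + 1)),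
        dirMoment θ α * eval c (rename σ (coeff α (momentPoly q ψ))) := by
    intro α
    rw [symmAverage, map_mul, eval_C, map_sum, ← Finset.mul_sum]
    ring
  rw [Finset.sum_congr rfl fun α _ => this α, ← Finset.mul_sum, Finset.sum_comm,
    Finset.sum_congr rfl fun σ _ => hσ σ, Finset.sum_const, Finset.card_univ, nsmul_eq_mul,
    inv_mul_cancel_left₀ hcard]

theorem exists_dixon_moment_expansion {φ : MvPolynomial (Fin n) ℝ} (hφ : φ.IsSymmetric) (q : ℕ) :
    ∃ (s : Finset (Fin (n + 1) →₀ ℕ)) (S : (Fin (n + 1) →₀ ℕ) → MvPolynomial (Fin (n + 1)) ℝ),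
      (∀ α, (S α).IsSymmetric) ∧ ∀ θ : ℝ, 0 < θ → ∀ c : Fin (n + 1) → ℝ, StrictAnti c →
        Integrable (fun b => (∑ i, c i - ∑ i, b i) ^ q * eval b φ) (dixon θ c) ∧
        ∫ b, (∑ i, c i - ∑ i, b i) ^ q * eval b φ ∂dixon θ c =
          ∑ α ∈ s, dirMoment θ α * eval c (S α) := by
  obtain ⟨ψ, hψ⟩ := esymmAlgHom_fin_surjective ℝ le_rfl ⟨φ, hφ⟩
  have hψ' : aeval (fun i : Fin n => esymm (Fin n) ℝ (i + 1)) ψ = φ := by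
    rw [← esymmAlgHom_apply, hψ]
  refine ⟨(momentPoly q ψ).support, fun α => symmAverage (coeff α (momentPoly q ψ)),
    fun α => symmAverage_isSymmetric _, fun θ hθ c hc => ?_⟩
  have hfun : (fun b : Fin n → ℝ => (∑ i, c i - ∑ i, b i) ^ q * eval b φ) = fun b =>
      ∑ α ∈ (momentPoly q ψ).support, eval c (coeff α (momentPoly q ψ)) * ∏ i, dw c b i ^ α i := by
    funext b
    rw [← hψ', ← eval₂_momentPoly hc, eval₂_eq']
  have hInt : ∀ α ∈ (momentPoly q ψ).support, Integrable
      (fun b => eval c (coeff α (momentPoly q ψ)) * ∏ i, dw c b i ^ α i) (dixon θ c) :=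
    fun α _ => (integrable_dixon_dw hθ hc α).const_mul _
  rw [hfun]
  refine ⟨integrable_finsetSum _ hInt, ?_⟩
  rw [integral_finsetSum _ hInt, sum_dirMoment_symmAverage]
  refine Finset.sum_congr rfl fun α _ => ?_
  rw [integral_const_mul, integral_dixon_dw hθ hc, mul_comm]

end SymmetricMoments

/-- Functions that agree on the positive half-line with a rational function without positive
poles. -/
def IsRationalOnPos (r : ℝ → ℝ) : Prop :=
  ∃ P Q : Polynomial ℝ, ∀ θ : ℝ, 0 < θ → Q.eval θ ≠ 0 ∧ r θ * Q.eval θ = P.eval θ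

namespace IsRationalOnPos

theorem const (x : ℝ) : IsRationalOnPos fun _ => x :=
  ⟨Polynomial.C x, 1, fun θ _ => by simp⟩

theorem mul {r s : ℝ → ℝ} (hr : IsRationalOnPos r) (hs : IsRationalOnPos s) :
    IsRationalOnPos fun θ => r θ * s θ := by
  obtain ⟨P, Q, h⟩ := hr
  obtain ⟨P', Q', h'⟩ := hs
  refine ⟨P * P', Q * Q', fun θ hθ => ?_⟩
  rw [Polynomial.eval_mul, Polynomial.eval_mul, ← (h θ hθ).2, ← (h' θ hθ).2]
  exact ⟨mul_ne_zero (h θ hθ).1 (h' θ hθ).1, by ring⟩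

theorem add {r s : ℝ → ℝ} (hr : IsRationalOnPos r) (hs : IsRationalOnPos s) :
    IsRationalOnPos fun θ => r θ + s θ := by
  obtain ⟨P, Q, h⟩ := hr
  obtain ⟨P', Q', h'⟩ := hs
  refine ⟨P * Q' + P' * Q, Q * Q', fun θ hθ => ?_⟩
  rw [Polynomial.eval_add, Polynomial.eval_mul, Polynomial.eval_mul, Polynomial.eval_mul,
    ← (h θ hθ).2, ← (h' θ hθ).2]
  exact ⟨mul_ne_zero (h θ hθ).1 (h' θ hθ).1, by ring⟩

theorem sub {r s : ℝ → ℝ} (hr : IsRationalOnPos r) (hs : IsRationalOnPos s) :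
    IsRationalOnPos fun θ => r θ - s θ := by
  simpa [sub_eq_add_neg] using hr.add ((const (-1)).mul hs)

theorem sum {ι : Type*} (s : Finset ι) {r : ι → ℝ → ℝ} (h : ∀ i ∈ s, IsRationalOnPos (r i)) :
    IsRationalOnPos fun θ => ∑ i ∈ s, r i θ := by
  classical
  induction s using Finset.induction_on with
  | empty => simpa using const 0
  | insert i s hi ih =>
    simp only [Finset.sum_insert hi]
    exact (h i (Finset.mem_insert_self i s)).add
      (ih fun j hj => h j (Finset.mem_insert_of_mem hj))

theorem eq_zero {r : ℝ → ℝ} (hr : IsRationalOnPos r)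
    (h0 : ∀ D : ℕ, 0 < D → r ((D : ℝ) / 2) = 0) {θ : ℝ} (hθ : 0 < θ) : r θ = 0 := by
  obtain ⟨P, Q, h⟩ := hr
  have hP : P = 0 := by
    refine Polynomial.eq_zero_of_infinite_isRoot P
      (Set.Infinite.mono (s := Set.range fun D : ℕ => ((D + 1 : ℕ) : ℝ) / 2) ?_ ?_)
    · rintro _ ⟨D, rfl⟩
      have := (h (((D + 1 : ℕ) : ℝ) / 2) (by positivity)).2
      rw [h0 _ D.succ_pos, zero_mul] at this
      exact this.symm
    · refine Set.infinite_range_of_injective fun D E h => ?_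
      simpa using h
  have := (h θ hθ).2
  rw [hP, Polynomial.eval_zero] at this
  exact (mul_eq_zero.1 this).resolve_right (h θ hθ).1

end IsRationalOnPos

theorem isRationalOnPos_dirMoment (α : Fin (n + 1) → ℕ) :
    IsRationalOnPos fun θ => dirMoment θ α := by
  refine ⟨∏ i, ascPochhammer ℝ (α i),
    (ascPochhammer ℝ (∑ i, α i)).comp (Polynomial.C ((n : ℝ) + 1) * Polynomial.X), fun θ hθ => ?_⟩
  have hpos : 0 < (ascPochhammer ℝ (∑ i, α i)).eval (((n : ℝ) + 1) * θ) :=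
    ascPochhammer_pos _ _ (by positivity)
  simp only [Polynomial.eval_comp, Polynomial.eval_mul, Polynomial.eval_C, Polynomial.eval_X,
    Polynomial.eval_prod, dirMoment]
  exact ⟨hpos.ne', div_mul_cancel₀ _ hpos.ne'⟩

theorem Interlaces.strictAnti_right {b : Fin (n + 1) → ℝ} {c : Fin (n + 2) → ℝ}
    (h : Interlaces b c) : StrictAnti b :=
  Fin.strictAnti_iff_succ_lt.2 fun i => by
    have h1 := (h i.castSucc).2
    have h2 := (h i.succ).1
    rw [← Fin.succ_castSucc] at h2
    exact h2.trans h1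

theorem Interlaces.mem_Icc {b : Fin n → ℝ} {c : Fin (n + 1) → ℝ} (h : Interlaces b c) {l u : ℝ}
    (hc : ∀ i, c i ∈ Set.Icc l u) (i : Fin n) : b i ∈ Set.Icc l u :=
  ⟨(hc i.succ).1.trans (h i).2.le, (h i).1.le.trans (hc i.castSucc).2⟩

section SymmetricExchange
open MvPolynomial

/-- A mixed moment of the increments of two consecutive Dixon–Anderson steps. -/
def pairMoment (θ : ℝ) (φ : MvPolynomial (Fin n) ℝ) (p q : ℕ) (c : Fin (n + 2) → ℝ) : ℝ :=
  ∫ b, (∑ i, c i - ∑ i, b i) ^ p *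
    ∫ a, (∑ i, b i - ∑ i, a i) ^ q * eval a φ ∂dixon θ b ∂dixon θ c

theorem exists_pairMoment_expansion {φ : MvPolynomial (Fin n) ℝ} (hφ : φ.IsSymmetric) (p q : ℕ) :
    ∃ (s : Finset (Fin (n + 1) →₀ ℕ)) (t : (Fin (n + 1) →₀ ℕ) → Finset (Fin (n + 2) →₀ ℕ))
      (S : (Fin (n + 1) →₀ ℕ) → (Fin (n + 2) →₀ ℕ) → MvPolynomial (Fin (n + 2)) ℝ),
      ∀ θ : ℝ, 0 < θ → ∀ c : Fin (n + 2) → ℝ, StrictAnti c →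
        Integrable (fun b => (∑ i, c i - ∑ i, b i) ^ p *
          ∫ a, (∑ i, b i - ∑ i, a i) ^ q * eval a φ ∂dixon θ b) (dixon θ c) ∧
        pairMoment θ φ p q c =
          ∑ α ∈ s, dirMoment θ α * ∑ β ∈ t α, dirMoment θ β * eval c (S α β) := by
  obtain ⟨s, R, hR, h⟩ := exists_dixon_moment_expansion hφ q
  choose t S _ hS' using fun α => exists_dixon_moment_expansion (hR α) p
  refine ⟨s, t, S, fun θ hθ c hc => ?_⟩
  have hae : (fun b => (∑ i, c i - ∑ i, b i) ^ p *
      ∫ a, (∑ i, b i - ∑ i, a i) ^ q * eval a φ ∂dixon θ b) =ᵐ[dixon θ c]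
      fun b => ∑ α ∈ s, dirMoment θ α * ((∑ i, c i - ∑ i, b i) ^ p * eval b (R α)) := by
    filter_upwards [ae_dixon_interlaces θ c] with b hb
    rw [(h θ hθ b hb.strictAnti_right).2, Finset.mul_sum]
    exact Finset.sum_congr rfl fun α _ => by ring
  have hInt : ∀ α ∈ s, Integrable
      (fun b => dirMoment θ α * ((∑ i, c i - ∑ i, b i) ^ p * eval b (R α))) (dixon θ c) :=
    fun α _ => (hS' α θ hθ c hc).1.const_mul _
  refine ⟨(integrable_finsetSum _ hInt).congr hae.symm, ?_⟩
  rw [pairMoment, integral_congr_ae hae, integral_finsetSum _ hInt]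
  refine Finset.sum_congr rfl fun α _ => ?_
  rw [integral_const_mul, (hS' α θ hθ c hc).2]

theorem isRationalOnPos_pairMoment {φ : MvPolynomial (Fin n) ℝ} (hφ : φ.IsSymmetric) (p q : ℕ)
    {c : Fin (n + 2) → ℝ} (hc : StrictAnti c) :
    IsRationalOnPos fun θ => pairMoment θ φ p q c := by
  obtain ⟨s, t, S, h⟩ := exists_pairMoment_expansion hφ p q
  have hr : IsRationalOnPos fun θ =>
      ∑ α ∈ s, dirMoment θ α * ∑ β ∈ t α, dirMoment θ β * eval c (S α β) :=
    .sum s fun α _ => (isRationalOnPos_dirMoment α).mul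
      (.sum (t α) fun β _ => (isRationalOnPos_dirMoment β).mul (.const _))
  obtain ⟨P, Q, hPQ⟩ := hr
  refine ⟨P, Q, fun θ hθ => ?_⟩
  have := hPQ θ hθ
  beta_reduce at this ⊢
  rwa [(h θ hθ c hc).2]

theorem continuousOn_pairMoment {φ : MvPolynomial (Fin n) ℝ} (hφ : φ.IsSymmetric) (p q : ℕ)
    {θ : ℝ} (hθ : 0 < θ) : ContinuousOn (pairMoment θ φ p q) {c | StrictAnti c} := by
  obtain ⟨s, t, S, h⟩ := exists_pairMoment_expansion hφ p q
  refine ContinuousOn.congr (f := fun c =>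
    ∑ α ∈ s, dirMoment θ α * ∑ β ∈ t α, dirMoment θ β * eval c (S α β)) ?_
    fun c hc => (h θ hθ c hc).2
  refine Continuous.continuousOn ?_
  refine continuous_finsetSum _ fun α _ => continuous_const.mul
    (continuous_finsetSum _ fun β _ => continuous_const.mul (MvPolynomial.continuous_eval _))

theorem lintegral_pairMoment {φ : MvPolynomial (Fin n) ℝ} (hφ : φ.IsSymmetric) (p q : ℕ)
    {θ : ℝ} (hθ : 0 < θ) {c : Fin (n + 2) → ℝ} (hc : StrictAnti c) {M : ℝ}
    (hM : ∀ b a, Interlaces b c → Interlaces a b →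
      |(∑ i, c i - ∑ i, b i) ^ p * ((∑ i, b i - ∑ i, a i) ^ q * eval a φ)| ≤ M) :
    ∫⁻ b, ∫⁻ a, ENNReal.ofReal ((∑ i, c i - ∑ i, b i) ^ p *
        ((∑ i, b i - ∑ i, a i) ^ q * eval a φ) + M) ∂dixon θ b ∂dixon θ c =
      ENNReal.ofReal (pairMoment θ φ p q c + M) ∧ 0 ≤ pairMoment θ φ p q c + M := by
  obtain ⟨_, _, _, h⟩ := exists_dixon_moment_expansion hφ q
  obtain ⟨_, _, _, h'⟩ := exists_pairMoment_expansion hφ p q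
  have := isProbabilityMeasure_dixon hθ hc
  have inner : ∀ b, Interlaces b c →
      ∫⁻ a, ENNReal.ofReal ((∑ i, c i - ∑ i, b i) ^ p *
        ((∑ i, b i - ∑ i, a i) ^ q * eval a φ) + M) ∂dixon θ b =
      ENNReal.ofReal ((∑ i, c i - ∑ i, b i) ^ p *
        ∫ a, (∑ i, b i - ∑ i, a i) ^ q * eval a φ ∂dixon θ b + M) ∧
      0 ≤ (∑ i, c i - ∑ i, b i) ^ p *
        ∫ a, (∑ i, b i - ∑ i, a i) ^ q * eval a φ ∂dixon θ b + M := by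
    intro b hb
    have := isProbabilityMeasure_dixon hθ hb.strictAnti_right
    have hi := ((h θ hθ b hb.strictAnti_right).1.const_mul ((∑ i, c i - ∑ i, b i) ^ p))
    have hnn : 0 ≤ᵐ[dixon θ b] fun a => (∑ i, c i - ∑ i, b i) ^ p *
        ((∑ i, b i - ∑ i, a i) ^ q * eval a φ) + M := by
      filter_upwards [ae_dixon_interlaces θ b] with a ha
      have := (abs_le.1 (hM b a hb ha)).1
      simp only [Pi.zero_apply]
      linarith
    have he : ∫ a, ((∑ i, c i - ∑ i, b i) ^ p *
        ((∑ i, b i - ∑ i, a i) ^ q * eval a φ) + M) ∂dixon θ b = (∑ i, c i - ∑ i, b i) ^ p *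
        ∫ a, (∑ i, b i - ∑ i, a i) ^ q * eval a φ ∂dixon θ b + M := by
      rw [integral_add hi (integrable_const M), integral_const_mul]
      simp
    rw [← he]
    exact ⟨(ofReal_integral_eq_lintegral_ofReal (hi.add (integrable_const M)) hnn).symm,
      integral_nonneg_of_ae hnn⟩
  have hnn : 0 ≤ᵐ[dixon θ c] fun b => (∑ i, c i - ∑ i, b i) ^ p *
        ∫ a, (∑ i, b i - ∑ i, a i) ^ q * eval a φ ∂dixon θ b + M := by
    filter_upwards [ae_dixon_interlaces θ c] with b hb
    exact (inner b hb).2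
  have he : ∫ b, ((∑ i, c i - ∑ i, b i) ^ p *
        ∫ a, (∑ i, b i - ∑ i, a i) ^ q * eval a φ ∂dixon θ b + M) ∂dixon θ c =
      pairMoment θ φ p q c + M := by
    rw [integral_add (h' θ hθ c hc).1 (integrable_const M), pairMoment]
    simp
  rw [← he]
  refine ⟨?_, integral_nonneg_of_ae hnn⟩
  refine Eq.trans (lintegral_congr_ae ?_)
    (ofReal_integral_eq_lintegral_ofReal ((h' θ hθ c hc).1.add (integrable_const M)) hnn).symm
  filter_upwards [ae_dixon_interlaces θ c] with b hb
  exact (inner b hb).1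

theorem exists_bound_pairMoment (φ : MvPolynomial (Fin n) ℝ) (p q : ℕ)
    {c : Fin (n + 2) → ℝ} (hc : StrictAnti c) : ∃ M : ℝ, ∀ b a, Interlaces b c → Interlaces a b →
      |(∑ i, c i - ∑ i, b i) ^ p * ((∑ i, b i - ∑ i, a i) ^ q * eval a φ)| ≤ M := by
  have hcI : ∀ i, c i ∈ Set.Icc (c (Fin.last _)) (c 0) := fun i =>
    ⟨hc.antitone (Fin.le_last i), hc.antitone (Fin.zero_le i)⟩
  have hcont : Continuous fun x : (Fin (n + 1) → ℝ) × (Fin n → ℝ) =>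
      (∑ i, c i - ∑ i, x.1 i) ^ p * ((∑ i, x.1 i - ∑ i, x.2 i) ^ q * eval x.2 φ) := by
    have : Continuous fun x : (Fin (n + 1) → ℝ) × (Fin n → ℝ) => eval x.2 φ :=
      (MvPolynomial.continuous_eval φ).comp continuous_snd
    fun_prop
  obtain ⟨M, hM⟩ := ((isCompact_univ_pi fun _ => isCompact_Icc).prod
    (isCompact_univ_pi fun _ => isCompact_Icc)).exists_bound_of_continuousOn
      (s := (Set.univ.pi fun _ : Fin (n + 1) => Set.Icc (c (Fin.last _)) (c 0)) ×ˢ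
        (Set.univ.pi fun _ : Fin n => Set.Icc (c (Fin.last _)) (c 0))) hcont.continuousOn
  refine ⟨M, fun b a hb ha => hM (b, a) ⟨fun i _ => hb.mem_Icc hcI i, fun i _ => ?_⟩⟩
  exact ha.mem_Icc (hb.mem_Icc hcI) i

theorem pairMoment_swap_of_nat {D : ℕ} (hD : 0 < D) {φ : MvPolynomial (Fin n) ℝ}
    (hφ : φ.IsSymmetric) (p q : ℕ) {c : Fin (n + 2) → ℝ} (hc : StrictAnti c) :
    pairMoment ((D : ℝ) / 2) φ p q c = pairMoment ((D : ℝ) / 2) φ q p c := by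
  have hθ : (0 : ℝ) < (D : ℝ) / 2 := by positivity
  have hev : Measurable fun a : Fin n → ℝ => eval a φ := (MvPolynomial.continuous_eval φ).measurable
  refine Measure.eqOn_open_of_ae_eq (μ := volume) ?_ isOpen_strictAnti
    (continuousOn_pairMoment hφ p q hθ) (continuousOn_pairMoment hφ q p hθ) hc
  have hae := ae_all_iff.2 fun M : ℕ => ae_lintegral_dixon_swap hD
    (F := fun x : (Fin n → ℝ) × ℝ × ℝ => ENNReal.ofReal (x.2.1 ^ p * (x.2.2 ^ q * eval x.1 φ) + M))
    (by fun_prop)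
  filter_upwards [ae_restrict_of_ae hae, ae_restrict_mem isOpen_strictAnti.measurableSet] with c h hc
  obtain ⟨M₁, h₁⟩ := exists_bound_pairMoment φ p q hc
  obtain ⟨M₂, h₂⟩ := exists_bound_pairMoment φ q p hc
  obtain ⟨M, hM⟩ := exists_nat_ge (max M₁ M₂)
  have e₁ := lintegral_pairMoment hφ p q hθ hc
    fun b a hb ha => (h₁ b a hb ha).trans ((le_max_left _ _).trans hM)
  have e₂ := lintegral_pairMoment hφ q p hθ hc
    fun b a hb ha => (h₂ b a hb ha).trans ((le_max_right _ _).trans hM)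
  have hM' := h M
  simp only [mul_left_comm (_ ^ p) (_ ^ q)] at hM' e₁ e₂
  rw [e₁.1] at hM'
  simp only [mul_left_comm (_ ^ q) (_ ^ p)] at hM' e₂
  rw [e₂.1, ENNReal.ofReal_eq_ofReal_iff e₁.2 e₂.2] at hM'
  linarith

theorem pairMoment_swap {θ : ℝ} (hθ : 0 < θ) {φ : MvPolynomial (Fin n) ℝ}
    (hφ : φ.IsSymmetric) (p q : ℕ) {c : Fin (n + 2) → ℝ} (hc : StrictAnti c) :
    pairMoment θ φ p q c = pairMoment θ φ q p c :=
  sub_eq_zero.1 (((isRationalOnPos_pairMoment hφ p q hc).sub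
    (isRationalOnPos_pairMoment hφ q p hc)).eq_zero
      (fun _ hD => sub_eq_zero.2 (pairMoment_swap_of_nat hD hφ p q hc)) hθ)

end SymmetricExchange

/-- One Dixon–Anderson step with an exponential weight. -/
def besStep (θ y : ℝ) (f : (Fin n → ℝ) → ℝ) (c : Fin (n + 1) → ℝ) : ℝ :=
  ∫ b, Real.exp (y * (∑ i, c i - ∑ i, b i)) * f b ∂dixon θ c

/-- The multivariate Bessel function with arguments `y 0, …, y (n - 1)`, computed recursively from
the bottom level to the top level. -/
def bes (θ : ℝ) (y : ℕ → ℝ) : (n : ℕ) → (Fin n → ℝ) → ℝ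
  | 0 => fun _ => 1
  | n + 1 => besStep θ (y n) (bes θ y n)

/-- Truncated exponential series. -/
def expTrunc (k : ℕ) (x : ℝ) : ℝ := ∑ q ∈ Finset.range k, x ^ q / q.factorial

theorem tendsto_expTrunc (x : ℝ) : Tendsto (fun k => expTrunc k x) atTop (𝓝 (Real.exp x)) := by
  have h := NormedSpace.expSeries_div_hasSum_exp x
  rw [← Real.exp_eq_exp_ℝ] at h
  exact h.tendsto_sum_nat

theorem abs_expTrunc_le (k : ℕ) (x : ℝ) : |expTrunc k x| ≤ Real.exp |x| := by
  refine (Finset.abs_sum_le_sum_abs _ _).trans ?_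
  have : ∀ q ∈ Finset.range k, |x ^ q / (q.factorial : ℝ)| = |x| ^ q / q.factorial := fun q _ => by
    rw [abs_div, abs_pow, Nat.abs_cast]
  rw [Finset.sum_congr rfl this]
  exact Real.sum_le_exp_of_nonneg (abs_nonneg x) k

theorem continuous_expTrunc (k : ℕ) : Continuous (expTrunc k) := by
  unfold expTrunc
  fun_prop

theorem abs_le_of_interlaces {b : Fin n → ℝ} {c : Fin (n + 1) → ℝ} (h : Interlaces b c) {R : ℝ}
    (hc : ∀ i, |c i| ≤ R) (i : Fin n) : |b i| ≤ R :=
  abs_le.2 (h.mem_Icc (fun i => abs_le.1 (hc i)) i)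

theorem abs_sum_sub_sum_le {b : Fin n → ℝ} {c : Fin (n + 1) → ℝ} (h : Interlaces b c) {R : ℝ}
    (hc : ∀ i, |c i| ≤ R) : |∑ i, c i - ∑ i, b i| ≤ R := by
  have h1 : ∑ i, c i - ∑ i, b i = c 0 + ∑ i : Fin n, (c i.succ - b i) := by
    rw [Fin.sum_univ_succ, Finset.sum_sub_distrib]; ring
  have h2 : ∑ i, c i - ∑ i, b i = c (Fin.last n) + ∑ i : Fin n, (c i.castSucc - b i) := by
    rw [Fin.sum_univ_castSucc, Finset.sum_sub_distrib]; ring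
  have h3 : ∑ i : Fin n, (c i.succ - b i) ≤ 0 :=
    Finset.sum_nonpos fun i _ => (sub_neg.2 (h i).2).le
  have h4 : 0 ≤ ∑ i : Fin n, (c i.castSucc - b i) :=
    Finset.sum_nonneg fun i _ => (sub_pos.2 (h i).1).le
  have h5 := abs_le.1 (hc 0)
  have h6 := abs_le.1 (hc (Fin.last n))
  exact abs_le.2 ⟨by linarith, by linarith⟩

section SymmetricLimits
open MvPolynomial

/-- On ordered tuples bounded by `R`, the function `f` is a bounded pointwise limit of symmetric
polynomials. -/
def IsSymmLimit (R : ℝ) (f : (Fin n → ℝ) → ℝ) : Prop :=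
  ∃ φ : ℕ → MvPolynomial (Fin n) ℝ, (∀ k, (φ k).IsSymmetric) ∧
    (∃ M, ∀ k c, StrictAnti c → (∀ i, |c i| ≤ R) → |eval c (φ k)| ≤ M) ∧
    ∀ c, StrictAnti c → (∀ i, |c i| ≤ R) → Tendsto (fun k => eval c (φ k)) atTop (𝓝 (f c))

theorem exists_expTrunc_moment {θ : ℝ} (hθ : 0 < θ) {φ : MvPolynomial (Fin n) ℝ}
    (hφ : φ.IsSymmetric) (y : ℝ) (k : ℕ) :
    ∃ ψ : MvPolynomial (Fin (n + 1)) ℝ, ψ.IsSymmetric ∧ ∀ c, StrictAnti c →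
      ∫ b, expTrunc k (y * (∑ i, c i - ∑ i, b i)) * eval b φ ∂dixon θ c = eval c ψ := by
  choose s S hS h using fun q => exists_dixon_moment_expansion hφ q
  refine ⟨∑ q ∈ Finset.range k, C (y ^ q / q.factorial) * ∑ α ∈ s q, C (dirMoment θ α) * S q α,
    ?_, fun c hc => ?_⟩
  · refine Subalgebra.sum_mem (symmetricSubalgebra (Fin (n + 1)) ℝ) fun q _ =>
      IsSymmetric.mul (IsSymmetric.C _) ?_
    exact Subalgebra.sum_mem (symmetricSubalgebra (Fin (n + 1)) ℝ) fun α _ =>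
      IsSymmetric.mul (IsSymmetric.C _) (hS q α)
  · have e : ∀ b : Fin n → ℝ, expTrunc k (y * (∑ i, c i - ∑ i, b i)) * eval b φ =
        ∑ q ∈ Finset.range k, y ^ q / q.factorial *
          ((∑ i, c i - ∑ i, b i) ^ q * eval b φ) := by
      intro b
      rw [expTrunc, Finset.sum_mul]
      exact Finset.sum_congr rfl fun q _ => by rw [mul_pow]; ring
    simp_rw [e]
    rw [integral_finsetSum _ fun q _ => (h q θ hθ c hc).1.const_mul _, map_sum]
    refine Finset.sum_congr rfl fun q _ => ?_
    rw [integral_const_mul, (h q θ hθ c hc).2, map_mul, eval_C, map_sum]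
    simp

theorem tendsto_integral_expTrunc {θ : ℝ} (hθ : 0 < θ) {R : ℝ} {f : (Fin n → ℝ) → ℝ}
    {φ : ℕ → MvPolynomial (Fin n) ℝ} {M : ℝ} (hM : ∀ k c, StrictAnti c → (∀ i, |c i| ≤ R) →
      |eval c (φ k)| ≤ M)
    (hf : ∀ c, StrictAnti c → (∀ i, |c i| ≤ R) → Tendsto (fun k => eval c (φ k)) atTop (𝓝 (f c)))
    (y : ℝ) {c : Fin (n + 1) → ℝ} (hc : StrictAnti c) (hcR : ∀ i, |c i| ≤ R) :
    Tendsto (fun k => ∫ b, expTrunc k (y * (∑ i, c i - ∑ i, b i)) * eval b (φ k) ∂dixon θ c) atTop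
      (𝓝 (besStep θ y f c)) ∧
    ∀ k, |∫ b, expTrunc k (y * (∑ i, c i - ∑ i, b i)) * eval b (φ k) ∂dixon θ c| ≤
      Real.exp (|y| * R) * M := by
  have := isProbabilityMeasure_dixon hθ hc
  have hanti : ∀ b : Fin n → ℝ, Interlaces b c → StrictAnti b := by
    cases n with
    | zero => exact fun b _ i => i.elim0
    | succ n => exact fun b hb => hb.strictAnti_right
  have hbound : ∀ k, ∀ᵐ b ∂dixon θ c,
      ‖expTrunc k (y * (∑ i, c i - ∑ i, b i)) * eval b (φ k)‖ ≤ Real.exp (|y| * R) * M := by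
    intro k
    filter_upwards [ae_dixon_interlaces θ c] with b hb
    rw [norm_mul]
    refine mul_le_mul ((abs_expTrunc_le k _).trans (Real.exp_le_exp.2 ?_))
      (hM k b (hanti b hb) (abs_le_of_interlaces hb hcR)) (norm_nonneg _) (Real.exp_nonneg _)
    rw [abs_mul]
    exact mul_le_mul_of_nonneg_left (abs_sum_sub_sum_le hb hcR) (abs_nonneg y)
  constructor
  · refine tendsto_integral_of_dominated_convergence (fun _ => Real.exp (|y| * R) * M) (fun k => ?_)
      (integrable_const _) hbound ?_
    · have h1 := continuous_expTrunc k
      have h2 := MvPolynomial.continuous_eval (φ k)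
      exact Continuous.aestronglyMeasurable (by fun_prop)
    · filter_upwards [ae_dixon_interlaces θ c] with b hb
      exact (tendsto_expTrunc _).mul (hf b (hanti b hb) (abs_le_of_interlaces hb hcR))
  · intro k
    have := norm_integral_le_of_norm_le_const (hbound k)
    simpa using this

theorem IsSymmLimit.besStep {θ : ℝ} (hθ : 0 < θ) {R : ℝ} {f : (Fin n → ℝ) → ℝ}
    (h : IsSymmLimit R f) (y : ℝ) : IsSymmLimit R (besStep θ y f) := by
  obtain ⟨φ, hφ, ⟨M, hM⟩, hf⟩ := h
  choose ψ hψ hψ' using fun k => exists_expTrunc_moment hθ (hφ k) y k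
  refine ⟨ψ, hψ, ⟨Real.exp (|y| * R) * M, fun k c hc hcR => ?_⟩, fun c hc hcR => ?_⟩
  · rw [← hψ' k c hc]
    exact (tendsto_integral_expTrunc hθ hM hf y hc hcR).2 k
  · simp_rw [← fun k => hψ' k c hc]
    exact (tendsto_integral_expTrunc hθ hM hf y hc hcR).1

theorem isSymmLimit_bes {θ : ℝ} (hθ : 0 < θ) (y : ℕ → ℝ) (R : ℝ) :
    ∀ n, IsSymmLimit R (bes θ y n)
  | 0 => ⟨fun _ => 1, fun _ => IsSymmetric.one, ⟨1, fun k c _ _ => by simp⟩,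
      fun c _ _ => by simp [bes]⟩
  | n + 1 => (isSymmLimit_bes hθ y R n).besStep hθ (y n)

theorem integral_expTrunc_swap {θ : ℝ} (hθ : 0 < θ) {φ : MvPolynomial (Fin n) ℝ}
    (hφ : φ.IsSymmetric) (u v : ℝ) (k : ℕ) {c : Fin (n + 2) → ℝ} (hc : StrictAnti c) :
    ∫ b, expTrunc k (u * (∑ i, c i - ∑ i, b i)) *
      ∫ a, expTrunc k (v * (∑ i, b i - ∑ i, a i)) * eval a φ ∂dixon θ b ∂dixon θ c =
    ∫ b, expTrunc k (v * (∑ i, c i - ∑ i, b i)) *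
      ∫ a, expTrunc k (u * (∑ i, b i - ∑ i, a i)) * eval a φ ∂dixon θ b ∂dixon θ c := by
  have key : ∀ u v : ℝ, ∫ b, expTrunc k (u * (∑ i, c i - ∑ i, b i)) *
      ∫ a, expTrunc k (v * (∑ i, b i - ∑ i, a i)) * eval a φ ∂dixon θ b ∂dixon θ c =
      ∑ p ∈ Finset.range k, ∑ q ∈ Finset.range k,
        u ^ p / p.factorial * (v ^ q / q.factorial) * pairMoment θ φ p q c := by
    intro u v
    choose s S hS h using fun q => exists_dixon_moment_expansion hφ q
    choose s' t' S' h' using fun p q => exists_pairMoment_expansion hφ p q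
    have hae : (fun b => expTrunc k (u * (∑ i, c i - ∑ i, b i)) *
        ∫ a, expTrunc k (v * (∑ i, b i - ∑ i, a i)) * eval a φ ∂dixon θ b) =ᵐ[dixon θ c]
        fun b => ∑ p ∈ Finset.range k, ∑ q ∈ Finset.range k,
        u ^ p / p.factorial * (v ^ q / q.factorial) * ((∑ i, c i - ∑ i, b i) ^ p *
          ∫ a, (∑ i, b i - ∑ i, a i) ^ q * eval a φ ∂dixon θ b) := by
      filter_upwards [ae_dixon_interlaces θ c] with b hb
      have e : ∀ a : Fin n → ℝ, expTrunc k (v * (∑ i, b i - ∑ i, a i)) * eval a φ =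
          ∑ q ∈ Finset.range k, v ^ q / q.factorial *
            ((∑ i, b i - ∑ i, a i) ^ q * eval a φ) := by
        intro a
        rw [expTrunc, Finset.sum_mul]
        exact Finset.sum_congr rfl fun q _ => by rw [mul_pow]; ring
      simp_rw [e]
      rw [integral_finsetSum _ fun q _ => (h q θ hθ b hb.strictAnti_right).1.const_mul _,
        expTrunc, Finset.sum_mul_sum]
      refine Finset.sum_congr rfl fun p _ => Finset.sum_congr rfl fun q _ => ?_
      rw [integral_const_mul, mul_pow]
      ring
    rw [integral_congr_ae hae, integral_finsetSum _ fun p _ => integrable_finsetSum _ fun q _ =>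
      (h' p q θ hθ c hc).1.const_mul _]
    refine Finset.sum_congr rfl fun p _ => ?_
    rw [integral_finsetSum _ fun q _ => (h' p q θ hθ c hc).1.const_mul _]
    refine Finset.sum_congr rfl fun q _ => ?_
    rw [integral_const_mul, pairMoment]
  rw [key, key, Finset.sum_comm]
  refine Finset.sum_congr rfl fun p _ => Finset.sum_congr rfl fun q _ => ?_
  rw [pairMoment_swap hθ hφ q p hc]
  ring

theorem besStep_comm {θ : ℝ} (hθ : 0 < θ) {R : ℝ} {f : (Fin n → ℝ) → ℝ} (h : IsSymmLimit R f)
    (u v : ℝ) {c : Fin (n + 2) → ℝ} (hc : StrictAnti c) (hcR : ∀ i, |c i| ≤ R) :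
    besStep θ u (besStep θ v f) c = besStep θ v (besStep θ u f) c := by
  obtain ⟨φ, hφ, ⟨M, hM⟩, hf⟩ := h
  have key : ∀ u v : ℝ, Tendsto (fun k => ∫ b, expTrunc k (u * (∑ i, c i - ∑ i, b i)) *
      ∫ a, expTrunc k (v * (∑ i, b i - ∑ i, a i)) * eval a (φ k) ∂dixon θ b ∂dixon θ c) atTop
      (𝓝 (besStep θ u (besStep θ v f) c)) := by
    intro u v
    choose ψ hψ hψ' using fun k => exists_expTrunc_moment hθ (hφ k) v k
    have := (tendsto_integral_expTrunc hθ (f := besStep θ v f) (φ := ψ) (R := R)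
      (M := Real.exp (|v| * R) * M)
      (fun k c hc hcR => by
        rw [← hψ' k c hc]
        exact (tendsto_integral_expTrunc hθ hM hf v hc hcR).2 k)
      (fun c hc hcR => by
        simp_rw [← fun k => hψ' k c hc]
        exact (tendsto_integral_expTrunc hθ hM hf v hc hcR).1) u hc hcR).1
    refine this.congr fun k => integral_congr_ae ?_
    filter_upwards [ae_dixon_interlaces θ c] with b hb
    rw [hψ' k b hb.strictAnti_right]
  refine tendsto_nhds_unique (key u v) ((key v u).congr fun k => ?_)
  exact integral_expTrunc_swap hθ (hφ k) v u k hc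

end SymmetricLimits

theorem besStep_congr {θ : ℝ} {y : ℝ} {f g : (Fin n → ℝ) → ℝ}
    (h : ∀ b, StrictAnti b → f b = g b) (c : Fin (n + 1) → ℝ) :
    besStep θ y f c = besStep θ y g c := by
  refine integral_congr_ae ?_
  filter_upwards [ae_dixon_interlaces θ c] with b hb
  have hb' : StrictAnti b := by
    cases n with
    | zero => exact fun i => i.elim0
    | succ n => exact hb.strictAnti_right
  rw [h b hb']

theorem bes_congr {θ : ℝ} {y y' : ℕ → ℝ} :
    ∀ {n : ℕ}, (∀ k < n, y k = y' k) → bes θ y n = bes θ y' n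
  | 0, _ => rfl
  | n + 1, h => by
    rw [bes, bes, h n n.lt_succ_self, bes_congr fun k hk => h k (hk.trans n.lt_succ_self)]

theorem bes_comp_swap {θ : ℝ} (hθ : 0 < θ) (y : ℕ → ℝ) (k : ℕ) (n : ℕ) (hn : k + 2 ≤ n)
    (c : Fin n → ℝ) (hc : StrictAnti c) :
    bes θ (y ∘ Equiv.swap k (k + 1)) n c = bes θ y n c := by
  induction n, hn using Nat.le_induction with
  | base =>
    have hlow : bes θ (y ∘ Equiv.swap k (k + 1)) k = bes θ y k := bes_congr fun j hj => by
      rw [Function.comp_apply, Equiv.swap_apply_of_ne_of_ne (by omega) (by omega)]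
    have h1 : (y ∘ Equiv.swap k (k + 1)) (k + 1) = y k := by simp
    have h2 : (y ∘ Equiv.swap k (k + 1)) k = y (k + 1) := by simp
    rw [bes, bes, bes, bes, hlow, h1, h2]
    obtain ⟨R, hR⟩ := Finite.exists_le fun i => |c i|
    exact besStep_comm hθ (isSymmLimit_bes hθ y R k) _ _ hc hR
  | succ n hn ih =>
    have h1 : (y ∘ Equiv.swap k (k + 1)) n = y n := by
      rw [Function.comp_apply, Equiv.swap_apply_of_ne_of_ne (by omega) (by omega)]
    rw [bes, bes, h1]
    exact besStep_congr ih c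

/-- Extension of a finite sequence by zero. -/
def extendZero (y : Fin n → ℝ) (k : ℕ) : ℝ := if h : k < n then y ⟨k, h⟩ else 0

theorem bes_comp_perm {θ : ℝ} (hθ : 0 < θ) (σ : Equiv.Perm (Fin (n + 1))) (y : Fin (n + 1) → ℝ)
    {c : Fin (n + 1) → ℝ} (hc : StrictAnti c) :
    bes θ (extendZero (y ∘ σ)) (n + 1) c = bes θ (extendZero y) (n + 1) c := by
  have hσ : σ ∈ Submonoid.closure (Set.range fun i : Fin n => Equiv.swap i.castSucc i.succ) := by
    rw [Equiv.Perm.mclosure_swap_castSucc_succ]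
    trivial
  induction hσ using Submonoid.closure_induction generalizing y with
  | mem σ hσ =>
    obtain ⟨i, rfl⟩ := hσ
    rw [← bes_comp_swap hθ (extendZero y) i (n + 1) (by have := i.isLt; omega) c hc]
    refine congrFun (bes_congr fun k hk => ?_) c
    rw [extendZero, dif_pos hk, Function.comp_apply, Function.comp_apply]
    rcases eq_or_ne k i with rfl | h1
    · rw [Equiv.swap_apply_left, extendZero, dif_pos (by have := i.isLt; omega)]
      congr 1
      exact Equiv.swap_apply_left _ _
    rcases eq_or_ne k (i + 1) with rfl | h2
    · rw [Equiv.swap_apply_right, extendZero, dif_pos (by have := i.isLt; omega)]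
      congr 1
      exact Equiv.swap_apply_right _ _
    · rw [Equiv.swap_apply_of_ne_of_ne h1 h2, extendZero, dif_pos hk,
        Equiv.swap_apply_of_ne_of_ne]
      · exact fun h => h1 (by simpa using congrArg Fin.val h)
      · exact fun h => h2 (by simpa using congrArg Fin.val h)
  | one => rfl
  | mul σ τ _ _ hσ hτ =>
    have : y ∘ ⇑(σ * τ) = (y ∘ σ) ∘ τ := rfl
    rw [this, hτ, hσ]

theorem Interlaces.strictAnti {b : Fin n → ℝ} {c : Fin (n + 1) → ℝ} (h : Interlaces b c) :
    StrictAnti b := by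
  cases n with
  | zero => exact fun i => i.elim0
  | succ n => exact h.strictAnti_right

theorem bes_nonneg (θ : ℝ) (y : ℕ → ℝ) : ∀ (n : ℕ) (c : Fin n → ℝ), 0 ≤ bes θ y n c
  | 0, _ => zero_le_one
  | n + 1, _ => integral_nonneg fun b => mul_nonneg (Real.exp_nonneg _) (bes_nonneg θ y n b)

theorem integrable_exp_mul_bes {θ : ℝ} (hθ : 0 < θ) (y : ℕ → ℝ) (t : ℝ) {c : Fin (n + 1) → ℝ}
    (hc : StrictAnti c) :
    Integrable (fun b => Real.exp (t * (∑ i, c i - ∑ i, b i)) * bes θ y n b) (dixon θ c) := by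
  have := isProbabilityMeasure_dixon hθ hc
  obtain ⟨R, hR⟩ := Finite.exists_le fun i => |c i|
  obtain ⟨φ, -, ⟨M, hM⟩, hf⟩ := isSymmLimit_bes hθ y R n
  have hmeas : AEStronglyMeasurable (bes θ y n) (dixon θ c) := by
    refine aestronglyMeasurable_of_tendsto_ae atTop (f := fun k b => MvPolynomial.eval b (φ k))
      (fun k => (MvPolynomial.continuous_eval (φ k)).aestronglyMeasurable) ?_
    filter_upwards [ae_dixon_interlaces θ c] with b hb
    exact hf b hb.strictAnti (abs_le_of_interlaces hb hR)
  refine Integrable.of_bound ((Continuous.aestronglyMeasurable (by fun_prop)).mul hmeas)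
    (Real.exp (|t| * R) * M) ?_
  filter_upwards [ae_dixon_interlaces θ c] with b hb
  rw [norm_mul]
  refine mul_le_mul ?_ ?_ (norm_nonneg _) (Real.exp_nonneg _)
  · rw [Real.norm_eq_abs, Real.abs_exp, Real.exp_le_exp]
    refine (le_abs_self _).trans ?_
    rw [abs_mul]
    exact mul_le_mul_of_nonneg_left (abs_sum_sub_sum_le hb hR) (abs_nonneg t)
  · exact le_of_tendsto (hf b hb.strictAnti (abs_le_of_interlaces hb hR)).abs
      (Eventually.of_forall fun k => hM k b hb.strictAnti (abs_le_of_interlaces hb hR))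

/-- The triangular array with top level `b` above the levels of `x`. -/
def triSnoc (x : Tri n) (b : Fin (n + 1) → ℝ) : Tri (n + 1) :=
  Fin.snoc (α := fun k : Fin (n + 1) => Fin (k.1 + 1) → ℝ) x b

theorem triSnoc_castSucc (x : Tri n) (b : Fin (n + 1) → ℝ) (k : Fin n) :
    triSnoc x b k.castSucc = x k :=
  Fin.snoc_castSucc (α := fun k : Fin (n + 1) => Fin (k.1 + 1) → ℝ) b x k

theorem triSnoc_last (x : Tri n) (b : Fin (n + 1) → ℝ) : triSnoc x b (Fin.last n) = b :=
  Fin.snoc_last (α := fun k : Fin (n + 1) => Fin (k.1 + 1) → ℝ) b x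

theorem measurable_triSnoc :
    Measurable fun p : Tri n × (Fin (n + 1) → ℝ) => triSnoc p.1 p.2 := by
  refine measurable_pi_iff.2 fun k => ?_
  refine Fin.lastCases ?_ (fun k => ?_) k
  · simp only [triSnoc_last]
    exact measurable_snd
  · simp only [triSnoc_castSucc]
    exact (measurable_pi_apply k).comp measurable_fst

theorem measurePreserving_triSnoc :
    MeasurePreserving (fun p : Tri n × (Fin (n + 1) → ℝ) => triSnoc p.1 p.2) := by
  refine ⟨measurable_triSnoc, (Measure.pi_eq fun s hs => ?_).symm⟩
  rw [Measure.map_apply measurable_triSnoc (MeasurableSet.univ_pi hs)]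
  have : (fun p : Tri n × (Fin (n + 1) → ℝ) => triSnoc p.1 p.2) ⁻¹' Set.univ.pi s =
      (Set.univ.pi fun k : Fin n => s k.castSucc) ×ˢ s (Fin.last n) := by
    ext p
    simp only [Set.mem_preimage, Set.mem_univ_pi, Set.mem_prod, Fin.forall_fin_succ',
      triSnoc_castSucc, triSnoc_last]
  rw [this, Measure.volume_eq_prod, Measure.prod_prod, Fin.prod_univ_castSucc]
  congr 1
  exact Measure.pi_pi _ _

theorem lintegral_triSnoc {F : Tri (n + 1) → ℝ≥0∞} (hF : Measurable F) :
    ∫⁻ x, F x = ∫⁻ b, ∫⁻ x : Tri n, F (triSnoc x b) := by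
  rw [← measurePreserving_triSnoc.lintegral_comp hF]
  exact lintegral_prod_symm _ (hF.comp measurable_triSnoc).aemeasurable

theorem lvl_top (a : Fin (n + 1) → ℝ) (x : Tri n) : lvl a x n n.lt_succ_self = a := by
  simp [lvl]

theorem lvl_triSnoc (a : Fin (n + 2) → ℝ) (x : Tri n) (b : Fin (n + 1) → ℝ) (k : ℕ)
    (hk : k < n + 1) : lvl a (triSnoc x b) k (hk.trans n.succ.lt_succ_self) = lvl b x k hk := by
  have h : k < n + 2 - 1 := by omega
  unfold lvl
  rw [dif_pos h]
  by_cases h' : k < n + 1 - 1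
  · rw [dif_pos h']
    exact triSnoc_castSucc x b ⟨k, h'⟩
  · rw [dif_neg h']
    obtain rfl : k = n := by omega
    exact triSnoc_last x b

theorem triSnoc_mem_obpDomain (a : Fin (n + 2) → ℝ) (x : Tri n) (b : Fin (n + 1) → ℝ) :
    triSnoc x b ∈ obpDomain a ↔ Interlaces b a ∧ x ∈ obpDomain b := by
  have h1 : triSnoc x b ∈ obpDomain a ↔ ∀ k : Fin (n + 1),
    Interlaces (triSnoc x b k) (lvl a (triSnoc x b) (k.1 + 1) (by omega)) := Iff.rfl
  rw [h1, Fin.forall_fin_succ', and_comm]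
  refine and_congr ?_ (forall_congr' fun k => ?_)
  · rw [triSnoc_last]
    exact iff_of_eq (congrArg _ (lvl_top a _))
  · rw [triSnoc_castSucc]
    exact iff_of_eq (congrArg _ (lvl_triSnoc a x b _ _))

theorem prod_prod_rpow (v : Fin n → ℝ) (s : ℝ) :
    (∏ i : Fin n, ∏ j : Fin n, if i < j then |v i - v j| ^ s else 1) = vand v ^ s := by
  rw [vand, ← Real.finsetProd_rpow _ _ fun i _ =>
    Finset.prod_nonneg fun j _ => by split_ifs <;> positivity]
  refine Finset.prod_congr rfl fun i _ => ?_
  rw [← Real.finsetProd_rpow _ _ fun j _ => by split_ifs <;> positivity]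
  refine Finset.prod_congr rfl fun j _ => ?_
  split_ifs
  · rfl
  · rw [Real.one_rpow]

theorem prod_prod_cross_rpow {m : ℕ} (u : Fin m → ℝ) (v : Fin n → ℝ) (s : ℝ) :
    ∏ i, ∏ j, |u i - v j| ^ s = cross u v ^ s := by
  rw [cross, ← Real.finsetProd_rpow _ _ fun i _ => by positivity]
  refine Finset.prod_congr rfl fun i _ => ?_
  rw [← Real.finsetProd_rpow _ _ fun j _ => by positivity]

theorem obpWt_eq (θ : ℝ) (a : Fin (n + 1) → ℝ) (x : Tri n) :
    obpWt θ a x = ∏ k : Fin n, vand (x k) ^ (2 - 2 * θ) *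
      cross (lvl a x (k.1 + 1) (by omega)) (x k) ^ (θ - 1) :=
  Finset.prod_congr rfl fun k _ => by
    rw [← prod_prod_rpow, ← prod_prod_cross_rpow]

theorem obpWt_nonneg (θ : ℝ) (a : Fin (n + 1) → ℝ) (x : Tri n) : 0 ≤ obpWt θ a x := by
  rw [obpWt_eq]
  exact Finset.prod_nonneg fun k _ => mul_nonneg (Real.rpow_nonneg (vand_nonneg _) _)
    (Real.rpow_nonneg (cross_nonneg _ _) _)

theorem obpWt_triSnoc (θ : ℝ) (a : Fin (n + 2) → ℝ) (x : Tri n) (b : Fin (n + 1) → ℝ) :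
    obpWt θ a (triSnoc x b) =
      vand b ^ (2 - 2 * θ) * cross a b ^ (θ - 1) * obpWt θ b x := by
  rw [obpWt_eq, obpWt_eq, Fin.prod_univ_castSucc, mul_comm]
  congr 1
  · rw [triSnoc_last]
    congr 2
    exact congrArg (fun u => cross u b) (lvl_top a _)
  · refine Finset.prod_congr rfl fun k _ => ?_
    rw [triSnoc_castSucc]
    congr 2
    exact congrArg (fun u => cross u (x k)) (lvl_triSnoc a x b _ _)

theorem measurable_lvl (a : Fin (n + 1) → ℝ) (k : ℕ) (hk : k < n + 1) :
    Measurable fun x : Tri n => lvl a x k hk := by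
  unfold lvl
  by_cases h : k < n + 1 - 1
  · simp only [dif_pos h]
    exact measurable_pi_apply (X := fun k : Fin n => Fin (k.1 + 1) → ℝ) ⟨k, h⟩
  · simp only [dif_neg h]
    exact measurable_const

theorem measurableSet_obpDomain (a : Fin (n + 1) → ℝ) : MeasurableSet (obpDomain a) := by
  have : obpDomain a = ⋂ k : Fin n,
      {x : Tri n | Interlaces (x k) (lvl a x (k.1 + 1) (by omega))} := by
    ext x
    simp only [Set.mem_iInter]
    rfl
  rw [this]
  refine MeasurableSet.iInter fun k => ?_
  have h : Measurable fun x : Tri n => (x k, lvl a x (k.1 + 1) (by omega)) :=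
    (measurable_pi_apply k).prodMk (measurable_lvl a _ _)
  exact isOpen_interlaces_prod.measurableSet.preimage h

theorem setLIntegral_obpDomain (a : Fin (n + 1) → ℝ) (f : Tri n → ℝ≥0∞) :
    ∫⁻ x : Tri n in obpDomain a, f x = ∫⁻ x : Tri n, (obpDomain a).indicator f x :=
  (lintegral_indicator (measurableSet_obpDomain a) f).symm

theorem measurable_obpWt (θ : ℝ) (a : Fin (n + 1) → ℝ) :
    Measurable fun x : Tri n => obpWt θ a x := by
  simp only [obpWt_eq]
  refine Finset.measurable_fun_prod _ fun k _ => ?_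
  have h1 : Measurable fun x : Tri n => x k := measurable_pi_apply k
  have h2 := measurable_lvl (n := n) a (k.1 + 1) (by omega)
  refine ((continuous_vand.measurable.comp h1).pow_const _).mul (Measurable.pow_const ?_ _)
  unfold cross
  refine Finset.measurable_fun_prod _ fun i _ => Finset.measurable_fun_prod _ fun j _ => ?_
  exact (((measurable_pi_apply i).comp h2).sub ((measurable_pi_apply j).comp h1)).abs

theorem sumLvl_zero (a : Fin (n + 1) → ℝ) (x : Tri n) : sumLvl a x 0 = 0 := by
  simp [sumLvl]

theorem sumLvl_succ (a : Fin (n + 1) → ℝ) (x : Tri n) (k : ℕ) (hk : k < n + 1) :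
    sumLvl a x (k + 1) = ∑ i, lvl a x k hk i := by
  unfold sumLvl lvl
  rw [if_neg k.succ_ne_zero]
  simp only [Nat.add_sub_cancel (n := k) (m := 1)]
  by_cases h : k < n + 1 - 1
  · rw [dif_pos h, dif_pos h]
    rfl
  · obtain rfl : k = n := by omega
    rw [dif_neg h, dif_neg h]

theorem measurable_sumLvl (a : Fin (n + 1) → ℝ) (k : ℕ) (hk : k ≤ n + 1) :
    Measurable fun x : Tri n => sumLvl a x k := by
  cases k with
  | zero => simp only [sumLvl_zero]; exact measurable_const
  | succ k =>
    simp only [sumLvl_succ a _ k hk]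
    exact Finset.measurable_fun_sum _ fun i _ =>
      (measurable_pi_apply i).comp (measurable_lvl a k hk)

theorem sumLvl_triSnoc (a : Fin (n + 2) → ℝ) (x : Tri n) (b : Fin (n + 1) → ℝ) (k : ℕ)
    (hk : k ≤ n + 1) : sumLvl a (triSnoc x b) k = sumLvl b x k := by
  cases k with
  | zero => exact (sumLvl_zero a (n := n + 1) _).trans (sumLvl_zero b x).symm
  | succ k =>
    rw [sumLvl_succ b x k hk]
    exact (sumLvl_succ a (n := n + 1) _ k (by omega)).trans (by rw [lvl_triSnoc a x b k hk])

theorem sumLvl_top (a : Fin (n + 1) → ℝ) (x : Tri n) : sumLvl a x (n + 1) = ∑ i, a i := by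
  rw [sumLvl_succ a x n n.lt_succ_self, lvl_top]

/-- The exponent in the integral representation of the multivariate Bessel function. -/
def besExponent (y : ℕ → ℝ) (a : Fin (n + 1) → ℝ) (x : Tri n) : ℝ :=
  ∑ k : Fin (n + 1), y k * (sumLvl a x (k.1 + 1) - sumLvl a x k.1)

theorem besExponent_triSnoc (y : ℕ → ℝ) (a : Fin (n + 2) → ℝ) (x : Tri n) (b : Fin (n + 1) → ℝ) :
    besExponent y a (triSnoc x b) =
      y (n + 1) * (∑ i, a i - ∑ i, b i) + besExponent y b x := by
  unfold besExponent
  rw [Fin.sum_univ_castSucc, add_comm]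
  congr 1
  · rw [Fin.val_last, sumLvl_triSnoc a x b _ le_rfl, sumLvl_top b]
    congr 2
    exact sumLvl_top a (n := n + 1) _
  · refine Finset.sum_congr rfl fun k _ => ?_
    rw [Fin.val_castSucc, sumLvl_triSnoc a x b _ (by omega), sumLvl_triSnoc a x b _ (by omega)]

theorem measurable_besExponent (y : ℕ → ℝ) (a : Fin (n + 1) → ℝ) :
    Measurable fun x : Tri n => besExponent y a x :=
  Finset.measurable_fun_sum _ fun k _ =>
    ((measurable_sumLvl a _ (by omega)).sub (measurable_sumLvl a _ (by omega))).const_mul _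

/-- The normalizing constant of the multivariate Bessel function. -/
def besConst (θ : ℝ) (n : ℕ) : ℝ := ∏ k ∈ Finset.range n, dixonConst θ k

theorem besConst_nonneg {θ : ℝ} (hθ : 0 < θ) (n : ℕ) : 0 ≤ besConst θ n :=
  Finset.prod_nonneg fun k _ => (dixonConst_pos hθ k).le

theorem besConst_eq {θ : ℝ} (n : ℕ) :
    besConst θ n = (∏ k : Fin n, Real.Gamma ((k.1 + 1) * θ)) /
      Real.Gamma θ ^ (n * (n + 1) / 2) := by
  have h : ∑ k ∈ Finset.range n, (k + 1) = n * (n + 1) / 2 := by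
    have := Finset.sum_range_id (n + 1)
    rw [Finset.sum_range_succ'] at this
    simpa [mul_comm] using this
  rw [← h, ← Finset.prod_pow_eq_pow_sum, Fin.prod_univ_eq_prod_range
    (fun k => Real.Gamma (((k : ℕ) + 1) * θ)), ← Finset.prod_div_distrib]
  rfl

theorem lintegral_obpDomain_eq_bes {θ : ℝ} (hθ : 0 < θ) (y : ℕ → ℝ) :
    ∀ {n : ℕ} {a : Fin (n + 1) → ℝ}, StrictAnti a →
    ENNReal.ofReal (besConst θ (n + 1)) * ENNReal.ofReal (vand a ^ (1 - 2 * θ)) *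
      ∫⁻ x : Tri n in obpDomain a, ENNReal.ofReal (Real.exp (besExponent y a x) * obpWt θ a x) =
    ENNReal.ofReal (bes θ y (n + 1) a)
  | 0, a, ha => by
    have := isProbabilityMeasure_dixon hθ ha
    have h1 : besConst θ 1 = 1 := by
      simp [besConst, dixonConst, (Real.Gamma_pos_of_pos hθ).ne']
    have h2 : vand a = 1 := by simp [vand]
    have h3 : obpDomain a = Set.univ := Set.eq_univ_of_forall fun x k => k.elim0
    have h4 : ∀ x : Tri 0, Real.exp (besExponent y a x) * obpWt θ a x =
        Real.exp (y 0 * ∑ i, a i) := by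
      intro x
      have e1 := sumLvl_top a x
      have e2 := sumLvl_zero a x
      rw [obpWt_eq]
      simp only [zero_add] at e1
      simp [besExponent, e1, e2]
    have h5 : volume (Set.univ : Set (Tri 0)) = 1 := by
      exact (Measure.pi_univ fun k : Fin 0 => (volume : Measure (Fin (k.1 + 1) → ℝ))).trans
        Finset.prod_empty
    have h6 : bes θ y 1 a = Real.exp (y 0 * ∑ i, a i) := by
      simp [bes, besStep]
    simp only [zero_add, h1, h2, h3, h4, h6, Real.one_rpow, ENNReal.ofReal_one, one_mul,
      Measure.restrict_univ, lintegral_const]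
    rw [h5, mul_one]
  | n + 1, a, ha => by
    have hmeas : Measurable ((obpDomain a).indicator fun x : Tri (n + 1) =>
        ENNReal.ofReal (Real.exp (besExponent y a x) * obpWt θ a x)) :=
      ((measurable_besExponent y a).exp.mul (measurable_obpWt θ a)).ennreal_ofReal.indicator
        (measurableSet_obpDomain a)
    have hinner : ∀ b, ∫⁻ x : Tri n, (obpDomain a).indicator (fun x : Tri (n + 1) =>
        ENNReal.ofReal (Real.exp (besExponent y a x) * obpWt θ a x)) (triSnoc x b) =
        {b | Interlaces b a}.indicator (fun b => ENNReal.ofReal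
          (Real.exp (y (n + 1) * (∑ i, a i - ∑ i, b i)) *
            (vand b ^ (2 - 2 * θ) * cross a b ^ (θ - 1))) *
          ∫⁻ x : Tri n in obpDomain b,
            ENNReal.ofReal (Real.exp (besExponent y b x) * obpWt θ b x)) b := by
      intro b
      by_cases hb : Interlaces b a
      · rw [Set.indicator_of_mem (s := {b | Interlaces b a}) hb,
          setLIntegral_obpDomain,
          ← lintegral_const_mul' _ _ ENNReal.ofReal_ne_top]
        refine lintegral_congr fun x => ?_
        by_cases hx : x ∈ obpDomain b
        · rw [Set.indicator_of_mem ((triSnoc_mem_obpDomain a x b).2 ⟨hb, hx⟩),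
            Set.indicator_of_mem hx, ← ENNReal.ofReal_mul (mul_nonneg (Real.exp_nonneg _)
              (mul_nonneg (Real.rpow_nonneg (vand_nonneg _) _)
                (Real.rpow_nonneg (cross_nonneg _ _) _))),
            besExponent_triSnoc, obpWt_triSnoc, Real.exp_add]
          congr 1
          ring
        · rw [Set.indicator_of_notMem fun h => hx ((triSnoc_mem_obpDomain a x b).1 h).2,
            Set.indicator_of_notMem hx, mul_zero]
      · rw [Set.indicator_of_notMem (s := {b | Interlaces b a}) hb]
        simp only [Set.indicator_of_notMem fun h => hb ((triSnoc_mem_obpDomain a _ b).1 h).1,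
          lintegral_zero]
    have hbes : ENNReal.ofReal (bes θ y (n + 2) a) = ENNReal.ofReal (dixonConst θ (n + 1)) *
        ∫⁻ b in {b | Interlaces b a}, ENNReal.ofReal (dixonWt θ a b) *
          ENNReal.ofReal (Real.exp (y (n + 1) * (∑ i, a i - ∑ i, b i)) * bes θ y (n + 1) b) := by
      rw [bes, besStep, ofReal_integral_eq_lintegral_ofReal (integrable_exp_mul_bes hθ y _ ha)
        (Eventually.of_forall fun b => mul_nonneg (Real.exp_nonneg _) (bes_nonneg θ y _ b)),
        lintegral_dixon hθ]
    have hconst : ENNReal.ofReal (besConst θ (n + 2)) =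
        ENNReal.ofReal (dixonConst θ (n + 1)) * ENNReal.ofReal (besConst θ (n + 1)) := by
      rw [besConst, Finset.prod_range_succ, mul_comm,
        ENNReal.ofReal_mul (dixonConst_pos hθ _).le, besConst]
    rw [setLIntegral_obpDomain]
    have hsplit := lintegral_triSnoc hmeas
    simp only [hinner] at hsplit
    rw [lintegral_indicator (isOpen_interlaces a).measurableSet] at hsplit
    rw [hbes, hconst]
    refine (congrArg (_ * ·) hsplit).trans ?_
    rw [mul_assoc, mul_assoc, ← lintegral_const_mul' _ _ ENNReal.ofReal_ne_top,
      ← lintegral_const_mul' _ _ ENNReal.ofReal_ne_top]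
    congr 1
    refine setLIntegral_congr_fun (isOpen_interlaces a).measurableSet fun b hb => ?_
    have hb' : StrictAnti b := Interlaces.strictAnti hb
    have hE := Real.exp_nonneg (y (n + 1) * (∑ i, a i - ∑ i, b i))
    have hv : vand b ^ (2 - 2 * θ) = vand b * vand b ^ (1 - 2 * θ) := by
      rw [show 2 - 2 * θ = 1 + (1 - 2 * θ) by ring, Real.rpow_add (vand_pos hb'.injective),
        Real.rpow_one]
    have hvb := Real.rpow_nonneg (vand_nonneg b) (1 - 2 * θ)
    have hva := Real.rpow_nonneg (vand_nonneg a) (1 - 2 * θ)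
    have hcr := Real.rpow_nonneg (cross_nonneg a b) (θ - 1)
    rw [ENNReal.ofReal_mul hE, ENNReal.ofReal_mul (q := bes θ y (n + 1) b) hE,
      ← lintegral_obpDomain_eq_bes hθ y hb', dixonWt, hv,
      ENNReal.ofReal_mul (mul_nonneg (vand_nonneg b) hvb),
      ENNReal.ofReal_mul (vand_nonneg b), ENNReal.ofReal_mul (mul_nonneg hva (vand_nonneg b)),
      ENNReal.ofReal_mul hva]
    ring

theorem MBF_eq_bes {θ : ℝ} (hθ : 0 < θ) {a : Fin (n + 1) → ℝ} (ha : StrictAnti a)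
    (y : Fin (n + 1) → ℝ) :
    MBF θ a (fun k => (y k : ℂ)) = ((bes θ (extendZero y) (n + 1) a : ℝ) : ℂ) := by
  have hy : ∀ k : Fin (n + 1), extendZero y k = y k := fun k => dif_pos k.isLt
  have h1 : ∀ x : Tri n, Complex.exp (∑ k : Fin (n + 1),
      (y k : ℂ) * ((sumLvl a x (k.1 + 1) - sumLvl a x k.1 : ℝ) : ℂ)) * ((obpWt θ a x : ℝ) : ℂ) =
      ((Real.exp (besExponent (extendZero y) a x) * obpWt θ a x : ℝ) : ℂ) := by
    intro x
    simp only [besExponent, hy]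
    push_cast
    rfl
  have hInt : ∫ x : Tri n in obpDomain a, Real.exp (besExponent (extendZero y) a x) * obpWt θ a x =
      (∫⁻ x : Tri n in obpDomain a,
        ENNReal.ofReal (Real.exp (besExponent (extendZero y) a x) * obpWt θ a x)).toReal :=
    integral_eq_lintegral_of_nonneg_ae
      (Eventually.of_forall fun x => mul_nonneg (Real.exp_nonneg _) (obpWt_nonneg θ a x))
      ((measurable_besExponent _ a).exp.mul (measurable_obpWt θ a)).aestronglyMeasurable
  have hmain := congrArg ENNReal.toReal (lintegral_obpDomain_eq_bes hθ (extendZero y) ha)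
  rw [ENNReal.toReal_mul, ENNReal.toReal_mul, ← hInt, ENNReal.toReal_ofReal (bes_nonneg _ _ _ _),
    ENNReal.toReal_ofReal (Real.rpow_nonneg (vand_nonneg _) _), ENNReal.toReal_ofReal
      (besConst_nonneg hθ _)] at hmain
  rw [← hmain]
  unfold MBF
  rw [← besConst_eq, prod_prod_rpow]
  refine (congrArg (_ * ·) ((integral_congr_ae (Eventually.of_forall h1)).trans
    integral_ofReal)).trans ?_
  push_cast
  rfl

theorem abs_exp_sub_exp_le {a b L : ℝ} (ha : a ≤ L) (hb : b ≤ L) :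
    |Real.exp a - Real.exp b| ≤ Real.exp L * |a - b| := by
  have key : ∀ a b : ℝ, a ≤ L → Real.exp a - Real.exp b ≤ Real.exp L * |a - b| := by
    intro a b ha
    have h1 : Real.exp b = Real.exp a * Real.exp (b - a) := by rw [← Real.exp_add]; congr 1; ring
    have h2 := Real.add_one_le_exp (b - a)
    have h3 := Real.exp_pos a
    have h4 := Real.exp_le_exp.2 ha
    calc Real.exp a - Real.exp b = Real.exp a * (1 - Real.exp (b - a)) := by rw [h1]; ring
      _ ≤ Real.exp a * (a - b) := mul_le_mul_of_nonneg_left (by linarith) h3.le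
      _ ≤ Real.exp a * |a - b| := mul_le_mul_of_nonneg_left (le_abs_self _) h3.le
      _ ≤ Real.exp L * |a - b| := mul_le_mul_of_nonneg_right h4 (abs_nonneg _)
  refine abs_le.2 ⟨?_, key a b ha⟩
  have := key b a hb
  rw [abs_sub_comm] at this
  linarith

theorem exp_le_one_sub_div_rpow {M u : ℝ} (hM : 0 < M) (hu : |u| ≤ M / 2) :
    Real.exp u ≤ (1 - u / M) ^ (-M) := by
  have hx : |u / M| ≤ 1 / 2 := by
    rw [abs_div, abs_of_pos hM, div_le_iff₀ hM]; linarith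
  have hpos : 0 < 1 - u / M := by have := abs_le.1 hx; linarith
  rw [Real.rpow_def_of_pos hpos, Real.exp_le_exp]
  have h := mul_le_mul_of_nonneg_right (Real.log_le_sub_one_of_pos hpos) hM.le
  have e : (1 - u / M - 1) * M = -u := by field_simp; ring
  linarith

theorem one_sub_div_rpow_le_exp {M u : ℝ} (hM : 0 < M) (hu : |u| ≤ M / 2) :
    (1 - u / M) ^ (-M) ≤ Real.exp (u + 2 * u ^ 2 / M) := by
  have hx : |u / M| ≤ 1 / 2 := by
    rw [abs_div, abs_of_pos hM, div_le_iff₀ hM]; linarith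
  have hpos : 0 < 1 - u / M := by have := abs_le.1 hx; linarith
  rw [Real.rpow_def_of_pos hpos, Real.exp_le_exp]
  have h := Real.abs_log_sub_add_sum_range_le (x := u / M) (by linarith) 1
  have h2 : |u / M| ^ (1 + 1) / (1 - |u / M|) ≤ 2 * (u / M) ^ 2 := by
    rw [div_le_iff₀ (by linarith), ← sq_abs (u / M)]
    nlinarith [sq_nonneg |u / M|]
  have h3 := mul_le_mul_of_nonneg_right (abs_le.1 (h.trans h2)).1 hM.le
  simp only [Finset.range_one, Finset.sum_singleton, zero_add, pow_one, Nat.cast_zero,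
    div_one] at h3
  have e : -(2 * (u / M) ^ 2) * M = -(2 * u ^ 2 / M) := by field_simp
  have e2 : (u / M + Real.log (1 - u / M)) * M = u + Real.log (1 - u / M) * M := by field_simp
  linarith

theorem one_sub_div_rpow_sub_exp_le {M u U : ℝ} (hM : 0 < M) (hu : |u| ≤ M / 2) (huU : |u| ≤ U) :
    (1 - u / M) ^ (-M) - Real.exp u ≤
      4 * Real.exp (2 * U ^ 2 / M) / M * (Real.exp (2 * u) + 1) := by
  have hw : 0 ≤ 2 * u ^ 2 / M := by positivity
  have hwU : 2 * u ^ 2 / M ≤ 2 * U ^ 2 / M := by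
    rw [← sq_abs u]
    gcongr
  have h1 := one_sub_div_rpow_le_exp hM hu
  have h2 : Real.exp (2 * u ^ 2 / M) - 1 ≤ Real.exp (2 * U ^ 2 / M) * (2 * u ^ 2 / M) := by
    have := abs_exp_sub_exp_le hwU (hw.trans hwU)
    rw [Real.exp_zero, sub_zero, abs_of_nonneg hw] at this
    exact (le_abs_self _).trans this
  have h3 : u ^ 2 ≤ 2 * Real.exp |u| := by
    have := Real.quadratic_le_exp_of_nonneg (abs_nonneg u)
    rw [sq_abs] at this
    linarith [abs_nonneg u]
  have h4 : Real.exp u * Real.exp |u| ≤ Real.exp (2 * u) + 1 := by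
    rw [← Real.exp_add]
    rcases le_total 0 u with h | h
    · rw [abs_of_nonneg h, two_mul]; linarith
    · rw [abs_of_nonpos h, add_neg_cancel, Real.exp_zero]
      linarith [Real.exp_pos (2 * u)]
  have hE := Real.exp_pos u
  have hC : 0 < Real.exp (2 * U ^ 2 / M) := Real.exp_pos _
  calc (1 - u / M) ^ (-M) - Real.exp u
      ≤ Real.exp u * (Real.exp (2 * u ^ 2 / M) - 1) := by rw [Real.exp_add] at h1; linarith
    _ ≤ Real.exp u * (Real.exp (2 * U ^ 2 / M) * (2 * u ^ 2 / M)) :=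
        mul_le_mul_of_nonneg_left h2 hE.le
    _ = 2 * Real.exp (2 * U ^ 2 / M) / M * (Real.exp u * u ^ 2) := by ring
    _ ≤ 2 * Real.exp (2 * U ^ 2 / M) / M * (Real.exp u * (2 * Real.exp |u|)) := by gcongr
    _ = 4 * Real.exp (2 * U ^ 2 / M) / M * (Real.exp u * Real.exp |u|) := by ring
    _ ≤ _ := by gcongr

/-- The product `∏ᵢ (1 - s cᵢ)^{-θ}`. -/
def kreinProd (θ s : ℝ) (c : Fin n → ℝ) : ℝ := ∏ i, (1 - s * c i) ^ (-θ)

theorem one_sub_mul_pos {s R x : ℝ} (hs : |s| * R ≤ 1 / 2) (hx : |x| ≤ R) : 0 < 1 - s * x := by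
  have h : |s * x| ≤ 1 / 2 := by
    rw [abs_mul]
    exact (mul_le_mul_of_nonneg_left hx (abs_nonneg s)).trans hs
  have := abs_le.1 h
  linarith

theorem integral_dixon_markov_krein {θ : ℝ} (hθ : 0 < θ) {c : Fin (n + 1) → ℝ} (hc : StrictAnti c)
    {s R : ℝ} (hcR : ∀ i, |c i| ≤ R) (hs : |s| * R ≤ 1 / 2) :
    Integrable (fun b => (1 - s * (∑ i, c i - ∑ j, b j)) ^ (-((n + 1) * θ))) (dixon θ c) ∧
    ∫ b, (1 - s * (∑ i, c i - ∑ j, b j)) ^ (-((n + 1) * θ)) ∂(dixon θ c) = kreinProd θ s c := by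
  have h := lintegral_dixon_markov_krein hθ hc (s := s) fun i => one_sub_mul_pos hs (hcR i)
  have hnn : 0 ≤ᵐ[dixon θ c] fun b => (1 - s * (∑ i, c i - ∑ j, b j)) ^ (-((n + 1) * θ)) := by
    filter_upwards [ae_dixon_interlaces θ c] with b hb
    exact Real.rpow_nonneg (one_sub_mul_pos hs (abs_sum_sub_sum_le hb hcR)).le _
  have hm : AEStronglyMeasurable
      (fun b : Fin n → ℝ => (1 - s * (∑ i, c i - ∑ j, b j)) ^ (-((n + 1) * θ))) (dixon θ c) :=
    (Measurable.pow_const (by fun_prop) _).aestronglyMeasurable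
  refine ⟨(lintegral_ofReal_ne_top_iff_integrable hm hnn).1 (by simp [h]), ?_⟩
  rw [integral_eq_lintegral_of_nonneg_ae hnn hm, h, ENNReal.toReal_ofReal, kreinProd]
  exact Finset.prod_nonneg fun i _ => Real.rpow_nonneg (one_sub_mul_pos hs (hcR i)).le _

theorem integrable_exp_dixon {θ : ℝ} (hθ : 0 < θ) {c : Fin (n + 1) → ℝ} (hc : StrictAnti c)
    (t : ℝ) : Integrable (fun b => Real.exp (t * (∑ i, c i - ∑ i, b i))) (dixon θ c) := by
  have := isProbabilityMeasure_dixon hθ hc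
  obtain ⟨R, hR⟩ := Finite.exists_le fun i => |c i|
  refine Integrable.of_bound (Continuous.aestronglyMeasurable (by fun_prop))
    (Real.exp (|t| * R)) ?_
  filter_upwards [ae_dixon_interlaces θ c] with b hb
  rw [Real.norm_eq_abs, Real.abs_exp, Real.exp_le_exp]
  refine (le_abs_self _).trans ?_
  rw [abs_mul]
  exact mul_le_mul_of_nonneg_left (abs_sum_sub_sum_le hb hR) (abs_nonneg t)

theorem integral_exp_dixon_le {θ : ℝ} (hθ : 0 < θ) {c : Fin (n + 1) → ℝ} (hc : StrictAnti c)
    {t R : ℝ} (hcR : ∀ i, |c i| ≤ R) (ht : |t| * R ≤ (n + 1) * θ / 2) :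
    ∫ b, Real.exp (t * (∑ i, c i - ∑ i, b i)) ∂dixon θ c ≤
      kreinProd θ (t / ((n + 1) * θ)) c := by
  have hM : 0 < (n + 1) * θ := by positivity
  have hs : |t / ((n + 1) * θ)| * R ≤ 1 / 2 := by
    rw [abs_div, abs_of_pos hM, div_mul_eq_mul_div, div_le_iff₀ hM]; linarith
  obtain ⟨h1, h2⟩ := integral_dixon_markov_krein hθ hc hcR hs
  rw [← h2]
  refine integral_mono_ae (integrable_exp_dixon hθ hc t) h1 ?_
  filter_upwards [ae_dixon_interlaces θ c] with b hb
  have := exp_le_one_sub_div_rpow hM (u := t * (∑ i, c i - ∑ i, b i)) (by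
    rw [abs_mul]
    exact (mul_le_mul_of_nonneg_left (abs_sum_sub_sum_le hb hcR) (abs_nonneg t)).trans ht)
  rwa [div_mul_eq_mul_div]

theorem kreinProd_sub_integral_exp_dixon_le {θ : ℝ} (hθ : 0 < θ) {c : Fin (n + 1) → ℝ}
    (hc : StrictAnti c) {t R : ℝ} (hcR : ∀ i, |c i| ≤ R) (ht : |t| * R ≤ (n + 1) * θ / 4) :
    kreinProd θ (t / ((n + 1) * θ)) c - ∫ b, Real.exp (t * (∑ i, c i - ∑ i, b i)) ∂dixon θ c ≤
      4 * Real.exp (2 * (|t| * R) ^ 2 / ((n + 1) * θ)) / ((n + 1) * θ) *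
        (kreinProd θ (2 * t / ((n + 1) * θ)) c + 1) := by
  have := isProbabilityMeasure_dixon hθ hc
  have hM : 0 < (n + 1) * θ := by positivity
  have hs : |t / ((n + 1) * θ)| * R ≤ 1 / 2 := by
    rw [abs_div, abs_of_pos hM, div_mul_eq_mul_div, div_le_iff₀ hM]; linarith
  obtain ⟨h1, h2⟩ := integral_dixon_markov_krein hθ hc hcR hs
  have h3 : ∫ b, Real.exp (2 * t * (∑ i, c i - ∑ i, b i)) ∂dixon θ c ≤
      kreinProd θ (2 * t / ((n + 1) * θ)) c :=
    integral_exp_dixon_le hθ hc hcR (by rw [abs_mul, abs_two]; linarith)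
  have hI := integrable_exp_dixon hθ hc (2 * t)
  rw [← h2, ← integral_sub h1 (integrable_exp_dixon hθ hc t)]
  calc _ ≤ ∫ b, 4 * Real.exp (2 * (|t| * R) ^ 2 / ((n + 1) * θ)) / ((n + 1) * θ) *
        (Real.exp (2 * t * (∑ i, c i - ∑ i, b i)) + 1) ∂dixon θ c := by
        refine integral_mono_ae (h1.sub (integrable_exp_dixon hθ hc t))
          ((hI.add (integrable_const 1)).const_mul _) ?_
        filter_upwards [ae_dixon_interlaces θ c] with b hb
        have hu : |t * (∑ i, c i - ∑ i, b i)| ≤ |t| * R := by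
          rw [abs_mul]
          exact mul_le_mul_of_nonneg_left (abs_sum_sub_sum_le hb hcR) (abs_nonneg t)
        have := one_sub_div_rpow_sub_exp_le hM (by linarith) hu
        rwa [← mul_assoc, ← div_mul_eq_mul_div] at this
    _ ≤ _ := by
      rw [integral_const_mul, integral_add hI (integrable_const 1)]
      simp only [integral_const, probReal_univ, smul_eq_mul, mul_one]
      gcongr

theorem abs_log_kreinProd_sub_le {θ : ℝ} (hθ : 0 < θ) {c : Fin n → ℝ} {s R : ℝ}
    (hcR : ∀ i, |c i| ≤ R) (hs : |s| * R ≤ 1 / 2) :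
    |Real.log (kreinProd θ s c) - θ * (s * ∑ i, c i + s ^ 2 * (∑ i, c i ^ 2) / 2)| ≤
      2 * θ * n * (|s| * R) ^ 3 := by
  have hpos : ∀ i, 0 < 1 - s * c i := fun i => one_sub_mul_pos hs (hcR i)
  have h1 : Real.log (kreinProd θ s c) - θ * (s * ∑ i, c i + s ^ 2 * (∑ i, c i ^ 2) / 2) =
      ∑ i, -θ * (s * c i + (s * c i) ^ 2 / 2 + Real.log (1 - s * c i)) := by
    rw [kreinProd, Real.log_prod fun i _ => (Real.rpow_pos_of_pos (hpos i) _).ne',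
      ← Finset.mul_sum, Finset.sum_add_distrib, Finset.sum_add_distrib,
      Finset.sum_congr rfl fun i _ => Real.log_rpow (hpos i) (-θ)]
    simp only [mul_pow, ← Finset.mul_sum, ← Finset.sum_div]
    ring
  rw [h1]
  refine (Finset.abs_sum_le_sum_abs _ _).trans ?_
  have h2 : ∀ i ∈ Finset.univ, |-θ * (s * c i + (s * c i) ^ 2 / 2 + Real.log (1 - s * c i))| ≤
      2 * θ * (|s| * R) ^ 3 := by
    intro i _
    have hx : |s * c i| ≤ |s| * R := by
      rw [abs_mul]
      exact mul_le_mul_of_nonneg_left (hcR i) (abs_nonneg s)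
    have h := Real.abs_log_sub_add_sum_range_le (x := s * c i) (by linarith) 2
    have h3 : |s * c i| ^ (2 + 1) / (1 - |s * c i|) ≤ 2 * (|s| * R) ^ 3 := by
      rw [div_le_iff₀ (by linarith)]
      have h4 : |s * c i| ^ 3 ≤ (|s| * R) ^ 3 := pow_le_pow_left₀ (abs_nonneg _) hx 3
      have h5 : 0 ≤ (|s| * R) ^ 3 := (pow_nonneg (abs_nonneg _) 3).trans h4
      have h6 := mul_nonneg h5 (by linarith : 0 ≤ 1 / 2 - |s * c i|)
      rw [show 2 + 1 = 3 from rfl]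
      linarith
    simp only [Finset.sum_range_succ, Finset.sum_range_zero, zero_add, pow_one, Nat.cast_zero,
      div_one, Nat.cast_one, one_add_one_eq_two] at h
    rw [abs_mul, abs_neg, abs_of_pos hθ]
    calc θ * _ ≤ θ * (2 * (|s| * R) ^ 3) := mul_le_mul_of_nonneg_left (h.trans h3) hθ.le
      _ = _ := by ring
  refine (Finset.sum_le_card_nsmul _ _ _ h2).trans_eq ?_
  rw [Finset.card_univ, Fintype.card_fin, nsmul_eq_mul]
  ring

theorem kreinProd_pos {θ : ℝ} {c : Fin n → ℝ} {s R : ℝ} (hcR : ∀ i, |c i| ≤ R)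
    (hs : |s| * R ≤ 1 / 2) : 0 < kreinProd θ s c :=
  Finset.prod_pos fun i _ => Real.rpow_pos_of_pos (one_sub_mul_pos hs (hcR i)) _

/-- The constant in the Gaussian approximation of `log ∏ᵢ (1 - s cᵢ)^{-θ}`. -/
def gaussConst (θ K D y : ℝ) : ℝ :=
  2 * |y| * K + 2 * y ^ 2 * K ^ 2 * D / θ + 8 * |y| ^ 3 * K ^ 3 / θ ^ 2

theorem gaussConst_nonneg {θ K D : ℝ} (hθ : 0 < θ) (hK : 0 ≤ K) (hD : 0 ≤ D) (y : ℝ) :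
    0 ≤ gaussConst θ K D y := by
  unfold gaussConst
  positivity

theorem sum_sq_le {p K N : ℝ} (hp : (n : ℝ) = p) {c : Fin n → ℝ} (hc : ∀ i, |c i| ≤ K * N) :
    ∑ i, c i ^ 2 ≤ p * (K * N) ^ 2 := by
  refine (Finset.sum_le_card_nsmul _ _ ((K * N) ^ 2) fun i _ => ?_).trans_eq ?_
  · rw [← sq_abs]
    exact pow_le_pow_left₀ (abs_nonneg _) (hc i) 2
  · rw [Finset.card_univ, Fintype.card_fin, nsmul_eq_mul, hp]

theorem abs_log_kreinProd_sub_gauss_le {θ : ℝ} (hθ : 0 < θ) {K D N y : ℝ} (hK : 0 ≤ K)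
    (hN : 1 ≤ N) {c : Fin (n + 1) → ℝ} (hle : (n + 1 : ℝ) ≤ N) (hD : N ≤ n + 1 + D)
    (hhalf : N ≤ 2 * (n + 1)) (hc : ∀ i, |c i| ≤ K * N) (hsum : |∑ i, c i| ≤ K * N)
    (hsmall : |y| * K * √N ≤ (n + 1) * θ / 2) :
    |Real.log (kreinProd θ (y / √N / ((n + 1) * θ)) c) -
      (∑ i, c i ^ 2) / N ^ 3 * (y ^ 2 / (2 * θ))| ≤ gaussConst θ K D y / √N := by
  have hN0 : 0 < N := by linarith
  obtain ⟨r, hr⟩ : ∃ r, r = √N := ⟨_, rfl⟩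
  obtain ⟨p, hp⟩ : ∃ p : ℝ, p = n + 1 := ⟨_, rfl⟩
  have hr1 : 1 ≤ r := by rw [hr]; exact Real.one_le_sqrt.2 hN
  have hr2 : N = r ^ 2 := by rw [hr, Real.sq_sqrt hN0.le]
  have hpcast : ((n + 1 : ℕ) : ℝ) = p := by rw [hp]; push_cast; ring
  have hp0 : 0 < p := by rw [hp]; positivity
  have hD0 : 0 ≤ D := by linarith
  have hQ := sum_sq_le hpcast hc
  have hQ0 : 0 ≤ ∑ i, c i ^ 2 := Finset.sum_nonneg fun i _ => sq_nonneg _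
  rw [← hr] at hsmall ⊢
  rw [← hp] at hsmall hle hD hhalf ⊢
  have hr0 : 0 < r := by linarith
  have hsR : |y / r / (p * θ)| * (K * N) = |y| * K * r / (p * θ) := by
    rw [abs_div, abs_div, abs_of_pos hr0, abs_of_pos (mul_pos hp0 hθ), hr2]
    field_simp
  have hmain := abs_log_kreinProd_sub_le hθ (c := c) (s := y / r / (p * θ)) hc (by
    rw [hsR, div_le_iff₀ (mul_pos hp0 hθ)]; linarith)
  rw [hsR, hpcast] at hmain
  generalize ∑ i, c i ^ 2 = Q at *
  generalize ∑ i, c i = S at *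
  have e1 : |θ * (y / r / (p * θ) * S)| ≤ 2 * |y| * K / r := by
    have : θ * (y / r / (p * θ) * S) = y * S / (r * p) := by field_simp
    rw [this, abs_div, abs_mul, abs_of_pos (mul_pos hr0 hp0), div_le_div_iff₀ (by positivity) hr0]
    calc |y| * |S| * r ≤ |y| * (K * (2 * p)) * r := by
          gcongr
          exact hsum.trans (by gcongr)
      _ = 2 * |y| * K * (r * p) := by ring
  have e2 : |θ * ((y / r / (p * θ)) ^ 2 * Q / 2) - Q / N ^ 3 * (y ^ 2 / (2 * θ))| ≤
      2 * y ^ 2 * K ^ 2 * D / θ / r := by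
    have : θ * ((y / r / (p * θ)) ^ 2 * Q / 2) - Q / N ^ 3 * (y ^ 2 / (2 * θ)) =
        y ^ 2 * Q * ((N - p) * (N + p)) / (2 * θ * N ^ 3 * p ^ 2) := by
      have hN0' := hN0.ne'
      rw [div_pow, div_pow, ← hr2]
      field_simp
      ring
    rw [this, abs_of_nonneg (by
      have : 0 ≤ N - p := by linarith
      positivity), div_div, div_le_div_iff₀ (by positivity) (by positivity)]
    have hrN : r ≤ N := by rw [hr2]; nlinarith
    calc y ^ 2 * Q * ((N - p) * (N + p)) * (θ * r)
        ≤ y ^ 2 * (p * (K * N) ^ 2) * (D * (N + N)) * (θ * N) := by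
          have : 0 ≤ N - p := by linarith
          gcongr
          linarith
      _ = 2 * y ^ 2 * K ^ 2 * D * (θ * N ^ 3 * p) * N := by ring
      _ ≤ 2 * y ^ 2 * K ^ 2 * D * (θ * N ^ 3 * p) * (2 * p) := by gcongr
      _ = _ := by ring
  have e3 : 2 * θ * p * (|y| * K * r / (p * θ)) ^ 3 ≤ 8 * |y| ^ 3 * K ^ 3 / θ ^ 2 / r := by
    have : 2 * θ * p * (|y| * K * r / (p * θ)) ^ 3 =
        2 * |y| ^ 3 * K ^ 3 * r ^ 3 / (p ^ 2 * θ ^ 2) := by field_simp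
    rw [this, div_div, div_le_div_iff₀ (by positivity) (by positivity)]
    calc 2 * |y| ^ 3 * K ^ 3 * r ^ 3 * (θ ^ 2 * r) = 2 * |y| ^ 3 * K ^ 3 * θ ^ 2 * N ^ 2 := by
          rw [hr2]; ring
      _ ≤ 2 * |y| ^ 3 * K ^ 3 * θ ^ 2 * (2 * p) ^ 2 := by gcongr
      _ = _ := by ring
  have e4 : gaussConst θ K D y / r = 2 * |y| * K / r + 2 * y ^ 2 * K ^ 2 * D / θ / r +
      8 * |y| ^ 3 * K ^ 3 / θ ^ 2 / r := by
    unfold gaussConst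
    ring
  rw [e4]
  rw [abs_le] at *
  constructor <;> linarith

/-- The constant in the Gaussian approximation of the moment generating function of one
Dixon–Anderson step. -/
def stepConst (θ K D y : ℝ) : ℝ :=
  Real.exp (K ^ 2 * (y ^ 2 / (2 * θ)) + gaussConst θ K D y) * gaussConst θ K D y +
    8 / θ * Real.exp (4 * y ^ 2 * K ^ 2 / θ) *
      (Real.exp (K ^ 2 * ((2 * y) ^ 2 / (2 * θ)) + gaussConst θ K D (2 * y)) + 1)

theorem stepConst_nonneg {θ K D : ℝ} (hθ : 0 < θ) (hK : 0 ≤ K) (hD : 0 ≤ D) (y : ℝ) :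
    0 ≤ stepConst θ K D y := by
  have := gaussConst_nonneg hθ hK hD y
  unfold stepConst
  positivity

theorem sum_sq_div_le {K N : ℝ} (hN : 0 < N) (hle : (n : ℝ) ≤ N) {c : Fin n → ℝ}
    (hc : ∀ i, |c i| ≤ K * N) : (∑ i, c i ^ 2) / N ^ 3 ≤ K ^ 2 := by
  rw [div_le_iff₀ (by positivity)]
  calc ∑ i, c i ^ 2 ≤ n * (K * N) ^ 2 := sum_sq_le rfl hc
    _ ≤ N * (K * N) ^ 2 := by gcongr
    _ = K ^ 2 * N ^ 3 := by ring

theorem abs_integral_exp_dixon_sub_le {θ : ℝ} (hθ : 0 < θ) {K D N y : ℝ} (hK : 0 ≤ K)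
    (hN : 1 ≤ N) {c : Fin (n + 1) → ℝ} (hanti : StrictAnti c) (hle : (n + 1 : ℝ) ≤ N)
    (hD : N ≤ n + 1 + D) (hhalf : N ≤ 2 * (n + 1)) (hc : ∀ i, |c i| ≤ K * N)
    (hsum : |∑ i, c i| ≤ K * N) (hsmall : |y| * K * √N ≤ (n + 1) * θ / 4) :
    |∫ b, Real.exp (y / √N * (∑ i, c i - ∑ i, b i)) ∂dixon θ c -
      Real.exp ((∑ i, c i ^ 2) / N ^ 3 * (y ^ 2 / (2 * θ)))| ≤ stepConst θ K D y / √N := by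
  have hN0 : 0 < N := by linarith
  have hr1 : 1 ≤ √N := Real.one_le_sqrt.2 hN
  have hr0 : 0 < √N := by linarith
  have hr2 : √N * √N = N := Real.mul_self_sqrt hN0.le
  have hM : 0 < (n + 1) * θ := by positivity
  have hD0 : 0 ≤ D := by linarith
  have hV := sum_sq_div_le hN0 (by push_cast; exact hle) hc
  have hlog : ∀ z : ℝ, |z| * K * √N ≤ (n + 1) * θ / 2 →
      0 < kreinProd θ (z / √N / ((n + 1) * θ)) c ∧
      Real.log (kreinProd θ (z / √N / ((n + 1) * θ)) c) ≤
        K ^ 2 * (z ^ 2 / (2 * θ)) + gaussConst θ K D z := by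
    intro z hz
    constructor
    · refine kreinProd_pos hc ?_
      have : |z / √N / ((n + 1) * θ)| * (K * N) = |z| * K * √N / ((n + 1) * θ) := by
        rw [abs_div, abs_div, abs_of_pos hr0, abs_of_pos hM]
        nth_rewrite 2 [← hr2]
        field_simp
      rw [this, div_le_iff₀ hM]
      linarith
    · have h1 := (abs_le.1 (abs_log_kreinProd_sub_gauss_le hθ hK hN hle hD hhalf hc hsum hz)).2
      have h2 : gaussConst θ K D z / √N ≤ gaussConst θ K D z :=
        div_le_self (gaussConst_nonneg hθ hK hD0 z) hr1
      have h3 : (∑ i, c i ^ 2) / N ^ 3 * (z ^ 2 / (2 * θ)) ≤ K ^ 2 * (z ^ 2 / (2 * θ)) := by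
        gcongr
      linarith
  obtain ⟨hpos, hL⟩ := hlog y (by linarith)
  obtain ⟨hpos2, hL2⟩ := hlog (2 * y) (by rw [abs_mul, abs_two]; linarith)
  have hP : |kreinProd θ (y / √N / ((n + 1) * θ)) c -
      Real.exp ((∑ i, c i ^ 2) / N ^ 3 * (y ^ 2 / (2 * θ)))| ≤
      Real.exp (K ^ 2 * (y ^ 2 / (2 * θ)) + gaussConst θ K D y) * (gaussConst θ K D y / √N) := by
    rw [← Real.exp_log hpos]
    refine (abs_exp_sub_exp_le hL ?_).trans (mul_le_mul_of_nonneg_left ?_ (Real.exp_nonneg _))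
    · have h3 : (∑ i, c i ^ 2) / N ^ 3 * (y ^ 2 / (2 * θ)) ≤ K ^ 2 * (y ^ 2 / (2 * θ)) := by
        gcongr
      linarith [gaussConst_nonneg hθ hK hD0 y]
    · exact abs_log_kreinProd_sub_gauss_le hθ hK hN hle hD hhalf hc hsum (by linarith)
  have htR : |y / √N| * (K * N) = |y| * K * √N := by
    rw [abs_div, abs_of_pos hr0]
    nth_rewrite 2 [← hr2]
    field_simp
  have hup := integral_exp_dixon_le hθ hanti (t := y / √N) hc (by rw [htR]; linarith)
  have hlow := kreinProd_sub_integral_exp_dixon_le hθ hanti (t := y / √N) hc (by rw [htR]; linarith)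
  rw [htR, ← mul_div_assoc] at hlow
  have hP2 : kreinProd θ (2 * y / √N / ((n + 1) * θ)) c ≤
      Real.exp (K ^ 2 * ((2 * y) ^ 2 / (2 * θ)) + gaussConst θ K D (2 * y)) := by
    rw [← Real.exp_log hpos2]
    exact Real.exp_le_exp.2 hL2
  have hE : 2 * (|y| * K * √N) ^ 2 / ((n + 1) * θ) ≤ 4 * y ^ 2 * K ^ 2 / θ := by
    rw [mul_pow, mul_pow, sq_abs, Real.sq_sqrt hN0.le, div_le_div_iff₀ hM hθ]
    calc 2 * (y ^ 2 * K ^ 2 * N) * θ ≤ 2 * (y ^ 2 * K ^ 2 * (2 * (n + 1))) * θ := by gcongr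
      _ = _ := by ring
  have hM2 : 4 / ((n + 1) * θ) ≤ 8 / θ / √N := by
    rw [div_div, div_le_div_iff₀ hM (by positivity)]
    have : √N ≤ N := by nlinarith
    calc 4 * (θ * √N) ≤ 4 * (θ * (2 * (n + 1))) := by
          gcongr
          linarith
      _ = _ := by ring
  have hlow2 : 4 * Real.exp (2 * (|y| * K * √N) ^ 2 / ((n + 1) * θ)) / ((n + 1) * θ) *
      (kreinProd θ (2 * y / √N / ((n + 1) * θ)) c + 1) ≤
      8 / θ * Real.exp (4 * y ^ 2 * K ^ 2 / θ) *
      (Real.exp (K ^ 2 * ((2 * y) ^ 2 / (2 * θ)) + gaussConst θ K D (2 * y)) + 1) / √N := by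
    calc _ = 4 / ((n + 1) * θ) * Real.exp (2 * (|y| * K * √N) ^ 2 / ((n + 1) * θ)) *
          (kreinProd θ (2 * y / √N / ((n + 1) * θ)) c + 1) := by ring
      _ ≤ 8 / θ / √N * Real.exp (4 * y ^ 2 * K ^ 2 / θ) *
          (Real.exp (K ^ 2 * ((2 * y) ^ 2 / (2 * θ)) + gaussConst θ K D (2 * y)) + 1) := by
        gcongr
      _ = _ := by ring
  have hsplit : stepConst θ K D y / √N =
      Real.exp (K ^ 2 * (y ^ 2 / (2 * θ)) + gaussConst θ K D y) * (gaussConst θ K D y / √N) +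
      8 / θ * Real.exp (4 * y ^ 2 * K ^ 2 / θ) *
      (Real.exp (K ^ 2 * ((2 * y) ^ 2 / (2 * θ)) + gaussConst θ K D (2 * y)) + 1) / √N := by
    unfold stepConst
    ring
  rw [hsplit]
  have hnn : 0 ≤ 8 / θ * Real.exp (4 * y ^ 2 * K ^ 2 / θ) *
      (Real.exp (K ^ 2 * ((2 * y) ^ 2 / (2 * θ)) + gaussConst θ K D (2 * y)) + 1) / √N := by
    positivity
  rw [abs_le] at hP ⊢
  constructor <;> linarith

/-- The sequence `z` shifted by `n` places, with zeros in front. -/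
def shiftZero (n : ℕ) (z : ℕ → ℝ) (k : ℕ) : ℝ := if k < n then 0 else z (k - n)

theorem shiftZero_add (n : ℕ) (z : ℕ → ℝ) (k : ℕ) : shiftZero n z (n + k) = z k := by
  simp [shiftZero]

theorem bes_eq_one {θ : ℝ} (hθ : 0 < θ) {y : ℕ → ℝ} :
    ∀ {n : ℕ} {c : Fin n → ℝ}, StrictAnti c → (∀ k < n, y k = 0) → bes θ y n c = 1
  | 0, _, _, _ => rfl
  | n + 1, c, hc, hy => by
    have := isProbabilityMeasure_dixon hθ hc
    rw [bes, besStep_congr (g := fun _ => 1) fun b hb =>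
      bes_eq_one hθ hb fun k hk => hy k (hk.trans n.lt_succ_self)]
    simp [besStep, hy n n.lt_succ_self]

theorem abs_sum_sq_sub_sum_sq_le {b : Fin n → ℝ} {c : Fin (n + 1) → ℝ} (h : Interlaces b c) {R : ℝ}
    (hc : ∀ i, |c i| ≤ R) : |∑ i, b i ^ 2 - ∑ i, c i ^ 2| ≤ 5 * R ^ 2 := by
  have hb := abs_le_of_interlaces h hc
  have hR : 0 ≤ R := (abs_nonneg _).trans (hc 0)
  have hlast : c (Fin.last n) ^ 2 ≤ R ^ 2 := by
    rw [← sq_abs]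
    exact pow_le_pow_left₀ (abs_nonneg _) (hc _) 2
  have hterm : ∀ i ∈ Finset.univ, |b i ^ 2 - c (Fin.castSucc i) ^ 2| ≤
      2 * R * (c (Fin.castSucc i) - b i) := by
    intro i _
    have h1 := (h i).1
    have h2 : |b i + c (Fin.castSucc i)| ≤ 2 * R :=
      (abs_add_le _ _).trans (by linarith [hb i, hc (Fin.castSucc i)])
    rw [sq_sub_sq, abs_mul, abs_sub_comm, abs_of_pos (sub_pos.2 h1)]
    exact mul_le_mul_of_nonneg_right h2 (sub_pos.2 h1).le
  have hsum := (Finset.abs_sum_le_sum_abs _ _).trans (Finset.sum_le_sum hterm)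
  rw [← Finset.mul_sum, Finset.sum_sub_distrib, Finset.sum_sub_distrib] at hsum
  have hd := (abs_le.1 (abs_sum_sub_sum_le h hc)).2
  rw [Fin.sum_univ_castSucc] at hd
  have hl := (abs_le.1 (hc (Fin.last n))).1
  have h3 : 2 * R * (∑ i : Fin n, c i.castSucc - ∑ i, b i) ≤ 2 * R * (2 * R) :=
    mul_le_mul_of_nonneg_left (by linarith) (by linarith)
  rw [Fin.sum_univ_castSucc (f := fun i => c i ^ 2)]
  have h4 := abs_le.1 (hsum.trans h3)
  have h5 := sq_nonneg (c (Fin.last n))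
  exact abs_le.2 ⟨by linarith, by nlinarith⟩

theorem exists_abs_bes_sub_exp_le {θ : ℝ} (hθ : 0 < θ) (y : ℕ → ℝ) :
    ∀ (m : ℕ) {K : ℝ}, 0 ≤ K → ∀ D : ℕ, ∃ C : ℝ, 0 ≤ C ∧ ∃ N₀ : ℕ, ∀ N : ℕ, N₀ ≤ N →
      ∀ (n : ℕ) (c : Fin (n + m) → ℝ), StrictAnti c → n + m ≤ N → N ≤ n + m + D →
      (∀ i, |c i| ≤ K * N) → |∑ i, c i| ≤ K * N →
      |bes θ (shiftZero n fun j => y j / √N) (n + m) c -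
        Real.exp ((∑ i, c i ^ 2) / N ^ 3 * ((∑ j ∈ Finset.range m, y j ^ 2) / (2 * θ)))| ≤ C / √N
  | 0, K, _, D => ⟨0, le_rfl, 0, fun N _ n c hc _ _ _ _ => by
      have h : ∀ k < n + 0, shiftZero n (fun j => y j / √N) k = 0 := fun k hk => if_pos hk
      rw [bes_eq_one hθ hc h]
      simp⟩
  | m + 1, K, hK, D => by
    obtain ⟨C, hC, N₁, hN₁⟩ := exists_abs_bes_sub_exp_le hθ y m (K := 2 * K) (by positivity) (D + 1)
    obtain ⟨κ, hκ⟩ : ∃ κ, κ = (∑ j ∈ Finset.range m, y j ^ 2) / (2 * θ) := ⟨_, rfl⟩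
    have hκ0 : 0 ≤ κ := by rw [hκ]; positivity
    have hstep0 := stepConst_nonneg hθ hK (Nat.cast_nonneg D) (y m)
    obtain ⟨C₂, hC₂⟩ : ∃ C₂, C₂ = C + Real.exp (K ^ 2 * κ) * (5 * K ^ 2 * κ) := ⟨_, rfl⟩
    have hC₂0 : 0 ≤ C₂ := by rw [hC₂]; positivity
    obtain ⟨B, hB⟩ : ∃ B, B = Real.exp (K ^ 2 * (y m ^ 2 / (2 * θ))) + stepConst θ K D (y m) :=
      ⟨_, rfl⟩
    refine ⟨C₂ * B + stepConst θ K D (y m) * Real.exp (K ^ 2 * κ), by rw [hB]; positivity,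
      max N₁ (max 1 (max (2 * D) ⌈(8 * |y m| * K / θ) ^ 2⌉₊)),
      fun N hN n (c : Fin (n + m + 1) → ℝ) hc hle hD hcK hsum => ?_⟩
    change ∀ i : Fin (n + m + 1), |c i| ≤ _ at hcK
    change |∑ i : Fin (n + m + 1), c i| ≤ _ at hsum
    change |bes θ _ (n + m + 1) c -
      Real.exp ((∑ i : Fin (n + m + 1), c i ^ 2) / (N : ℝ) ^ 3 * _)| ≤ _
    have hNN₁ : N₁ ≤ N := (le_max_left _ _).trans hN
    have hN1 : 1 ≤ N := by omega
    have hN2D : 2 * D ≤ N := by omega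
    have hNy : (8 * |y m| * K / θ) ^ 2 ≤ N := Nat.ceil_le.1 (by omega)
    have hN1' : (1 : ℝ) ≤ N := by exact_mod_cast hN1
    have hN0 : (0 : ℝ) < N := by linarith
    have hr1 : 1 ≤ √(N : ℝ) := Real.one_le_sqrt.2 hN1'
    have hr0 : 0 < √(N : ℝ) := by linarith
    have hrN : √(N : ℝ) ≤ N := by nlinarith [Real.mul_self_sqrt hN0.le]
    have hle' : ((n + m : ℕ) + 1 : ℝ) ≤ N := by exact_mod_cast hle
    have hD' : (N : ℝ) ≤ (n + m : ℕ) + 1 + (D : ℝ) := by exact_mod_cast hD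
    have hhalf : (N : ℝ) ≤ 2 * ((n + m : ℕ) + 1) := by
      have : N ≤ 2 * (n + m + 1) := by omega
      exact_mod_cast this
    have hsmall : |y m| * K * √(N : ℝ) ≤ ((n + m : ℕ) + 1) * θ / 4 := by
      have h1 : 8 * |y m| * K / θ ≤ √(N : ℝ) := Real.le_sqrt_of_sq_le hNy
      rw [div_le_iff₀ hθ] at h1
      have h2 := mul_le_mul_of_nonneg_right h1 hr0.le
      have h3 := mul_le_mul_of_nonneg_right hhalf hθ.le
      have h4 : √(N : ℝ) * θ * √(N : ℝ) = N * θ := by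
        rw [mul_right_comm, Real.mul_self_sqrt hN0.le]
      linarith
    have hI := abs_integral_exp_dixon_sub_le hθ (n := n + m) hK hN1' hc hle' hD' hhalf hcK hsum
      hsmall
    have hV := sum_sq_div_le hN0 (by push_cast at hle' ⊢; linarith) hcK
    obtain ⟨V, hVdef⟩ : ∃ V, V = (∑ i, c i ^ 2) / (N : ℝ) ^ 3 := ⟨_, rfl⟩
    have hb : ∀ b : Fin (n + m) → ℝ, Interlaces b c →
        |bes θ (shiftZero n fun j => y j / √N) (n + m) b - Real.exp (V * κ)| ≤ C₂ / √N := by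
      intro b hbc
      have hbK := abs_le_of_interlaces hbc hcK
      have h1 := hN₁ N hNN₁ n b hbc.strictAnti (by omega) (by omega)
        (fun i => (hbK i).trans (by nlinarith)) (by
          have e1 := abs_le.1 (abs_sum_sub_sum_le hbc hcK)
          have e2 := abs_le.1 hsum
          exact abs_le.2 ⟨by linarith, by linarith⟩)
      rw [← hκ] at h1
      have hVb := sum_sq_div_le hN0 (by push_cast at hle' ⊢; linarith) hbK
      have h2 := abs_exp_sub_exp_le (mul_le_mul_of_nonneg_right hVb hκ0)
        (mul_le_mul_of_nonneg_right hV hκ0)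
      rw [← sub_mul, abs_mul, abs_of_nonneg hκ0, ← sub_div, abs_div,
        abs_of_pos (by positivity : (0 : ℝ) < (N : ℝ) ^ 3)] at h2
      have h3 : |∑ i, b i ^ 2 - ∑ i, c i ^ 2| / (N : ℝ) ^ 3 ≤ 5 * K ^ 2 / √N := by
        rw [div_le_div_iff₀ (by positivity) hr0]
        calc _ ≤ 5 * (K * N) ^ 2 * N := by
              gcongr
              exact abs_sum_sq_sub_sum_sq_le hbc hcK
          _ = _ := by ring
      have h4 : Real.exp (K ^ 2 * κ) * (|∑ i, b i ^ 2 - ∑ i, c i ^ 2| / (N : ℝ) ^ 3 * κ) ≤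
          Real.exp (K ^ 2 * κ) * (5 * K ^ 2 * κ) / √N := by
        calc _ ≤ Real.exp (K ^ 2 * κ) * (5 * K ^ 2 / √N * κ) := by gcongr
          _ = _ := by ring
      rw [hC₂, add_div, hVdef]
      exact (abs_sub_le _ _ _).trans (add_le_add h1 (h2.trans h4))
    rw [← hVdef] at hI hV ⊢
    have := isProbabilityMeasure_dixon hθ hc
    obtain ⟨I, hIdef⟩ : ∃ I, I = ∫ b, Real.exp (y m / √N * (∑ i, c i - ∑ i, b i)) ∂dixon θ c :=
      ⟨_, rfl⟩
    have hInt := integrable_exp_dixon hθ hc (y m / √N)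
    have hbes : |bes θ (shiftZero n fun j => y j / √N) (n + m + 1) c - I * Real.exp (V * κ)| ≤
        C₂ / √N * I := by
      have e : bes θ (shiftZero n fun j => y j / √N) (n + m + 1) c =
          ∫ b, Real.exp (y m / √N * (∑ i, c i - ∑ i, b i)) *
            bes θ (shiftZero n fun j => y j / √N) (n + m) b ∂dixon θ c := by
        change besStep θ (shiftZero n (fun j => y j / √N) (n + m)) _ c = _
        rw [shiftZero_add]
        rfl
      rw [e, hIdef, ← integral_mul_const, ← integral_sub
        (integrable_exp_mul_bes hθ _ _ hc) (hInt.mul_const _), ← integral_const_mul,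
        ← Real.norm_eq_abs]
      refine norm_integral_le_of_norm_le (hInt.const_mul _) ?_
      filter_upwards [ae_dixon_interlaces θ c] with b hbc
      rw [← mul_sub, norm_mul, Real.norm_eq_abs, Real.abs_exp, mul_comm]
      exact mul_le_mul_of_nonneg_right (hb b hbc) (Real.exp_nonneg _)
    rw [← hIdef] at hI
    have hVexp : Real.exp (V * (y m ^ 2 / (2 * θ))) ≤ Real.exp (K ^ 2 * (y m ^ 2 / (2 * θ))) :=
      Real.exp_le_exp.2 (mul_le_mul_of_nonneg_right hV (by positivity))
    have hIB : I ≤ B := by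
      have h1 := (abs_le.1 hI).2
      have h2 := div_le_self hstep0 hr1
      rw [hB]
      linarith
    have hIE : |I * Real.exp (V * κ) - Real.exp (V * (y m ^ 2 / (2 * θ))) * Real.exp (V * κ)| ≤
        stepConst θ K D (y m) / √N * Real.exp (K ^ 2 * κ) := by
      rw [← sub_mul, abs_mul, Real.abs_exp]
      refine mul_le_mul hI (Real.exp_le_exp.2 (mul_le_mul_of_nonneg_right hV hκ0))
        (Real.exp_nonneg _) (by positivity)
    have hexp : Real.exp (V * ((∑ j ∈ Finset.range (m + 1), y j ^ 2) / (2 * θ))) =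
        Real.exp (V * (y m ^ 2 / (2 * θ))) * Real.exp (V * κ) := by
      rw [← Real.exp_add, Finset.sum_range_succ, hκ]
      congr 1
      ring
    rw [hexp]
    refine (abs_sub_le _ _ _).trans ((add_le_add hbes hIE).trans ?_)
    calc C₂ / √N * I + stepConst θ K D (y m) / √N * Real.exp (K ^ 2 * κ)
        ≤ C₂ / √N * B + stepConst θ K D (y m) / √N * Real.exp (K ^ 2 * κ) := by gcongr
      _ = _ := by ring

theorem MBF_padC_eq_bes {θ : ℝ} (hθ : 0 < θ) {m n : ℕ} (h0 : n + m ≠ 0) {a : Fin (n + m) → ℝ}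
    (ha : StrictAnti a) (h : m ≤ n + m) (ys : Fin m → ℝ) (z : ℕ → ℝ)
    (hz : ∀ j (hj : j < m), z j = ys ⟨m - 1 - j, by omega⟩) :
    MBF θ a (padC h fun i => (ys i : ℂ)) = ((bes θ (shiftZero n z) (n + m) a : ℝ) : ℂ) := by
  obtain ⟨N, hN⟩ : ∃ N, n + m = N := ⟨_, rfl⟩
  have hbes : ∀ k < N, shiftZero n z k =
      if hk : N - 1 - k < m then ys ⟨N - 1 - k, hk⟩ else 0 := by
    intro k hk
    unfold shiftZero
    by_cases hkn : k < n
    · rw [if_pos hkn, dif_neg (by omega)]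
    · rw [if_neg hkn, dif_pos (by omega), hz _ (by omega)]
      congr 2
      omega
  generalize shiftZero n z = w at hbes ⊢
  subst hN
  revert a
  generalize n + m = N at *
  intro a ha
  obtain _ | N := N
  · exact absurd rfl h0
  have hpad : padC h (fun i => (ys i : ℂ)) = fun k : Fin (N + 1) =>
      (((if hk : k.1 < m then ys ⟨k, hk⟩ else 0 : ℝ)) : ℂ) := by
    funext k
    unfold padC
    split_ifs <;> simp
  rw [hpad, MBF_eq_bes hθ ha, ← bes_comp_perm hθ Fin.revPerm _ ha]
  rw [bes_congr fun k hk => ?_]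
  rw [hbes k hk, extendZero, dif_pos hk]
  simp only [Function.comp_apply, Fin.revPerm_apply, Fin.val_rev]
  have e : N + 1 - (k + 1) = N + 1 - 1 - k := by omega
  simp only [e]

theorem integral_empMeasure {N : ℕ} (a : Fin N → ℝ) {f : ℝ → ℝ} :
    ∫ t, f t ∂empMeasure a = (∑ i, f (a i / N)) / N := by
  rw [empMeasure, integral_smul_measure, integral_finsetSum_measure
    fun i _ => integrable_dirac (by simp)]
  simp [div_eq_inv_mul]

theorem abs_le_of_antitone {N : ℕ} (hN : 1 ≤ N) {a : Fin N → ℝ} (ha : Antitone a) {R : ℝ}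
    (h0 : |a ⟨0, by omega⟩| ≤ R) (h1 : |a ⟨N - 1, by omega⟩| ≤ R) (i : Fin N) : |a i| ≤ R := by
  have e0 : a i ≤ a ⟨0, by omega⟩ := ha (Fin.le_def.2 (Nat.zero_le _))
  have e1 : a ⟨N - 1, by omega⟩ ≤ a i := ha (Fin.le_def.2 (by simp; omega))
  exact abs_le.2 ⟨(abs_le.1 h1).1.trans e1, e0.trans (abs_le.1 h0).2⟩

/-- The truncation of a real number to `[-K, K]`, as a bounded continuous function. -/
def clampBCF (K : ℝ) : BoundedContinuousFunction ℝ ℝ :=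
  BoundedContinuousFunction.ofNormedAddCommGroup (fun t => max (-|K|) (min t |K|))
    (by fun_prop) |K| fun t => abs_le.2 ⟨le_max_left _ _, max_le (by linarith [abs_nonneg K])
      (min_le_right _ _)⟩

theorem clampBCF_apply {K t : ℝ} (h : |t| ≤ K) : clampBCF K t = t := by
  have hK : |K| = K := abs_of_nonneg ((abs_nonneg _).trans h)
  obtain ⟨h1, h2⟩ := abs_le.1 h
  change max (-|K|) (min t |K|) = t
  rw [hK, min_eq_left h2, max_eq_right h1]

namespace RegularSeq

variable {a : (N : ℕ) → Fin N → ℝ} {μ : Measure ℝ}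

theorem exists_bound (h : RegularSeq a μ) : ∃ K : ℝ, 0 ≤ K ∧ (∀ᵐ t ∂μ, |t| ≤ K) ∧
    ∀ N, 1 ≤ N → ∀ i, |a N i| ≤ K * N := by
  obtain ⟨hanti, ⟨C, hC⟩, _, ⟨R, hR⟩, _⟩ := h
  refine ⟨max 0 (max C R), le_max_left _ _, ?_, fun N hN i => ?_⟩
  · filter_upwards [show ∀ᵐ t ∂μ, |t| ≤ R from hR] with t ht
    exact ht.trans ((le_max_right _ _).trans (le_max_right _ _))
  · refine (abs_le_of_antitone hN (hanti N hN).antitone (hC N hN).1 (hC N hN).2 i).trans ?_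
    gcongr
    exact (le_max_left _ _).trans (le_max_right _ _)

theorem tendsto_sum_pow (h : RegularSeq a μ) (k : ℕ) :
    Tendsto (fun N : ℕ => (∑ i, (a N i / N) ^ k) / N) atTop (𝓝 (∫ t, t ^ k ∂μ)) := by
  obtain ⟨K, -, hμ, hK⟩ := h.exists_bound
  have hlim := h.2.2.2.2 (clampBCF K ^ k)
  rw [integral_congr_ae (g := fun t => t ^ k) (by
    filter_upwards [hμ] with t ht
    simp [clampBCF_apply ht])] at hlim
  refine hlim.congr' ?_
  filter_upwards [eventually_ge_atTop 1] with N hN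
  rw [integral_empMeasure]
  congr 1
  refine Finset.sum_congr rfl fun i _ => ?_
  have hN0 : (0 : ℝ) < N := by exact_mod_cast hN
  rw [BoundedContinuousFunction.coe_pow, Pi.pow_apply, clampBCF_apply]
  rw [abs_div, abs_of_pos hN0, div_le_iff₀ hN0]
  exact hK N hN i

theorem meanM_eq_zero (h : RegularSeq a μ) (hzero : ∀ N : ℕ, 1 ≤ N → ∑ i, a N i = 0) :
    meanM μ = 0 := by
  have hlim := h.tendsto_sum_pow 1
  simp only [pow_one] at hlim
  refine tendsto_nhds_unique hlim (tendsto_const_nhds.congr' ?_)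
  filter_upwards [eventually_ge_atTop 1] with N hN
  rw [← Finset.sum_div, hzero N hN, zero_div, zero_div]

theorem tendsto_sum_sq (h : RegularSeq a μ) (hzero : ∀ N : ℕ, 1 ≤ N → ∑ i, a N i = 0) :
    Tendsto (fun N : ℕ => (∑ i, a N i ^ 2) / (N : ℝ) ^ 3) atTop (𝓝 (varM μ)) := by
  rw [varM, h.meanM_eq_zero hzero, zero_pow two_ne_zero, sub_zero]
  refine (h.tendsto_sum_pow 2).congr fun N => ?_
  simp_rw [div_pow]
  rw [← Finset.sum_div, div_div, ← pow_succ]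

end RegularSeq

end MultivariateBessel

theorem mbf_pointwise_limit
    (θ : ℝ) (hθ : 0 < θ) (m : ℕ) (hm : 1 ≤ m)
    (ys : Fin m → ℝ) (hord : StrictAnti ys) (hpos : 0 < ys ⟨m - 1, by omega⟩)
    (hgap : ∀ i : ℕ, ∀ h2 : i + 2 < m,
      ys ⟨i + 2, h2⟩ < ys ⟨i, by omega⟩ - ys ⟨i + 1, by omega⟩)
    (a : (N : ℕ) → Fin N → ℝ) (μ : Measure ℝ) (hreg : RegularSeq a μ)
    (hzero : ∀ N : ℕ, 1 ≤ N → ∑ i, a N i = 0) :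
    Tendsto
      (fun N : ℕ =>
        if h : m ≤ N then
          MBF θ (a N) (padC h fun i => ((ys i / Real.sqrt N : ℝ) : ℂ))
        else 0)
      atTop
      (𝓝 (Complex.exp (((varM μ / (2 * θ) : ℝ) : ℂ) * ∑ i, (ys i : ℂ) ^ 2))) := by
  obtain ⟨K, hK0, -, hK⟩ := hreg.exists_bound
  obtain ⟨y, hy⟩ : ∃ y : ℕ → ℝ, ∀ j (hj : j < m), y j = ys ⟨m - 1 - j, by omega⟩ :=
    ⟨fun j => if hj : j < m then ys ⟨m - 1 - j, by omega⟩ else 0, fun j hj => dif_pos hj⟩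
  have hsum : ∑ j ∈ Finset.range m, y j ^ 2 = ∑ i, ys i ^ 2 := by
    rw [Finset.sum_range, ← Equiv.sum_comp Fin.revPerm fun i => ys i ^ 2]
    refine Finset.sum_congr rfl fun j _ => ?_
    rw [hy j j.2, Fin.revPerm_apply]
    congr 3
    omega
  obtain ⟨C, hC, N₀, hN₀⟩ := exists_abs_bes_sub_exp_le hθ y m hK0 0
  rw [hsum] at hN₀
  have hexp : Tendsto (fun N : ℕ => Real.exp ((∑ i, a N i ^ 2) / (N : ℝ) ^ 3 *
      ((∑ i, ys i ^ 2) / (2 * θ)))) atTop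
      (𝓝 (Real.exp (varM μ * ((∑ i, ys i ^ 2) / (2 * θ))))) :=
    (Real.continuous_exp.tendsto _).comp ((hreg.tendsto_sum_sq hzero).mul_const _)
  have herr : Tendsto (fun N : ℕ => C / √(N : ℝ)) atTop (𝓝 0) :=
    (Real.tendsto_sqrt_atTop.comp tendsto_natCast_atTop_atTop).const_div_atTop C
  have hlim : Tendsto (fun N : ℕ => ((Real.exp ((∑ i, a N i ^ 2) / (N : ℝ) ^ 3 *
      ((∑ i, ys i ^ 2) / (2 * θ))) : ℝ) : ℂ)) atTop
      (𝓝 (Complex.exp (((varM μ / (2 * θ) : ℝ) : ℂ) * ∑ i, (ys i : ℂ) ^ 2))) := by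
    have e : Complex.exp (((varM μ / (2 * θ) : ℝ) : ℂ) * ∑ i, (ys i : ℂ) ^ 2) =
        ((Real.exp (varM μ * ((∑ i, ys i ^ 2) / (2 * θ))) : ℝ) : ℂ) := by
      push_cast
      congr 1
      ring
    rw [e]
    exact (Complex.continuous_ofReal.tendsto _).comp hexp
  refine tendsto_of_tendsto_of_dist hlim (squeeze_zero' (.of_forall fun _ => dist_nonneg) ?_ herr)
  filter_upwards [eventually_ge_atTop (max N₀ m)] with N hN
  have hmN : m ≤ N := (le_max_right _ _).trans hN
  obtain ⟨n, rfl⟩ : ∃ n, N = n + m := ⟨N - m, by omega⟩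
  have hnm : 1 ≤ n + m := hm.trans hmN
  have ha := hreg.1 _ hnm
  rw [dif_pos hmN, MBF_padC_eq_bes hθ (by omega) ha hmN _ (fun j => y j / √(n + m : ℕ))
    (fun j hj => by rw [hy j hj]), dist_comm, dist_eq_norm, ← Complex.ofReal_sub, Complex.norm_real]
  refine hN₀ _ ((le_max_left _ _).trans hN) n _ ha le_rfl le_rfl (hK _ hnm) ?_
  rw [hzero _ hnm, abs_zero]
  positivity

end
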